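/- Let (v; w₀, …, w_{n−1}) be an embedded, immersed simplicial vertex star in ℝ³ whose Gauss image has no self-intersections and whose discrete Gaussian curvature K(v) is negative. Then exactly four of the faces are inflection faces: the set {i : ⟨wᵢ₋₁ − v, mᵢ⟩ · ⟨wᵢ₊₂ − v, mᵢ⟩ < 0} has exactly four elements. (Theorem 2.8 (ii): for a negatively curved vertex all of whose face angles are less than π, the Gauss image is a spherical pseudo-quadrilateral whose corners are the normals of the exactly four inflection faces of the vertex star.) -/

import Mathlib

open RealInnerProductSpace

noncomputable section

/-- Euclidean 3-space. -/
abbrev E3 : Type := EuclideanSpace ℝ (Fin 3)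

/-- The cross product on `E3`. -/
noncomputable def cross3 (a b : E3) : E3 :=
  (WithLp.equiv 2 (Fin 3 → ℝ)).symm
    ![a 1 * b 2 - a 2 * b 1, a 2 * b 0 - a 0 * b 2, a 0 * b 1 - a 1 * b 0]

/-- The face `Tᵢ = conv {v, wᵢ, wᵢ₊₁}` of a simplicial vertex star `(v; w)`;
indices are taken modulo `n`. -/
def starFace {n : ℕ} (v : E3) (w : ZMod n → E3) (i : ZMod n) : Set E3 :=
  convexHull ℝ {v, w i, w (i + 1)}

/-- The unnormalized face normal `mᵢ = (wᵢ − v) × (wᵢ₊₁ − v)`. -/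
noncomputable def starFN {n : ℕ} (v : E3) (w : ZMod n → E3) (i : ZMod n) : E3 :=
  cross3 (w i - v) (w (i + 1) - v)

/-- The unit face normal `nᵢ = mᵢ / ‖mᵢ‖`. -/
noncomputable def starUN {n : ℕ} (v : E3) (w : ZMod n → E3) (i : ZMod n) : E3 :=
  ‖starFN v w i‖⁻¹ • starFN v w i

/-- `(v; w₀, …, w_{n−1})` is an embedded, immersed simplicial vertex star:
`n ≥ 3`; consecutive edge vectors are linearly independent; distinct faces meet
exactly in their common edge (adjacent case) or in `{v}` (non-adjacent case);
and consecutive unit normals satisfy `nᵢ₊₁ ≠ ±nᵢ`. -/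
def IsStar {n : ℕ} (v : E3) (w : ZMod n → E3) : Prop :=
  3 ≤ n ∧
  (∀ i : ZMod n, LinearIndependent ℝ ![w i - v, w (i + 1) - v]) ∧
  (∀ i : ZMod n, starUN v w (i + 1) ≠ starUN v w i ∧ starUN v w (i + 1) ≠ -starUN v w i) ∧
  (∀ i j : ZMod n, i ≠ j →
    (j = i + 1 → starFace v w i ∩ starFace v w j = segment ℝ v (w j)) ∧
    (i = j + 1 → starFace v w i ∩ starFace v w j = segment ℝ v (w i)) ∧
    (j ≠ i + 1 → i ≠ j + 1 → starFace v w i ∩ starFace v w j = {v}))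

/-- The shorter great-circle arc `Arc(p, q)` joining two unit vectors `p ≠ ±q`. -/
def sArc (p q : E3) : Set E3 :=
  {x | ∃ s t : ℝ, 0 ≤ s ∧ 0 ≤ t ∧ 0 < s + t ∧ x = ‖s • p + t • q‖⁻¹ • (s • p + t • q)}

/-- The Gauss image of the vertex star (the spherical polygon with vertices `nᵢ` and
edges `Arc(nᵢ, nᵢ₊₁)`) has no self-intersections. -/
def GaussEmb {n : ℕ} (v : E3) (w : ZMod n → E3) : Prop :=
  Function.Injective (starUN v w) ∧
  ∀ i j : ZMod n, i ≠ j →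
    (j = i + 1 →
      sArc (starUN v w i) (starUN v w (i + 1)) ∩ sArc (starUN v w j) (starUN v w (j + 1)) =
        {starUN v w j}) ∧
    (i = j + 1 →
      sArc (starUN v w i) (starUN v w (i + 1)) ∩ sArc (starUN v w j) (starUN v w (j + 1)) =
        {starUN v w i}) ∧
    (j ≠ i + 1 → i ≠ j + 1 →
      sArc (starUN v w i) (starUN v w (i + 1)) ∩ sArc (starUN v w j) (starUN v w (j + 1)) = ∅)

/-- The discrete Gaussian curvature (angle defect)
`K(v) = 2π − Σᵢ ∠(wᵢ − v, wᵢ₊₁ − v)`. -/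
noncomputable def curv {n : ℕ} [NeZero n] (v : E3) (w : ZMod n → E3) : ℝ :=
  2 * Real.pi - ∑ i : ZMod n, InnerProductGeometry.angle (w i - v) (w (i + 1) - v)

/-- The face `Tᵢ` is an inflection face: its two neighboring faces lie strictly on
opposite sides of its plane. -/
def IsInflectionFace {n : ℕ} (v : E3) (w : ZMod n → E3) (i : ZMod n) : Prop :=
  ⟪w (i - 1) - v, starFN v w i⟫ * ⟪w (i + 2) - v, starFN v w i⟫ < 0

/-- The carrier `Star = ⋃ᵢ Tᵢ` of the vertex star. -/
def starCarrier {n : ℕ} (v : E3) (w : ZMod n → E3) : Set E3 :=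
  ⋃ i : ZMod n, starFace v w i

namespace GS
open Filter Topology

/-- A total linear functional on `α → ℚ` extending eventual values along a filter. -/
theorem exists_lim {α : Type} (l : Filter α) [l.NeBot] :
    ∃ L : (α → ℚ) →ₗ[ℚ] ℚ, ∀ f c, (∀ᶠ x in l, f x = c) → L f = c := by
  let S : Submodule ℚ (α → ℚ) :=
    { carrier := {f | ∀ᶠ x in l, f x = 0}
      add_mem' := by
        intro a b ha hb
        filter_upwards [ha, hb] with x h1 h2
        simp [h1, h2]
      zero_mem' := by simp
      smul_mem' := by
        intro c f hf
        filter_upwards [hf] with x h1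
        simp [h1] }
  let ι : ℚ →ₗ[ℚ] ((α → ℚ) ⧸ S) := S.mkQ ∘ₗ (LinearMap.toSpanSingleton ℚ (α → ℚ) (fun _ => 1))
  have hι : LinearMap.ker ι = ⊥ := by
    rw [LinearMap.ker_eq_bot']
    intro q hq
    have : (LinearMap.toSpanSingleton ℚ (α → ℚ) (fun _ => 1)) q ∈ S := by
      rw [← Submodule.Quotient.mk_eq_zero]; exact hq
    have h2 : ∀ᶠ x in l, q = 0 := by
      have h3 : ∀ᶠ x in l, ((LinearMap.toSpanSingleton ℚ (α → ℚ) (fun _ => 1)) q) x = 0 := this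
      filter_upwards [h3] with x hx
      simpa using hx
    exact h2.exists.choose_spec
  obtain ⟨g, hg⟩ := LinearMap.exists_leftInverse_of_injective ι hι
  refine ⟨g ∘ₗ S.mkQ, fun f c hf => ?_⟩
  have h1 : S.mkQ f = ι c := by
    have : f - (LinearMap.toSpanSingleton ℚ (α → ℚ) (fun _ => 1)) c ∈ S := by
      change ∀ᶠ x in l, _
      filter_upwards [hf] with x hx
      simp [hx]
    have := (Submodule.Quotient.eq S).2 this
    exact this
  have h2 := LinearMap.congr_fun hg c
  simp only [LinearMap.comp_apply] at h2 ⊢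
  rw [h1]; simpa using h2

def lim {α : Type} (l : Filter α) [l.NeBot] : (α → ℚ) →ₗ[ℚ] ℚ := (exists_lim l).choose

theorem lim_eq {α : Type} {l : Filter α} [l.NeBot] {f : α → ℚ} {c : ℚ}
    (h : ∀ᶠ x in l, f x = c) : lim l f = c := (exists_lim l).choose_spec f c h

/-- jump functional -/
def rl (φ : ℝ → ℚ) (s : ℝ) : ℚ := φ s - lim (𝓝[>] (0:ℝ)) (fun δ => φ (s + δ))

def E1 (φ : ℝ → ℚ) : ℚ :=
  lim (atTop : Filter (Finset ℝ)) (fun S => ∑ s ∈ S, rl φ s) - lim (atTop : Filter ℝ) (fun M => φ (-M))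

theorem rl_add (φ ψ : ℝ → ℚ) (s : ℝ) : rl (φ + ψ) s = rl φ s + rl ψ s := by
  unfold rl
  have : (fun δ => (φ + ψ) (s + δ)) = (fun δ => φ (s + δ)) + (fun δ => ψ (s + δ)) := rfl
  rw [this, map_add]; simp; ring

theorem rl_smul (c : ℚ) (ψ : ℝ → ℚ) (s : ℝ) : rl (c • ψ) s = c * rl ψ s := by
  unfold rl
  have : (fun δ => (c • ψ) (s + δ)) = c • (fun δ => ψ (s + δ)) := rfl
  rw [this, map_smul]; simp; ring

theorem E1_add (φ ψ : ℝ → ℚ) : E1 (φ + ψ) = E1 φ + E1 ψ := by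
  unfold E1
  have h1 : (fun S : Finset ℝ => ∑ s ∈ S, rl (φ + ψ) s)
      = (fun S : Finset ℝ => ∑ s ∈ S, rl φ s) + (fun S : Finset ℝ => ∑ s ∈ S, rl ψ s) := by
    funext S; simp [rl_add, Finset.sum_add_distrib]
  have h2 : (fun δ => (φ + ψ) (-δ)) = (fun δ => φ (-δ)) + (fun δ => ψ (-δ)) := rfl
  rw [h1, h2, map_add, map_add]; ring

theorem E1_smul (c : ℚ) (ψ : ℝ → ℚ) : E1 (c • ψ) = c * E1 ψ := by
  unfold E1
  have h1 : (fun S : Finset ℝ => ∑ s ∈ S, rl (c • ψ) s)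
      = c • (fun S : Finset ℝ => ∑ s ∈ S, rl ψ s) := by
    funext S; simp [rl_smul, Finset.mul_sum]
  have h2 : (fun δ => (c • ψ) (-δ)) = c • (fun δ => ψ (-δ)) := rfl
  rw [h1, h2, map_smul, map_smul]; simp; ring

open Classical in
/-- indicator -/
def ind {V : Type} (s : Set V) (x : V) : ℚ := if x ∈ s then 1 else 0

theorem ind_mem {V : Type} {s : Set V} {x : V} (h : x ∈ s) : ind s x = 1 := by simp [ind, h]
theorem ind_not {V : Type} {s : Set V} {x : V} (h : x ∉ s) : ind s x = 0 := by simp [ind, h]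

theorem E1_zero : E1 (fun _ => 0) = 0 := by
  have := E1_smul 0 (fun _ => 0)
  rw [zero_mul] at this
  convert this using 2
  funext x; simp

/-- closed ray upward: value 0, and helper -/
theorem rl_of {φ : ℝ → ℚ} {s c : ℝ} {q : ℚ} (hc : s < c) (h : ∀ t, s < t → t < c → φ t = q) :
    rl φ s = φ s - q := by
  unfold rl
  rw [lim_eq (c := q)]
  have : Set.Ioo (0:ℝ) (c - s) ∈ 𝓝[>] (0:ℝ) := Ioo_mem_nhdsGT (by linarith)
  filter_upwards [this] with d hd
  exact h _ (by linarith [hd.1]) (by linarith [hd.2])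

theorem E1_of {φ : ℝ → ℚ} {a : ℝ} {q r : ℚ} (h0 : ∀ s, s ≠ a → rl φ s = 0) (ha : rl φ a = q)
    (hb : ∃ M, ∀ t < M, φ t = r) : E1 φ = q - r := by
  unfold E1
  rw [lim_eq (c := q), lim_eq (c := r)]
  · obtain ⟨M, hM⟩ := hb
    filter_upwards [eventually_gt_atTop (-M)] with t ht
    exact hM _ (by linarith)
  · filter_upwards [eventually_ge_atTop {a}] with S hS
    rw [Finset.sum_eq_single a]
    · exact ha
    · intro b _ hb; exact h0 b hb
    · intro h; exact absurd (hS (by simp)) h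

theorem E1_point (a : ℝ) : E1 (ind {a}) = 1 := by
  have := E1_of (φ := ind {a}) (a := a) (q := 1) (r := 0) ?_ ?_ ⟨a, ?_⟩
  · simpa using this
  · intro s hs
    rcases lt_or_gt_of_ne hs with h | h
    · rw [rl_of (c := a) (q := 0) h]
      · simp [ind, hs]
      · intro t _ h2; simp [ind, h2.ne]
    · rw [rl_of (c := s + 1) (q := 0) (by linarith)]
      · simp [ind, hs]
      · intro t h1 h2; simp [ind, (h.trans h1).ne']
  · rw [rl_of (c := a + 1) (q := 0) (by linarith)]
    · simp [ind]
    · intro t h1 h2; simp [ind, h1.ne']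
  · intro t ht; simp [ind, ht.ne]

theorem E1_Ici (a : ℝ) : E1 (ind (Set.Ici a)) = 0 := by
  have := E1_of (φ := ind (Set.Ici a)) (a := a) (q := 0) (r := 0) ?_ ?_ ⟨a, ?_⟩
  · simpa using this
  · intro s hs
    rcases lt_or_gt_of_ne hs with h | h
    · rw [rl_of (c := a) (q := 0) h]
      · simp [ind, h]
      · intro t _ h2; simp [ind, h2]
    · rw [rl_of (c := s + 1) (q := 1) (by linarith)]
      · simp [ind, h.le]
      · intro t h1 h2; simp [ind, (h.trans h1).le]
  · rw [rl_of (c := a + 1) (q := 1) (by linarith)]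
    · simp [ind]
    · intro t h1 h2; simp [ind, h1.le]
  · intro t ht; simp [ind, ht]

theorem E1_open {I : Set ℝ} (ho : IsOpen I) (hc : Convex ℝ I) (hn : I.Nonempty) :
    E1 (ind I) = -1 := by
  have hoc : I.OrdConnected := hc.ordConnected
  obtain ⟨x, hx⟩ := hn
  -- right limit at points of I
  have hin : ∀ s ∈ I, rl (ind I) s = 0 := by
    intro s hs
    obtain ⟨e, he, hb⟩ := Metric.isOpen_iff.1 ho s hs
    rw [rl_of (c := s + e) (q := 1) (by linarith)]
    · simp [ind, hs]
    · intro t h1 h2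
      exact ind_mem (hb (by rw [Metric.mem_ball, Real.dist_eq, abs_lt]; constructor <;> linarith))
  have hup : ∀ s ∉ I, x < s → rl (ind I) s = 0 := by
    intro s hs hxs
    rw [rl_of (c := s + 1) (q := 0) (by linarith)]
    · simp [ind, hs]
    · intro t h1 h2
      exact ind_not fun ht => hs (hoc.out hx ht ⟨hxs.le, h1.le⟩)
  by_cases hbd : BddBelow I
  · set a := sInf I with ha
    have hxa : a ≤ x := csInf_le hbd hx
    have haI : a ∉ I := by
      intro h
      obtain ⟨e, he, hb⟩ := Metric.isOpen_iff.1 ho a h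
      have : a - e/2 ∈ I := hb (by rw [Metric.mem_ball, Real.dist_eq, abs_lt]; constructor <;> linarith)
      have := csInf_le hbd this
      linarith
    have hax : a < x := lt_of_le_of_ne hxa (fun h => haI (h ▸ hx))
    have hmem : ∀ t, a < t → t < x → t ∈ I := by
      intro t h1 h2
      obtain ⟨y, hy, hyt⟩ := exists_lt_of_csInf_lt ⟨x, hx⟩ h1
      exact hoc.out hy hx ⟨hyt.le, h2.le⟩
    have := E1_of (φ := ind I) (a := a) (q := -1) (r := 0) ?_ ?_ ⟨a, ?_⟩
    · simpa using this
    · intro s hs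
      by_cases hsI : s ∈ I
      · exact hin s hsI
      rcases lt_trichotomy x s with h | h | h
      · exact hup s hsI h
      · exact absurd (h ▸ hx) hsI
      · have hsa : s < a := by
          rcases lt_or_gt_of_ne hs with h1 | h1
          · exact h1
          · exact absurd (hmem s h1 h) hsI
        rw [rl_of (c := a) (q := 0) hsa]
        · simp [ind, hsI]
        · intro t _ h2; exact ind_not fun ht => absurd (csInf_le hbd ht) (not_le.2 h2)
    · rw [rl_of (c := x) (q := 1) hax]
      · simp [ind, haI]
      · intro t h1 h2; exact ind_mem (hmem t h1 h2)
    · intro t ht; exact ind_not fun h => absurd (csInf_le hbd h) (not_le.2 ht)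
  · have hall : ∀ t < x, t ∈ I := by
      intro t ht
      rw [not_bddBelow_iff] at hbd
      obtain ⟨y, hy, hyt⟩ := hbd t
      exact hoc.out hy hx ⟨hyt.le, ht.le⟩
    have h0 : ∀ s, rl (ind I) s = 0 := by
      intro s
      by_cases hsI : s ∈ I
      · exact hin s hsI
      rcases lt_trichotomy x s with h | h | h
      · exact hup s hsI h
      · exact absurd (h ▸ hx) hsI
      · exact absurd (hall s h) hsI
    have := E1_of (φ := ind I) (a := x) (q := 0) (r := 1) (fun s _ => h0 s) (h0 x)
      ⟨x, fun t ht => ind_mem (hall t ht)⟩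
    simpa using this

end GS

namespace GS
open Filter Topology Module

/-- relatively open convex -/
def RO (C : Set E3) : Prop :=
  Convex ℝ C ∧ ∀ x ∈ C, ∀ y ∈ C, ∃ ε : ℝ, 0 < ε ∧ y + ε • (y - x) ∈ C

theorem conv_le {C : Set E3} (hC : Convex ℝ C) {p v : E3} (hp : p ∈ C) {e t : ℝ}
    (h : p + e • v ∈ C) (h0 : 0 ≤ t) (ht : t ≤ e) : p + t • v ∈ C := by
  rcases eq_or_lt_of_le (h0.trans ht) with h1 | h1
  · have : t = 0 := by linarith
    simpa [this] using hp
  · have := hC hp h (a := 1 - t/e) (b := t/e) (by rw [sub_nonneg, div_le_one h1]; exact ht) (by positivity) (by ring)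
    convert this using 1
    rw [smul_add, smul_smul, div_mul_cancel₀ _ h1.ne']; module

theorem RO.dir {C : Set E3} (hC : RO C) {p : E3} (hp : p ∈ C) {v : E3} (hv : v ∈ vectorSpan ℝ C) :
    ∃ ε : ℝ, 0 < ε ∧ p + ε • v ∈ C := by
  let S : Submodule ℝ E3 :=
    { carrier := {v | ∃ ε : ℝ, 0 < ε ∧ p + ε • v ∈ C}
      add_mem' := by
        rintro a b ⟨e, he, h1⟩ ⟨f, hf, h2⟩
        refine ⟨min e f / 2, by positivity, ?_⟩
        have h3 := conv_le hC.1 hp h1 (t := min e f) (by positivity) (min_le_left _ _)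
        have h4 := conv_le hC.1 hp h2 (t := min e f) (by positivity) (min_le_right _ _)
        have := (show Convex ℝ C from hC.1) h3 h4 (a := (1/2:ℝ)) (b := (1/2:ℝ)) (by norm_num) (by norm_num) (by norm_num)
        convert this using 1
        module
      zero_mem' := ⟨1, one_pos, by simpa using hp⟩
      smul_mem' := by
        rintro c x ⟨e, he, h1⟩
        rcases lt_trichotomy c 0 with hc | hc | hc
        · obtain ⟨d, hd, h2⟩ := hC.2 _ h1 _ hp
          refine ⟨d * e / (-c), by have : 0 < -c := by linarith
                                   positivity, ?_⟩
          convert h2 using 1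
          rw [smul_smul]
          have : d * e / -c * c = - (d * e) := by
            have := hc.ne
            field_simp
          rw [this]; module
        · exact ⟨1, one_pos, by simpa [hc] using hp⟩
        · refine ⟨e / c, by positivity, ?_⟩
          rw [smul_smul, div_mul_cancel₀ _ hc.ne']; exact h1 }
  have : vectorSpan ℝ C ≤ S := by
    rw [vectorSpan_eq_span_vsub_set_right ℝ hp, Submodule.span_le]
    rintro _ ⟨x, hx, rfl⟩
    exact ⟨1, one_pos, by simpa using hx⟩
  exact this hv

theorem RO.inter {C D : Set E3} (hC : RO C) (hD : RO D) : RO (C ∩ D) := by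
  refine ⟨hC.1.inter hD.1, fun x hx y hy => ?_⟩
  obtain ⟨e, he, h1⟩ := hC.2 x hx.1 y hy.1
  obtain ⟨f, hf, h2⟩ := hD.2 x hx.2 y hy.2
  exact ⟨min e f, by positivity, conv_le hC.1 hy.1 h1 (by positivity) (min_le_left _ _),
    conv_le hD.1 hy.2 h2 (by positivity) (min_le_right _ _)⟩

theorem RO.vectorSpan_inter {C D : Set E3} (hC : RO C) (hD : RO D) (hn : (C ∩ D).Nonempty) :
    vectorSpan ℝ (C ∩ D) = vectorSpan ℝ C ⊓ vectorSpan ℝ D := by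
  apply le_antisymm
  · exact le_inf (vectorSpan_mono ℝ Set.inter_subset_left) (vectorSpan_mono ℝ Set.inter_subset_right)
  · rintro v ⟨h1, h2⟩
    obtain ⟨p, hp⟩ := hn
    obtain ⟨e, he, h1⟩ := hC.dir hp.1 h1
    obtain ⟨f, hf, h2⟩ := hD.dir hp.2 h2
    have : p + (min e f) • v ∈ C ∩ D := ⟨conv_le hC.1 hp.1 h1 (by positivity) (min_le_left _ _),
      conv_le hD.1 hp.2 h2 (by positivity) (min_le_right _ _)⟩
    have h3 := vsub_mem_vectorSpan ℝ this hp
    have h4 : (p + (min e f) • v) -ᵥ p = (min e f) • v := by simp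
    rw [h4] at h3
    have hm : min e f ≠ 0 := by positivity
    exact (Submodule.smul_mem_iff _ hm).1 h3

theorem RO_lt (p : E3) : RO {x | ⟪p, x⟫ < 0} := by
  refine ⟨?_, ?_⟩
  · intro x hx y hy a b ha hb hab
    simp only [Set.mem_ofPred_eq, inner_add_right, inner_smul_right] at *
    rcases eq_or_lt_of_le ha with h | h
    · have : b = 1 := by linarith
      subst this; subst h; simpa using hy
    · nlinarith [mul_neg_of_pos_of_neg h hx, mul_nonpos_of_nonneg_of_nonpos hb hy.le]
  · intro x hx y hy
    simp only [Set.mem_ofPred_eq, inner_add_right, inner_smul_right, inner_sub_right] at *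
    refine ⟨⟪p,y⟫ / (2 * ⟪p,x⟫) , div_pos_of_neg_of_neg hy (by linarith), ?_⟩
    have : ⟪p,y⟫ / (2 * ⟪p,x⟫) * (⟪p,y⟫ - ⟪p,x⟫) = ⟪p,y⟫ / (2 * ⟪p,x⟫) * ⟪p,y⟫  - ⟪p,y⟫ / 2 := by
      field_simp [hx.ne]
    rw [this]
    have : 0 < ⟪p,y⟫ / (2 * ⟪p,x⟫) := div_pos_of_neg_of_neg hy (by linarith)
    nlinarith [mul_neg_of_pos_of_neg this hy]

theorem RO_sub (K : Submodule ℝ E3) : RO (K : Set E3) := by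
  refine ⟨K.convex, fun x hx y hy => ⟨1, one_pos, ?_⟩⟩
  exact K.add_mem hy (K.smul_mem _ (K.sub_mem hy hx))

theorem RO_eq (p : E3) : RO {x | ⟪p, x⟫ = 0} := by
  have := RO_sub (LinearMap.ker (innerₛₗ ℝ p))
  convert this using 1
  ext x; simp

/-- shadow along `v` -/
def sh (v : E3) (C : Set E3) : Set E3 := {w | ∃ t : ℝ, w + t • v ∈ C}

theorem RO.sh {C : Set E3} (hC : RO C) (v : E3) : RO (sh v C) := by
  refine ⟨?_, ?_⟩
  · rintro x ⟨s, hs⟩ y ⟨t, ht⟩ a b ha hb hab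
    refine ⟨a * s + b * t, ?_⟩
    convert hC.1 hs ht ha hb hab using 1
    module
  · rintro x ⟨s, hs⟩ y ⟨t, ht⟩
    obtain ⟨e, he, h⟩ := hC.2 _ hs _ ht
    refine ⟨e, he, t + e * (t - s), ?_⟩
    convert h using 1
    module

theorem vectorSpan_sh {C : Set E3} (hn : C.Nonempty) (v : E3) :
    vectorSpan ℝ (sh v C) = vectorSpan ℝ C ⊔ Submodule.span ℝ {v} := by
  apply le_antisymm
  · rw [vectorSpan_def, Submodule.span_le]
    rintro _ ⟨x, ⟨s, hs⟩, y, ⟨t, ht⟩, rfl⟩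
    have h1 := vsub_mem_vectorSpan ℝ hs ht
    have : x -ᵥ y = ((x + s • v) -ᵥ (y + t • v)) + (t - s) • v := by
      simp only [vsub_eq_sub]; module
    simp only [SetLike.mem_coe]
    rw [this]
    exact Submodule.add_mem_sup h1 (Submodule.smul_mem _ _ (Submodule.mem_span_singleton_self v))
  · apply sup_le
    · exact vectorSpan_mono ℝ fun x hx => ⟨0, by simpa using hx⟩
    · rw [Submodule.span_singleton_le_iff_mem]
      obtain ⟨p, hp⟩ := hn
      have h1 : p + v ∈ GS.sh v C := ⟨-1, by simpa using hp⟩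
      have h2 : p ∈ GS.sh v C := ⟨0, by simpa using hp⟩
      have := vsub_mem_vectorSpan ℝ h1 h2
      simpa using this

/-- fiberwise Euler integral -/
def IE (v : E3) : (E3 → ℚ) →ₗ[ℚ] (E3 → ℚ) where
  toFun φ := fun w => E1 (fun t => φ (w + t • v))
  map_add' φ ψ := by
    funext w
    exact E1_add (fun t => φ (w + t • v)) (fun t => ψ (w + t • v))
  map_smul' c φ := by
    funext w
    exact E1_smul c (fun t => φ (w + t • v))

theorem IE_not_mem {C : Set E3} {v w : E3} (hw : w ∉ sh v C) : IE v (ind C) w = 0 := by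
  change E1 _ = 0
  rw [← E1_zero]; congr 1; funext t
  exact ind_not fun h => hw ⟨t, h⟩

open Classical in
theorem IE_ind {C : Set E3} (hC : RO C) (v : E3) :
    IE v (ind C) = (if v ∈ vectorSpan ℝ C then (-1 : ℚ) else 1) • ind (sh v C) := by
  funext w
  by_cases hw : w ∈ sh v C
  swap
  · rw [IE_not_mem hw]; simp [ind_not hw]
  obtain ⟨t0, ht0⟩ := hw
  have hw : w ∈ sh v C := ⟨t0, ht0⟩
  rw [Pi.smul_apply, ind_mem hw]
  change E1 (ind {t : ℝ | w + t • v ∈ C}) = _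
  split_ifs with hv
  · rw [E1_open]; · simp
    · rw [Metric.isOpen_iff]
      intro t ht
      obtain ⟨e, he, h1⟩ := hC.dir ht hv
      obtain ⟨f, hf, h2⟩ := hC.dir ht (Submodule.neg_mem _ hv)
      refine ⟨min e f, by positivity, fun s hs => ?_⟩
      rw [Metric.mem_ball, Real.dist_eq, abs_lt] at hs
      rcases le_total t s with h | h
      · have := conv_le hC.1 ht h1 (t := s - t) (by linarith) (by linarith [min_le_left e f])
        change w + s • v ∈ C
        convert this using 1; module
      · have := conv_le hC.1 ht h2 (t := t - s) (by linarith) (by linarith [min_le_right e f])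
        change w + s • v ∈ C
        convert this using 1; module
    · intro s hs t ht a b ha hb hab
      change w + (a • s + b • t) • v ∈ C
      have := hC.1 hs ht ha hb hab
      convert this using 1
      obtain rfl : a = 1 - b := by linarith
      simp only [smul_eq_mul]; module
    · exact ⟨t0, ht0⟩
  · have : {t : ℝ | w + t • v ∈ C} = {t0} := by
      ext t
      refine ⟨fun ht => ?_, fun ht => ?_⟩
      · by_contra hne
        have h1 := vsub_mem_vectorSpan ℝ (show w + t • v ∈ C from ht) ht0
        have : (w + t • v) -ᵥ (w + t0 • v) = (t - t0) • v := by simp only [vsub_eq_sub]; module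
        rw [this] at h1
        exact hv ((Submodule.smul_mem_iff _ (sub_ne_zero.2 hne)).1 h1)
      · rw [Set.mem_singleton_iff.1 ht]; exact ht0
    rw [this, E1_point]; simp

/-- Euler integral in an ordered basis -/
def EB (b : Fin 3 → E3) : (E3 → ℚ) →ₗ[ℚ] ℚ :=
  (LinearMap.proj 0) ∘ₗ (IE (b 0)) ∘ₗ (IE (b 1)) ∘ₗ (IE (b 2))

open Classical in
theorem finrank_sup' (D : Submodule ℝ E3) (v : E3) :
    (-1 : ℚ) ^ (finrank ℝ (D ⊔ Submodule.span ℝ {v} : Submodule ℝ E3)) *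
      (if v ∈ D then (-1 : ℚ) else 1) = - (-1 : ℚ) ^ (finrank ℝ D) := by
  split_ifs with h
  · rw [sup_eq_left.2 ((Submodule.span_singleton_le_iff_mem v D).2 h)]; ring
  · rw [Submodule.finrank_sup_span_singleton h, pow_succ]; ring

theorem EB_ind {C : Set E3} (hC : RO C) (hn : C.Nonempty) (b : Fin 3 → E3)
    (hb : Submodule.span ℝ (Set.range b) = ⊤) :
    EB b (ind C) = (-1) ^ (finrank ℝ (vectorSpan ℝ C)) := by
  classical
  have n1 : (sh (b 2) C).Nonempty := hn.imp fun x hx => ⟨0, by simpa using hx⟩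
  have n2 : (sh (b 1) (sh (b 2) C)).Nonempty := n1.imp fun x hx => ⟨0, by simpa using hx⟩
  have n3 : (sh (b 0) (sh (b 1) (sh (b 2) C))).Nonempty := n2.imp fun x hx => ⟨0, by simpa using hx⟩
  have hR1 := hC.sh (b 2)
  have hR2 := hR1.sh (b 1)
  have hR3 := hR2.sh (b 0)
  have e1 := vectorSpan_sh hn (b 2)
  have e2 := vectorSpan_sh n1 (b 1)
  have e3 := vectorSpan_sh n2 (b 0)
  have htop : vectorSpan ℝ (sh (b 0) (sh (b 1) (sh (b 2) C))) = ⊤ := by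
    rw [eq_top_iff, ← hb, Submodule.span_le]
    rintro _ ⟨i, rfl⟩
    rw [e3, e2, e1]
    fin_cases i
    · exact Submodule.mem_sup_right (Submodule.mem_span_singleton_self _)
    · exact Submodule.mem_sup_left (Submodule.mem_sup_right (Submodule.mem_span_singleton_self _))
    · exact Submodule.mem_sup_left (Submodule.mem_sup_left (Submodule.mem_sup_right (Submodule.mem_span_singleton_self _)))
  have h0 : (0 : E3) ∈ sh (b 0) (sh (b 1) (sh (b 2) C)) := by
    obtain ⟨p, hp⟩ := hn
    have h1 : -p ∈ Submodule.span ℝ (Set.range b) := by rw [hb]; trivial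
    rw [Submodule.mem_span_range_iff_exists_fun] at h1
    obtain ⟨c, hc⟩ := h1
    rw [Fin.sum_univ_three] at hc
    refine ⟨-c 0, -c 1, - c 2, ?_⟩
    convert hp using 1
    have : p = -(c 0 • b 0 + c 1 • b 1 + c 2 • b 2) := by rw [hc]; simp
    rw [this]; module
  have f1 := finrank_sup' (vectorSpan ℝ C) (b 2)
  have f2 := finrank_sup' (vectorSpan ℝ (sh (b 2) C)) (b 1)
  have f3 := finrank_sup' (vectorSpan ℝ (sh (b 1) (sh (b 2) C))) (b 0)
  rw [← e1] at f1
  rw [← e2] at f2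
  rw [← e3, htop, finrank_top, finrank_euclideanSpace_fin] at f3
  simp only [EB, LinearMap.comp_apply, LinearMap.proj_apply]
  rw [IE_ind hC, map_smul, IE_ind hR1, map_smul, map_smul, IE_ind hR2]
  simp only [Pi.smul_apply, ind_mem h0, smul_eq_mul]
  generalize (if b 2 ∈ vectorSpan ℝ C then (-1:ℚ) else 1) = x at *
  generalize (if b 1 ∈ vectorSpan ℝ (sh (b 2) C) then (-1:ℚ) else 1) = y at *
  generalize (if b 0 ∈ vectorSpan ℝ (sh (b 1) (sh (b 2) C)) then (-1:ℚ) else 1) = z at *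
  have : z = (-1)^(finrank ℝ (vectorSpan ℝ (sh (b 1) (sh (b 2) C)))) := by linarith
  rw [mul_one, this]
  linear_combination (-1) * f1 + x * f2

/-- constructible functions -/
def CF : Submodule ℚ (E3 → ℚ) := Submodule.span ℚ {φ | ∃ C, RO C ∧ φ = ind C}

theorem ind_mul {V : Type} (C D : Set V) : ind C * ind D = ind (C ∩ D) := by
  funext x; simp only [ind, Pi.mul_apply, Set.mem_inter_iff]
  by_cases h1 : x ∈ C <;> by_cases h2 : x ∈ D <;> simp [h1, h2]

theorem CF_ind {C : Set E3} (h : RO C) : ind C ∈ CF := Submodule.subset_span ⟨C, h, rfl⟩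

theorem CF_mul {φ ψ : E3 → ℚ} (h1 : φ ∈ CF) (h2 : ψ ∈ CF) : φ * ψ ∈ CF := by
  unfold CF at h1 h2
  induction h1, h2 using Submodule.span_induction₂ with
  | mem_mem x y hx hy =>
    obtain ⟨C, hC, rfl⟩ := hx
    obtain ⟨D, hD, rfl⟩ := hy
    rw [ind_mul]; exact CF_ind (hC.inter hD)
  | zero_left => simp
  | zero_right => simp
  | add_left x y z _ _ _ hx hy => rw [add_mul]; exact CF.add_mem hx hy
  | add_right x y z _ _ _ hx hy => rw [mul_add]; exact CF.add_mem hx hy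
  | smul_left r x y _ _ h => rw [smul_mul_assoc]; exact CF.smul_mem _ h
  | smul_right r x y _ _ h => rw [mul_smul_comm]; exact CF.smul_mem _ h

theorem CF_one : (1 : E3 → ℚ) ∈ CF := by
  have : (1 : E3 → ℚ) = ind (⊤ : Submodule ℝ E3) := by funext x; simp [ind]
  rw [this]; exact CF_ind (RO_sub ⊤)

theorem CF_le (p : E3) : ind {x | ⟪p, x⟫ ≤ 0} ∈ CF := by
  have : ind {x | ⟪p, x⟫ ≤ 0} = ind {x | ⟪p, x⟫ < 0} + ind {x | ⟪p, x⟫ = 0} := by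
    funext x
    simp only [ind, Set.mem_ofPred_eq, Pi.add_apply]
    rcases lt_trichotomy (⟪p, x⟫) 0 with h | h | h
    · simp [h, h.le, h.ne]
    · simp [h]
    · simp [h.not_ge, h.ne', h.not_gt]
  rw [this]; exact CF.add_mem (CF_ind (RO_lt p)) (CF_ind (RO_eq p))

theorem EB_eq (b b' : Fin 3 → E3) (hb : Submodule.span ℝ (Set.range b) = ⊤)
    (hb' : Submodule.span ℝ (Set.range b') = ⊤) {φ : E3 → ℚ} (h : φ ∈ CF) : EB b φ = EB b' φ := by
  unfold CF at h
  induction h using Submodule.span_induction with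
  | mem x hx =>
    obtain ⟨C, hC, rfl⟩ := hx
    rcases C.eq_empty_or_nonempty with h | h
    · have : ind C = 0 := by funext x; simp [ind, h]
      rw [this, map_zero, map_zero]
    · rw [EB_ind hC h b hb, EB_ind hC h b' hb']
  | zero => simp
  | add x y _ _ hx hy => rw [map_add, map_add, hx, hy]
  | smul r x _ hx => rw [map_smul, map_smul, hx]

def sb : Fin 3 → E3 := fun i => EuclideanSpace.basisFun (Fin 3) ℝ i

theorem sb_span : Submodule.span ℝ (Set.range sb) = ⊤ := by
  have := (EuclideanSpace.basisFun (Fin 3) ℝ).toBasis.span_eq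
  rw [OrthonormalBasis.coe_toBasis] at this
  exact this

/-- spherical Euler functional -/
def EE : (E3 → ℚ) →ₗ[ℚ] ℚ := LinearMap.proj 0 - EB sb

theorem EE_ind {C : Set E3} (hC : RO C) (hn : C.Nonempty) :
    EE (ind C) = ind C 0 - (-1) ^ (finrank ℝ (vectorSpan ℝ C)) := by
  simp [EE, EB_ind hC hn sb sb_span]

theorem EE_one : EE 1 = 2 := by
  have : (1 : E3 → ℚ) = ind (⊤ : Submodule ℝ E3) := by funext x; simp [ind]
  rw [this, EE_ind (RO_sub ⊤) ⟨0, trivial⟩]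
  have : vectorSpan ℝ ((⊤ : Submodule ℝ E3) : Set E3) = ⊤ := by
    rw [eq_top_iff]; intro x _
    have := vsub_mem_vectorSpan ℝ (show x ∈ ((⊤ : Submodule ℝ E3) : Set E3) from trivial) (show 0 ∈ ((⊤ : Submodule ℝ E3) : Set E3) from trivial)
    simpa using this
  rw [this]; simp [ind]; norm_num

theorem EE_zero : EE (ind {0}) = 0 := by
  have h : RO {(0:E3)} := by
    have := RO_sub ⊥; simpa using this
  rw [EE_ind h ⟨0, rfl⟩, vectorSpan_singleton]; simp [ind]

/-- `EE` ignores the value at the origin -/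
theorem EE_congr {φ ψ : E3 → ℚ} (h : ∀ x, x ≠ 0 → φ x = ψ x) : EE φ = EE ψ := by
  have : φ = ψ + (φ 0 - ψ 0) • ind {0} := by
    funext x
    by_cases hx : x = 0
    · subst hx; simp [ind]
    · simp [ind, hx, h x hx]
  rw [this, map_add, map_smul, EE_zero]; simp

theorem EE_sub (K : Submodule ℝ E3) : EE (ind (K : Set E3)) = 1 - (-1) ^ (finrank ℝ K) := by
  rw [EE_ind (RO_sub K) ⟨0, K.zero_mem⟩, ind_mem (by exact K.zero_mem)]
  suffices h : vectorSpan ℝ (K : Set E3) = K by rw [h]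
  apply le_antisymm
  · rw [vectorSpan_def, Submodule.span_le]
    rintro _ ⟨x, hx, y, hy, rfl⟩
    exact K.sub_mem hx hy
  · intro x hx
    have := vsub_mem_vectorSpan ℝ (show x ∈ (K : Set E3) from hx) (show 0 ∈ (K : Set E3) from K.zero_mem)
    simpa using this

/-- closed convex cones that are not subspaces -/
theorem EE_cone {K : Set E3} (hcf : ind K ∈ CF) (hcl : IsClosed K) (hadd : ∀ x ∈ K, ∀ y ∈ K, x + y ∈ K)
    (hsm : ∀ x ∈ K, ∀ t : ℝ, 0 ≤ t → t • x ∈ K) {v : E3} (hv : v ∈ K) (hv' : -v ∉ K) :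
    EE (ind K) = 1 := by
  have hv0 : v ≠ 0 := by rintro rfl; exact hv' (by simpa using hv)
  have h0 : (0 : E3) ∈ K := by simpa using hsm v hv 0 le_rfl
  obtain ⟨b, hb, hb2⟩ : ∃ b : Fin 3 → E3, Submodule.span ℝ (Set.range b) = ⊤ ∧ b 2 = v := by
    have hex : ∃ i, v i ≠ 0 := by
      by_contra h; push Not at h
      exact hv0 (by ext i; simpa using h i)
    obtain ⟨i, hi⟩ := hex
    refine ⟨![sb (i+1), sb (i+2), v], ?_, rfl⟩
    set S := Submodule.span ℝ (Set.range ![sb (i+1), sb (i+2), v]) with hS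
    have m1 : sb (i+1) ∈ S := Submodule.subset_span ⟨0, rfl⟩
    have m2 : sb (i+2) ∈ S := Submodule.subset_span ⟨1, rfl⟩
    have m3 : v ∈ S := Submodule.subset_span ⟨2, rfl⟩
    have hv3 : v = v i • sb i + v (i+1) • sb (i+1) + v (i+2) • sb (i+2) := by
      ext j; fin_cases i <;> fin_cases j <;> simp [sb]
    have m0 : sb i ∈ S := by
      have : v i • sb i ∈ S := by
        have h5 : v i • sb i = v - v (i+1) • sb (i+1) - v (i+2) • sb (i+2) := by
          rw [eq_sub_iff_add_eq, eq_sub_iff_add_eq]; nth_rewrite 4 [hv3]; abel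
        rw [h5]
        exact S.sub_mem (S.sub_mem m3 (S.smul_mem _ m1)) (S.smul_mem _ m2)
      exact (S.smul_mem_iff hi).1 this
    rw [eq_top_iff, ← sb_span, Submodule.span_le]
    rintro _ ⟨j, rfl⟩
    have : j = i ∨ j = i + 1 ∨ j = i + 2 := by
      have : ∀ i j : Fin 3, j = i ∨ j = i + 1 ∨ j = i + 2 := by decide
      exact this i j
    rcases this with rfl | rfl | rfl
    exacts [m0, m1, m2]
  have hE : EB b (ind K) = 0 := by
    simp only [EB, LinearMap.comp_apply]
    have : IE (b 2) (ind K) = 0 := by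
      rw [hb2]; funext w
      change E1 (ind {t : ℝ | w + t • v ∈ K}) = 0
      set F := {t : ℝ | w + t • v ∈ K} with hF
      rcases F.eq_empty_or_nonempty with he | he
      · rw [he, ← E1_zero]; congr 1; funext x; simp [ind]
      have hup : ∀ t ∈ F, ∀ s, t ≤ s → s ∈ F := by
        intro t ht s hs
        have := hadd _ ht _ (hsm v hv (s - t) (by linarith))
        change w + s • v ∈ K
        convert this using 1; module
      have hFc : IsClosed F := hcl.preimage (by fun_prop : Continuous fun t : ℝ => w + t • v)
      have hbd : BddBelow F := by
        by_contra hnb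
        rw [not_bddBelow_iff] at hnb
        apply hv'
        have hall : ∀ s, s ∈ F := fun s => by
          obtain ⟨y, hy, hys⟩ := hnb s
          exact hup y hy s hys.le
        have hlim : Tendsto (fun s : ℝ => s⁻¹ • w + (-1 : ℝ) • v) atTop (𝓝 ((0:ℝ) • w + (-1 : ℝ) • v)) :=
          (tendsto_inv_atTop_zero.smul_const w).add_const _
        have h2 : (0:ℝ) • w + (-1 : ℝ) • v = -v := by module
        rw [h2] at hlim
        refine hcl.mem_of_tendsto hlim ?_
        filter_upwards [eventually_gt_atTop 0] with s hs
        have := hsm _ (hall (-s)) s⁻¹ (by positivity)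
        convert this using 1
        rw [smul_add, smul_smul]; congr 2; field_simp
      have : F = Set.Ici (sInf F) := by
        ext t
        refine ⟨fun ht => csInf_le hbd ht, fun ht => hup _ (hFc.csInf_mem he hbd) _ ht⟩
      rw [this, E1_Ici]
    rw [this, map_zero, map_zero, map_zero]
  have := EB_eq b sb hb sb_span hcf
  simp [EE, ← this, hE, ind_mem h0]

end GS

namespace GS
open Filter Topology Module

theorem RO.isOpen {C : Set E3} (hC : RO C) (hn : C.Nonempty) (ht : vectorSpan ℝ C = ⊤) : IsOpen C := by
  have h1 : affineSpan ℝ C = ⊤ :=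
    (AffineSubspace.affineSpan_eq_top_iff_vectorSpan_eq_top_of_nonempty ℝ E3 E3 hn).2 ht
  obtain ⟨x, hx⟩ := (hC.1.interior_nonempty_iff_affineSpan_eq_top).2 h1
  rw [← interior_eq_iff_isOpen]
  apply Set.Subset.antisymm interior_subset
  intro y hy
  obtain ⟨e, he, h2⟩ := hC.2 x (interior_subset hx) y hy
  have := hC.1.openSegment_interior_self_subset_interior hx h2
  apply this
  refine ⟨e / (1 + e), 1 / (1 + e), by positivity, by positivity, by field_simp; ring, ?_⟩
  have h : (1 + e) ≠ 0 := by positivity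
  have : (1 + e) • ((e / (1 + e)) • x + (1 / (1 + e)) • (y + e • (y - x))) = (1 + e) • y := by
    rw [smul_add, smul_smul, smul_smul, mul_div_cancel₀ _ h, mul_div_cancel₀ _ h]; module
  exact smul_right_injective _ h this

theorem sep {C : Set E3} (hC : RO C) (hn : C.Nonempty) (h2 : ∀ x ∈ C, (2:ℝ) • x ∈ C) (h0 : (0:E3) ∉ C) :
    ∃ ξ : E3, ∀ x ∈ C, 0 < ⟪ξ, x⟫ := by
  let W := (vectorSpan ℝ C)ᗮ
  let C' : Set E3 := {x | ∃ c ∈ C, ∃ d ∈ W, x = c + d}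
  have hsub : C ⊆ C' := fun x hx => ⟨x, hx, 0, W.zero_mem, by simp⟩
  have hC' : RO C' := by
    refine ⟨?_, ?_⟩
    · rintro _ ⟨c, hc, d, hd, rfl⟩ _ ⟨c', hc', d', hd', rfl⟩ a b ha hb hab
      exact ⟨_, hC.1 hc hc' ha hb hab, a • d + b • d', W.add_mem (W.smul_mem _ hd) (W.smul_mem _ hd'), by module⟩
    · rintro _ ⟨c, hc, d, hd, rfl⟩ _ ⟨c', hc', d', hd', rfl⟩
      obtain ⟨e, he, h⟩ := hC.2 c hc c' hc'
      exact ⟨e, he, _, h, d' + e • (d' - d), W.add_mem hd' (W.smul_mem _ (W.sub_mem hd' hd)), by module⟩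
  have htop : vectorSpan ℝ C' = ⊤ := by
    rw [eq_top_iff, ← Submodule.sup_orthogonal_of_hasOrthogonalProjection (K := vectorSpan ℝ C)]
    apply sup_le (vectorSpan_mono ℝ hsub)
    intro d hd
    obtain ⟨c, hc⟩ := hn
    have := vsub_mem_vectorSpan ℝ (show c + d ∈ C' from ⟨c, hc, d, hd, rfl⟩) (hsub hc)
    simpa using this
  have hop := hC'.isOpen (hn.mono hsub) htop
  have h0' : (0 : E3) ∉ C' := by
    rintro ⟨c, hc, d, hd, hcd⟩
    have h3 : c ∈ vectorSpan ℝ C := by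
      have := vsub_mem_vectorSpan ℝ (h2 c hc) hc
      have h4 : (2:ℝ) • c -ᵥ c = c := by simp only [vsub_eq_sub]; module
      rwa [h4] at this
    have h5 : d = -c := by rw [eq_neg_iff_add_eq_zero, add_comm]; exact hcd.symm
    have h6 : ⟪c, d⟫ = 0 := hd c h3
    rw [h5, inner_neg_right, neg_eq_zero, inner_self_eq_zero] at h6
    exact h0 (h6 ▸ hc)
  obtain ⟨f, hf⟩ := geometric_hahn_banach_open_point hC'.1 hop h0'
  refine ⟨-(InnerProductSpace.toDual ℝ E3).symm f, fun x hx => ?_⟩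
  have := hf x (hsub hx)
  rw [inner_neg_left, InnerProductSpace.toDual_symm_apply]
  simpa using this

/-- open simplicial cone -/
def pc {d : ℕ} (g : Fin d → E3) : Set E3 := {x | ∃ c : Fin d → ℝ, (∀ i, 0 < c i) ∧ x = ∑ i, c i • g i}

theorem pc_sum {d : ℕ} (g : Fin d → E3) : ∑ i, g i ∈ pc g := ⟨fun _ => 1, by simp, by simp⟩

theorem pc_RO {d : ℕ} (g : Fin d → E3) : RO (pc g) := by
  refine ⟨?_, ?_⟩
  · rintro _ ⟨c, hc, rfl⟩ _ ⟨c', hc', rfl⟩ a b ha hb hab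
    refine ⟨fun i => a * c i + b * c' i, fun i => ?_, ?_⟩
    · rcases eq_or_lt_of_le ha with h | h
      · have : b = 1 := by linarith
        subst this; subst h; simpa using hc' i
      · have := mul_pos h (hc i)
        have := mul_nonneg hb (hc' i).le
        linarith
    · simp only [add_smul, Finset.sum_add_distrib, Finset.smul_sum, smul_smul]
  · rintro _ ⟨c, hc, rfl⟩ _ ⟨c', hc', rfl⟩
    have : ∃ e : ℝ, 0 < e ∧ ∀ i, 0 < c' i + e * (c' i - c i) := by
      have : ∀ᶠ e in 𝓝[>] (0:ℝ), ∀ i, 0 < c' i + e * (c' i - c i) := by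
        rw [eventually_all]
        intro i
        have : Tendsto (fun e : ℝ => c' i + e * (c' i - c i)) (𝓝[>] 0) (𝓝 (c' i + 0 * (c' i - c i))) := by
          apply Tendsto.mono_left _ nhdsWithin_le_nhds
          exact Continuous.tendsto (by fun_prop) 0
        exact this.eventually (lt_mem_nhds (by simpa using hc' i))
      obtain ⟨e, he, h⟩ := (this.and self_mem_nhdsWithin).exists
      exact ⟨e, h, he⟩
    obtain ⟨e, he, h⟩ := this
    refine ⟨e, he, fun i => c' i + e * (c' i - c i), h, ?_⟩
    simp only [add_smul, sub_smul, mul_smul, Finset.sum_add_distrib, Finset.sum_sub_distrib, Finset.smul_sum, smul_sub]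

theorem pc_two {d : ℕ} (g : Fin d → E3) : ∀ x ∈ pc g, (2:ℝ) • x ∈ pc g := by
  rintro _ ⟨c, hc, rfl⟩
  exact ⟨fun i => 2 * c i, fun i => by have := hc i; positivity, by simp [Finset.smul_sum, smul_smul]⟩

theorem pc_span {d : ℕ} (g : Fin d → E3) : vectorSpan ℝ (pc g) = Submodule.span ℝ (Set.range g) := by
  classical
  apply le_antisymm
  · rw [vectorSpan_def, Submodule.span_le]
    have : ∀ x ∈ pc g, x ∈ Submodule.span ℝ (Set.range g) := by
      rintro _ ⟨c, hc, rfl⟩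
      exact Submodule.sum_mem _ fun i _ => Submodule.smul_mem _ _ (Submodule.subset_span ⟨i, rfl⟩)
    rintro _ ⟨x, hx, y, hy, rfl⟩
    exact Submodule.sub_mem _ (this x hx) (this y hy)
  · rw [Submodule.span_le]
    rintro _ ⟨i, rfl⟩
    have h1 : (∑ j, g j) + g i ∈ pc g := by
      refine ⟨fun j => if j = i then 2 else 1, fun j => by dsimp only; split_ifs <;> norm_num, ?_⟩
      have : ∀ j, (if j = i then (2:ℝ) else 1) • g j = g j + if j = i then g j else 0 := by
        intro j; split_ifs <;> module
      simp [this, Finset.sum_add_distrib]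
    have := vsub_mem_vectorSpan ℝ h1 (pc_sum g)
    simpa using this

theorem pc_zero {d : ℕ} {g : Fin d → E3} (hd : 0 < d) (hg : LinearIndependent ℝ g) : (0:E3) ∉ pc g := by
  rintro ⟨c, hc, h⟩
  have := (Fintype.linearIndependent_iff.1 hg) c h.symm ⟨0, hd⟩
  exact (hc ⟨0, hd⟩).ne' this

theorem pc_finrank {d : ℕ} {g : Fin d → E3} (hg : LinearIndependent ℝ g) :
    finrank ℝ (Submodule.span ℝ (Set.range g)) = d := by
  simpa using finrank_span_eq_card hg

theorem EE_pc {d : ℕ} {g : Fin d → E3} (hd : 0 < d) (hg : LinearIndependent ℝ g) :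
    EE (ind (pc g)) = (-1) ^ (d + 1) := by
  rw [EE_ind (pc_RO g) ⟨_, pc_sum g⟩, pc_span, pc_finrank hg, ind_not (pc_zero hd hg)]; ring

def pol {ι : Type} (g : ι → E3) : Set E3 := {ξ | ∀ i, ⟪g i, ξ⟫ ≤ 0}

theorem CF_pol {ι : Type} [Fintype ι] (g : ι → E3) : ind (pol g) ∈ CF := by
  classical
  have : ind (pol g) = ∏ i, ind {ξ | ⟪g i, ξ⟫ ≤ 0} := by
    funext ξ
    rw [Finset.prod_apply]
    by_cases h : ξ ∈ pol g
    · rw [ind_mem h, Finset.prod_eq_one]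
      intro i _; exact ind_mem (h i)
    · rw [ind_not h]
      have h2 : ∃ i, ¬ ⟪g i, ξ⟫ ≤ 0 := by simpa [pol] using h
      obtain ⟨i, hi⟩ := h2
      exact (Finset.prod_eq_zero (Finset.mem_univ i) (ind_not hi)).symm
  rw [this]
  exact Finset.prod_induction _ (· ∈ CF) (fun _ _ => CF_mul) CF_one (fun i _ => CF_le _)

theorem EE_pol {ι : Type} [Fintype ι] (g : ι → E3) (h : ∃ ξ, (∀ i, ⟪g i, ξ⟫ ≤ 0) ∧ ∃ i, ⟪g i, ξ⟫ < 0) :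
    EE (ind (pol g)) = 1 := by
  obtain ⟨ξ, h1, i, hi⟩ := h
  refine EE_cone (CF_pol g) ?_ ?_ ?_ (v := ξ) h1 ?_
  · have : pol g = ⋂ i, {ξ | ⟪g i, ξ⟫ ≤ 0} := by ext; simp [pol]
    rw [this]
    exact isClosed_iInter fun i => isClosed_le (by fun_prop) (by fun_prop)
  · intro x hx y hy i
    rw [inner_add_right]; exact add_nonpos (hx i) (hy i)
  · intro x hx t ht i
    rw [inner_smul_right]; exact mul_nonpos_of_nonneg_of_nonpos ht (hx i)
  · intro hx
    have := hx i
    rw [inner_neg_right] at this; linarith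

/-- values on generators from values on the open cone -/
theorem gen_nonneg {d : ℕ} {g : Fin d → E3} {ξ : E3} (r : ℝ) (h : ∀ x ∈ pc g, r < ⟪ξ, x⟫) (i : Fin d) :
    0 ≤ ⟪ξ, g i⟫ := by
  classical
  by_contra hneg
  push Not at hneg
  set A := ∑ j, ⟪ξ, g j⟫ with hA
  obtain ⟨t, ht0, ht⟩ : ∃ t : ℝ, 0 < t ∧ A + t * ⟪ξ, g i⟫ < r := by
    refine ⟨(|A - r| + 1) / (-⟪ξ, g i⟫), div_pos (by positivity) (by linarith), ?_⟩
    have : (|A - r| + 1) / (-⟪ξ, g i⟫) * ⟪ξ, g i⟫ = -(|A - r| + 1) := by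
      have := hneg.ne
      field_simp
    rw [this]; linarith [le_abs_self (A - r)]
  have h1 : (∑ j, g j) + t • g i ∈ pc g := by
    refine ⟨fun j => if j = i then 1 + t else 1, fun j => by dsimp only; split_ifs <;> positivity, ?_⟩
    have : ∀ j, (if j = i then (1 + t:ℝ) else 1) • g j = g j + if j = i then t • g j else 0 := by
      intro j; split_ifs <;> module
    simp [this, Finset.sum_add_distrib]
  have := h _ h1
  rw [inner_add_right, inner_sum, inner_smul_right] at this
  linarith

def hc {d : ℕ} (g : Fin d → E3) : E3 → ℚ := (-1 : ℚ) ^ (d + 1) • ind (pol g)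
def hc' {d : ℕ} (g : Fin d → E3) : E3 → ℚ := (-1 : ℚ) ^ (d + 1) • (1 - ind (pol (fun i => - g i)))

theorem pos_functional {d : ℕ} {g : Fin d → E3} (hd : 0 < d) (hg : LinearIndependent ℝ g) :
    ∃ ξ, (∀ i, 0 ≤ ⟪g i, ξ⟫) ∧ ∃ i, 0 < ⟪g i, ξ⟫ := by
  obtain ⟨ξ, h⟩ := sep (pc_RO g) ⟨_, pc_sum g⟩ (pc_two g) (pc_zero hd hg)
  have h1 : ∀ i, 0 ≤ ⟪g i, ξ⟫ := fun i => by rw [real_inner_comm]; exact gen_nonneg 0 h i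
  refine ⟨ξ, h1, ?_⟩
  by_contra hno
  push Not at hno
  have h2 := h _ (pc_sum g)
  rw [inner_sum] at h2
  have : ∑ i, ⟪ξ, g i⟫ ≤ 0 := Finset.sum_nonpos fun i _ => by rw [real_inner_comm]; exact hno i
  linarith

theorem EE_hc {d : ℕ} {g : Fin d → E3} (hd : 0 < d) (hg : LinearIndependent ℝ g) :
    EE (hc g) = EE (ind (pc g)) := by
  rw [EE_pc hd hg, hc, map_smul, EE_pol]; · simp
  obtain ⟨ξ, h1, i, hi⟩ := pos_functional hd hg
  exact ⟨-ξ, fun i => by rw [inner_neg_right]; linarith [h1 i], i, by rw [inner_neg_right]; linarith⟩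

theorem EE_hc' {d : ℕ} {g : Fin d → E3} (hd : 0 < d) (hg : LinearIndependent ℝ g) :
    EE (hc' g) = EE (ind (pc g)) := by
  rw [EE_pc hd hg, hc', map_smul, map_sub, EE_one, EE_pol]; · norm_num
  obtain ⟨ξ, h1, i, hi⟩ := pos_functional hd hg
  exact ⟨ξ, fun i => by rw [inner_neg_left]; linarith [h1 i], i, by rw [inner_neg_left]; linarith⟩

theorem planch {d e : ℕ} {g : Fin d → E3} {k : Fin e → E3} (hd : 0 < d) (he : 0 < e)
    (hg : LinearIndependent ℝ g) (hk : LinearIndependent ℝ k) :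
    EE (hc g * hc' k) = EE (ind (pc g) * ind (pc k)) := by
  have hmul : hc g * hc' k = ((-1:ℚ)^(d+1) * (-1)^(e+1)) •
      (ind (pol g) - ind (pol (Sum.elim g (fun i => - k i)))) := by
    have : ind (pol (Sum.elim g (fun i => - k i))) = ind (pol g) * ind (pol (fun i => - k i)) := by
      rw [ind_mul]; congr 1; ext ξ; simp [pol]
    rw [this, hc, hc', smul_mul_smul_comm, mul_sub, mul_one]
  have hA : EE (ind (pol g)) = 1 := by
    obtain ⟨ξ, h1, i, hi⟩ := pos_functional hd hg
    exact EE_pol _ ⟨-ξ, fun i => by rw [inner_neg_right]; linarith [h1 i], i, by rw [inner_neg_right]; linarith⟩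
  rw [hmul, map_smul, map_sub, hA, ind_mul]
  by_cases hne : (pc g ∩ pc k).Nonempty
  · -- intersecting case
    set U := Submodule.span ℝ (Set.range g) with hU
    set V := Submodule.span ℝ (Set.range k) with hV
    have h1 : pol (Sum.elim g (fun i => - k i)) = (((U ⊔ V)ᗮ : Submodule ℝ E3) : Set E3) := by
      ext ξ
      constructor
      · intro h
        have hgξ : ∀ i, ⟪g i, ξ⟫ ≤ 0 := fun i => h (Sum.inl i)
        have hkξ : ∀ i, 0 ≤ ⟪k i, ξ⟫ := fun i => by
          have := h (Sum.inr i)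
          simp only [Sum.elim_inr, inner_neg_left] at this; linarith
        obtain ⟨p, ⟨c, hc, hp⟩, ⟨c', hc', hp'⟩⟩ := hne
        have e1 : ⟪p, ξ⟫ = ∑ i, c i * ⟪g i, ξ⟫ := by rw [hp, sum_inner]; simp [inner_smul_left]
        have e2 : ⟪p, ξ⟫ = ∑ i, c' i * ⟪k i, ξ⟫ := by rw [hp', sum_inner]; simp [inner_smul_left]
        have n1 : ∀ i ∈ Finset.univ, c i * ⟪g i, ξ⟫ ≤ 0 := fun i _ => mul_nonpos_of_nonneg_of_nonpos (hc i).le (hgξ i)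
        have n2 : ∀ i ∈ Finset.univ, 0 ≤ c' i * ⟪k i, ξ⟫ := fun i _ => mul_nonneg (hc' i).le (hkξ i)
        have s1 := Finset.sum_nonpos n1
        have s2 := Finset.sum_nonneg n2
        have z1 := (Finset.sum_eq_zero_iff_of_nonpos n1).1 (by linarith)
        have z2 := (Finset.sum_eq_zero_iff_of_nonneg n2).1 (by linarith)
        change ξ ∈ (U ⊔ V)ᗮ
        rw [← Submodule.inf_orthogonal]
        constructor
        · rw [hU]
          refine (Submodule.mem_orthogonal _ _).2 fun u hu => ?_
          induction hu using Submodule.span_induction with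
          | mem x hx =>
            obtain ⟨i, rfl⟩ := hx
            exact (mul_eq_zero.1 (z1 i (Finset.mem_univ i))).resolve_left (hc i).ne'
          | zero => simp
          | add x y _ _ hx hy => rw [inner_add_left, hx, hy, add_zero]
          | smul r x _ hx => rw [inner_smul_left, hx, mul_zero]
        · rw [hV]
          refine (Submodule.mem_orthogonal _ _).2 fun u hu => ?_
          induction hu using Submodule.span_induction with
          | mem x hx =>
            obtain ⟨i, rfl⟩ := hx
            exact (mul_eq_zero.1 (z2 i (Finset.mem_univ i))).resolve_left (hc' i).ne'
          | zero => simp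
          | add x y _ _ hx hy => rw [inner_add_left, hx, hy, add_zero]
          | smul r x _ hx => rw [inner_smul_left, hx, mul_zero]
      · intro h i
        have h' : ξ ∈ (U ⊔ V)ᗮ := h
        rw [Submodule.mem_orthogonal] at h'
        rcases i with i | i
        · exact (h' _ (Submodule.mem_sup_left (Submodule.subset_span ⟨i, rfl⟩))).le
        · simp only [Sum.elim_inr, inner_neg_left]
          rw [h' _ (Submodule.mem_sup_right (Submodule.subset_span ⟨i, rfl⟩))]; simp
    rw [h1, EE_sub, EE_ind ((pc_RO g).inter (pc_RO k)) hne, (pc_RO g).vectorSpan_inter (pc_RO k) hne,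
      pc_span, pc_span, ind_not (fun h => pc_zero hd hg h.1)]
    have f1 := Submodule.finrank_sup_add_finrank_inf_eq U V
    rw [pc_finrank hg, pc_finrank hk] at f1
    have f2 := Submodule.finrank_add_finrank_orthogonal (U ⊔ V)
    rw [finrank_euclideanSpace_fin] at f2
    have : (-1:ℚ)^(d+1) * (-1)^(e+1) * (-1)^(finrank ℝ ((U ⊔ V)ᗮ : Submodule ℝ E3)) =
        - (-1)^(finrank ℝ (U ⊓ V : Submodule ℝ E3)) := by
      rw [← pow_add, ← pow_add]
      have : d + 1 + (e + 1) + finrank ℝ ((U ⊔ V)ᗮ : Submodule ℝ E3) = finrank ℝ (U ⊓ V : Submodule ℝ E3) + 1 + 2 * 2 := by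
        omega
      rw [this, pow_add, pow_mul, pow_succ]; norm_num
    rw [smul_eq_mul]
    linear_combination this
  · rw [Set.not_nonempty_iff_eq_empty] at hne
    have hz : ind (pc g ∩ pc k) = 0 := by rw [hne]; funext x; simp [ind]
    rw [hz, map_zero]
    have : EE (ind (pol (Sum.elim g (fun i => - k i)))) = 1 := by
      apply EE_pol
      let C : Set E3 := {x | ∃ s ∈ pc g, ∃ t ∈ pc k, x = t - s}
      have hC : RO C := by
        refine ⟨?_, ?_⟩
        · rintro _ ⟨c, hc, d, hd, rfl⟩ _ ⟨c', hc', d', hd', rfl⟩ a b ha hb hab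
          exact ⟨_, (pc_RO g).1 hc hc' ha hb hab, _, (pc_RO k).1 hd hd' ha hb hab, by module⟩
        · rintro _ ⟨c, hc, d, hd, rfl⟩ _ ⟨c', hc', d', hd', rfl⟩
          obtain ⟨e, he, h⟩ := (pc_RO g).2 c hc c' hc'
          obtain ⟨f, hf, h'⟩ := (pc_RO k).2 d hd d' hd'
          refine ⟨min e f, by positivity, _, conv_le (pc_RO g).1 hc' h (t := min e f) (by positivity) (min_le_left _ _), _,
            conv_le (pc_RO k).1 hd' h' (t := min e f) (by positivity) (min_le_right _ _), by module⟩
      have hCn : C.Nonempty := ⟨_, _, pc_sum g, _, pc_sum k, rfl⟩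
      have hC2 : ∀ x ∈ C, (2:ℝ) • x ∈ C := by
        rintro _ ⟨c, hc, d, hd, rfl⟩
        exact ⟨_, pc_two g c hc, _, pc_two k d hd, by module⟩
      have hC0 : (0:E3) ∉ C := by
        rintro ⟨c, hc, d, hd, h⟩
        have : d = c := by rw [← sub_eq_zero]; exact h.symm
        have : c ∈ pc g ∩ pc k := ⟨hc, this ▸ hd⟩
        rw [hne] at this; exact this
      obtain ⟨ξ, hξ⟩ := sep hC hCn hC2 hC0
      have k1 : ∀ i, 0 ≤ ⟪ξ, k i⟫ := fun i => gen_nonneg (⟪ξ, ∑ i, g i⟫) (fun x hx => by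
        have := hξ (x - ∑ i, g i) ⟨_, pc_sum g, x, hx, rfl⟩
        rw [inner_sub_right] at this; linarith) i
      have k2 : ∀ i, 0 ≤ ⟪-ξ, g i⟫ := fun i => gen_nonneg (⟪-ξ, ∑ i, k i⟫) (fun x hx => by
        have := hξ ((∑ i, k i) - x) ⟨x, hx, _, pc_sum k, rfl⟩
        rw [inner_sub_right] at this; rw [inner_neg_left, inner_neg_left]; linarith) i
      have hle : ∀ i, ⟪Sum.elim g (fun i => - k i) i, ξ⟫ ≤ 0 := by
        rintro (i | i)
        · have := k2 i
          rw [inner_neg_left, real_inner_comm] at this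
          simp only [Sum.elim_inl]; linarith
        · have := k1 i
          rw [real_inner_comm] at this
          simp only [Sum.elim_inr, inner_neg_left]; linarith
      refine ⟨ξ, hle, ?_⟩
      by_contra hno
      push Not at hno
      have := hξ _ ⟨_, pc_sum g, _, pc_sum k, rfl⟩
      rw [inner_sub_right, inner_sum, inner_sum] at this
      have s1 : ∑ i, ⟪ξ, k i⟫ ≤ 0 := Finset.sum_nonpos fun i _ => by
        have := hno (Sum.inr i)
        simp only [Sum.elim_inr, inner_neg_left] at this
        rw [real_inner_comm]; linarith
      have s2 : 0 ≤ ∑ i, ⟪ξ, g i⟫ := Finset.sum_nonneg fun i _ => by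
        have := hno (Sum.inl i)
        simp only [Sum.elim_inl] at this
        rw [real_inner_comm]; linarith
      linarith
    rw [this]; simp

/-- the graph of the transforms -/
def TT : Submodule ℚ ((E3 → ℚ) × (E3 → ℚ) × (E3 → ℚ)) :=
  Submodule.span ℚ {T | ∃ (d : ℕ) (g : Fin d → E3), 0 < d ∧ LinearIndependent ℝ g ∧ T = (ind (pc g), hc g, hc' g)}

theorem TT_mem {d : ℕ} {g : Fin d → E3} (hd : 0 < d) (hg : LinearIndependent ℝ g) :
    (ind (pc g), hc g, hc' g) ∈ TT := Submodule.subset_span ⟨d, g, hd, hg, rfl⟩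

theorem TT_EE {T : (E3 → ℚ) × (E3 → ℚ) × (E3 → ℚ)} (h : T ∈ TT) : EE T.2.1 = EE T.1 ∧ EE T.2.2 = EE T.1 := by
  unfold TT at h
  induction h using Submodule.span_induction with
  | mem x hx =>
    obtain ⟨d, g, hd, hg, rfl⟩ := hx
    exact ⟨EE_hc hd hg, EE_hc' hd hg⟩
  | zero => simp
  | add x y _ _ hx hy => simp [hx.1, hx.2, hy.1, hy.2]
  | smul r x _ hx => simp [hx.1, hx.2]

theorem TT_planch {S T : (E3 → ℚ) × (E3 → ℚ) × (E3 → ℚ)} (hS : S ∈ TT) (hT : T ∈ TT) :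
    EE (S.2.1 * T.2.2) = EE (S.1 * T.1) := by
  unfold TT at hS hT
  induction hS, hT using Submodule.span_induction₂ with
  | mem_mem x y hx hy =>
    obtain ⟨d, g, hd, hg, rfl⟩ := hx
    obtain ⟨e, k, he, hk, rfl⟩ := hy
    exact planch hd he hg hk
  | zero_left => simp
  | zero_right => simp
  | add_left x y z _ _ _ hx hy => simp [add_mul, hx, hy]
  | add_right x y z _ _ _ hx hy => simp [mul_add, hx, hy]
  | smul_left r x y _ _ h => simp [h]
  | smul_right r x y _ _ h => simp [h]

end GS

namespace GS
open Filter Topology Module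

/-- rational sign -/
def sg (x : ℝ) : ℚ := if 0 < x then 1 else if x < 0 then -1 else 0

theorem sg_pos {x : ℝ} (h : 0 < x) : sg x = 1 := by simp [sg, h]
theorem sg_neg {x : ℝ} (h : x < 0) : sg x = -1 := by simp [sg, h, h.le]
theorem sg_zero : sg 0 = 0 := by simp [sg]
theorem sg_mul (x y : ℝ) : sg (x * y) = sg x * sg y := by
  rcases lt_trichotomy x 0 with hx | rfl | hx <;> rcases lt_trichotomy y 0 with hy | rfl | hy <;>
  simp [sg_pos, sg_neg, sg_zero, *, mul_pos_of_neg_of_neg, mul_neg_of_neg_of_pos, mul_neg_of_pos_of_neg]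
theorem sg_inv (x : ℝ) : sg x⁻¹ = sg x := by
  rcases lt_trichotomy x 0 with hx | rfl | hx
  · rw [sg_neg hx, sg_neg (inv_lt_zero.2 hx)]
  · simp
  · rw [sg_pos hx, sg_pos (inv_pos.2 hx)]
theorem sg_div (x y : ℝ) : sg (x / y) = sg x * sg y := by rw [div_eq_mul_inv, sg_mul, sg_inv]
theorem sg_neg' (x : ℝ) : sg (-x) = - sg x := by
  rw [neg_eq_neg_one_mul, sg_mul, sg_neg (by norm_num : (-1:ℝ) < 0)]; ring
theorem sg_sq {x : ℝ} (h : x ≠ 0) : sg x * sg x = 1 := by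
  rcases lt_or_gt_of_ne h with h | h
  · rw [sg_neg h]; norm_num
  · rw [sg_pos h]; norm_num
theorem sg_cases (x : ℝ) : sg x = 1 ∨ sg x = -1 ∨ sg x = 0 := by
  unfold sg; split_ifs <;> simp
theorem sg_ne {x : ℝ} (h : x ≠ 0) : sg x = 1 ∨ sg x = -1 := by
  rcases lt_or_gt_of_ne h with h | h
  · right; exact sg_neg h
  · left; exact sg_pos h
theorem sg_eq_one {x : ℝ} : sg x = 1 ↔ 0 < x := by
  unfold sg; split_ifs with h1 h2 <;> simp [h1] <;> norm_num
theorem sg_eq_neg_one {x : ℝ} : sg x = -1 ↔ x < 0 := by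
  constructor
  · intro h; by_contra hx; push Not at hx
    rcases hx.lt_or_eq with h' | h'
    · rw [sg_pos h'] at h; norm_num at h
    · rw [← h', sg_zero] at h; norm_num at h
  · exact sg_neg
theorem sg_eq_zero {x : ℝ} : sg x = 0 ↔ x = 0 := by
  constructor
  · intro h; by_contra hx; rcases sg_ne hx with h' | h' <;> rw [h'] at h <;> norm_num at h
  · rintro rfl; exact sg_zero

/-- signs freeze near a point -/
theorem freeze {X : Type} [TopologicalSpace X] {ι : Type} [Finite ι] {F : ι → X → ℝ} (hF : ∀ i, Continuous (F i)) (x : X) :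
    ∀ᶠ y in 𝓝 x, ∀ i, F i x ≠ 0 → sg (F i y) = sg (F i x) := by
  rw [eventually_all]
  intro i
  by_cases h : F i x = 0
  · simp [h]
  · rcases lt_or_gt_of_ne h with h | h
    · filter_upwards [(hF i).continuousAt.eventually (gt_mem_nhds h)] with y hy _
      rw [sg_neg h, sg_neg hy]
    · filter_upwards [(hF i).continuousAt.eventually (lt_mem_nhds h)] with y hy _
      rw [sg_pos h, sg_pos hy]

theorem lc_const {Y : Type} {S : Set E3} (hS : IsPreconnected S) (f : E3 → Y)
    (h : ∀ x ∈ S, ∀ᶠ y in 𝓝 x, y ∈ S → f y = f x) : ∀ x ∈ S, ∀ y ∈ S, f x = f y := by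
  intro x hx y hy
  haveI : PreconnectedSpace S := isPreconnected_iff_preconnectedSpace.1 hS
  have hl : IsLocallyConstant (fun z : S => f z) := by
    rw [IsLocallyConstant.iff_eventually_eq]
    intro z
    have := h z z.2
    have h2 := (continuous_subtype_val.continuousAt (x := z)).eventually this
    filter_upwards [h2] with w hw using hw w.2
  exact hl.apply_eq_of_preconnectedSpace ⟨x, hx⟩ ⟨y, hy⟩

theorem ne0_conn : IsPreconnected ({0}ᶜ : Set E3) := by
  apply (isConnected_compl_singleton_of_one_lt_rank ?_ 0).isPreconnected
  rw [← finrank_eq_rank]; simp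

/-- determinant -/
def det3 (a b c : E3) : ℝ := ⟪a, cross3 b c⟫

theorem cross3_apply (a b : E3) : cross3 a b 0 = a 1 * b 2 - a 2 * b 1 ∧ cross3 a b 1 = a 2 * b 0 - a 0 * b 2
    ∧ cross3 a b 2 = a 0 * b 1 - a 1 * b 0 := by
  simp [cross3]

theorem inner3 (a b : E3) : ⟪a, b⟫ = a 0 * b 0 + a 1 * b 1 + a 2 * b 2 := by
  simp [PiLp.inner_apply, Fin.sum_univ_three]; ring

theorem det3_eq (a b c : E3) : det3 a b c = a 0 * (b 1 * c 2 - b 2 * c 1) + a 1 * (b 2 * c 0 - b 0 * c 2)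
    + a 2 * (b 0 * c 1 - b 1 * c 0) := by
  obtain ⟨h0, h1, h2⟩ := cross3_apply b c
  rw [det3, inner3, h0, h1, h2]

theorem ext3 {a b : E3} (h0 : a 0 = b 0) (h1 : a 1 = b 1) (h2 : a 2 = b 2) : a = b := by
  ext i; fin_cases i <;> assumption

theorem cramer (a b c x : E3) :
    det3 a b c • x = det3 x b c • a + det3 a x c • b + det3 a b x • c := by
  apply ext3 <;> simp [det3_eq] <;> ring

theorem cramer_dual (a b c x : E3) :
    det3 a b c • x = ⟪x, a⟫ • cross3 b c + ⟪x, b⟫ • cross3 c a + ⟪x, c⟫ • cross3 a b := by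
  apply ext3 <;> simp [det3_eq, inner3, cross3_apply] <;> ring

theorem det3_li {a b c : E3} (h : det3 a b c ≠ 0) : LinearIndependent ℝ ![a, b, c] := by
  rw [Fintype.linearIndependent_iff]
  intro g hg
  simp only [Fin.sum_univ_three, Matrix.cons_val_zero, Matrix.cons_val_one, Matrix.cons_val] at hg
  have e0 := congrArg (fun x : E3 => x 0) hg
  have e1 := congrArg (fun x : E3 => x 1) hg
  have e2 := congrArg (fun x : E3 => x 2) hg
  simp at e0 e1 e2
  rw [det3_eq] at h
  have h0 : g 0 = 0 := by
    apply (mul_eq_zero.1 (show _ * g 0 = 0 from ?_)).resolve_left h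
    linear_combination (b 1 * c 2 - b 2 * c 1) * e0 + (b 2 * c 0 - b 0 * c 2) * e1 + (b 0 * c 1 - b 1 * c 0) * e2
  have h1 : g 1 = 0 := by
    apply (mul_eq_zero.1 (show _ * g 1 = 0 from ?_)).resolve_left h
    linear_combination (c 1 * a 2 - c 2 * a 1) * e0 + (c 2 * a 0 - c 0 * a 2) * e1 + (c 0 * a 1 - c 1 * a 0) * e2
  have h2 : g 2 = 0 := by
    apply (mul_eq_zero.1 (show _ * g 2 = 0 from ?_)).resolve_left h
    linear_combination (a 1 * b 2 - a 2 * b 1) * e0 + (a 2 * b 0 - a 0 * b 2) * e1 + (a 0 * b 1 - a 1 * b 0) * e2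
  intro i; fin_cases i <;> assumption

/-- coordinates with respect to a basis -/
theorem coord {a b c : E3} (h : det3 a b c ≠ 0) (x : E3) :
    x = (det3 x b c / det3 a b c) • a + (det3 a x c / det3 a b c) • b + (det3 a b x / det3 a b c) • c := by
  have := cramer a b c x
  have h2 : det3 a b c • x = det3 a b c • ((det3 x b c / det3 a b c) • a + (det3 a x c / det3 a b c) • b + (det3 a b x / det3 a b c) • c) := by
    rw [this]; simp only [smul_add, smul_smul, mul_div_cancel₀ _ h]
  exact smul_right_injective _ h h2

theorem coord_uniq {a b c : E3} (h : det3 a b c ≠ 0) {p q r : ℝ} {x : E3}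
    (hx : x = p • a + q • b + r • c) :
    det3 x b c / det3 a b c = p ∧ det3 a x c / det3 a b c = q ∧ det3 a b x / det3 a b c = r := by
  subst hx
  refine ⟨?_, ?_, ?_⟩ <;> rw [div_eq_iff h] <;> simp [det3_eq] <;> ring

theorem mem_pc1 (a x : E3) : x ∈ pc ![a] ↔ ∃ s : ℝ, 0 < s ∧ x = s • a := by
  constructor
  · rintro ⟨c, hc, rfl⟩; exact ⟨c 0, hc 0, by simp⟩
  · rintro ⟨s, hs, rfl⟩; exact ⟨fun _ => s, fun _ => hs, by simp⟩

theorem mem_pc2 (a b x : E3) : x ∈ pc ![a, b] ↔ ∃ s t : ℝ, 0 < s ∧ 0 < t ∧ x = s • a + t • b := by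
  constructor
  · rintro ⟨c, hc, rfl⟩; exact ⟨c 0, c 1, hc 0, hc 1, by simp⟩
  · rintro ⟨s, t, hs, ht, rfl⟩
    exact ⟨![s, t], fun i => by fin_cases i <;> simpa, by simp⟩

theorem mem_pc3 (a b c x : E3) : x ∈ pc ![a, b, c] ↔
    ∃ s t r : ℝ, 0 < s ∧ 0 < t ∧ 0 < r ∧ x = s • a + t • b + r • c := by
  constructor
  · rintro ⟨d, hc, rfl⟩; exact ⟨d 0, d 1, d 2, hc 0, hc 1, hc 2, by simp [Fin.sum_univ_three]⟩
  · rintro ⟨s, t, r, hs, ht, hr, rfl⟩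
    exact ⟨![s, t, r], fun i => by fin_cases i <;> simpa, by simp [Fin.sum_univ_three]⟩

/-- closed two-dim cone minus origin -/
def kk (a b : E3) : Set E3 := {x | ∃ s t : ℝ, 0 ≤ s ∧ 0 ≤ t ∧ 0 < s + t ∧ x = s • a + t • b}

theorem kk_conv (a b : E3) : Convex ℝ (kk a b) := by
  rintro _ ⟨s, t, hs, ht, hst, rfl⟩ _ ⟨s', t', hs', ht', hst', rfl⟩ x y hx hy hxy
  refine ⟨x * s + y * s', x * t + y * t', by positivity, by positivity, ?_, by module⟩
  have : x * s + y * s' + (x * t + y * t') = x * (s + t) + y * (s' + t') := by ring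
  rw [this]
  rcases eq_or_lt_of_le hx with h | h
  · have : y = 1 := by linarith
    subst this; rw [← h]; linarith
  · have : 0 < x * (s + t) := by positivity
    have : 0 ≤ y * (s' + t') := by positivity
    linarith

theorem kk_left (a b : E3) : a ∈ kk a b := ⟨1, 0, by norm_num, by norm_num, by norm_num, by simp⟩
theorem kk_right (a b : E3) : b ∈ kk a b := ⟨0, 1, by norm_num, by norm_num, by norm_num, by simp⟩

/-- the polygon cone -/
def PP {n : ℕ} (u : ZMod n → E3) : Set E3 := {x | ∃ i, x ∈ kk (u i) (u (i + 1))}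

theorem zmod_ind {n : ℕ} [NeZero n] {p : ZMod n → Prop} (h0 : p 0) (h : ∀ i, p i → p (i + 1)) : ∀ i, p i := by
  have : ∀ k : ℕ, p (k : ZMod n) := by
    intro k; induction k with
    | zero => simpa using h0
    | succ k ih => push_cast; exact h _ ih
  intro i
  have := this i.val
  rwa [ZMod.natCast_zmod_val] at this

theorem two_val {n : ℕ} [NeZero n] (K : ZMod n → E3) (hne : ∀ x ∈ PP K, x ≠ 0)
    (f f' : E3 → ℚ)
    (heq : ∀ x, x ≠ 0 → x ∉ PP K → f x = f' x)
    (hoff : ∀ x, x ≠ 0 → x ∉ PP K → ∀ᶠ y in 𝓝 x, f y = f x)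
    (hon : ∀ x ∈ PP K, ∀ᶠ y in 𝓝 x, (f y = min (f x) (f' x) ∨ f y = min (f x) (f' x) + 1) ∧
      (f' y = min (f x) (f' x) ∨ f' y = min (f x) (f' x) + 1) ∧
      (y ∈ PP K → min (f y) (f' y) = min (f x) (f' x))) :
    ∃ c : ℚ, (∀ x, x ≠ 0 → (f x = c ∨ f x = c + 1) ∧ (f' x = c ∨ f' x = c + 1)) ∧
      ∀ x ∈ PP K, min (f x) (f' x) = c := by
  have h1 : ∀ i, ∀ x ∈ kk (K i) (K (i+1)), ∀ y ∈ kk (K i) (K (i+1)), min (f x) (f' x) = min (f y) (f' y) := by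
    intro i
    apply lc_const (kk_conv _ _).isPreconnected
    intro x hx
    filter_upwards [hon x ⟨i, hx⟩] with y hy h using hy.2.2 ⟨i, h⟩
  set c := min (f (K 0)) (f' (K 0)) with hc
  have h2 : ∀ i, min (f (K i)) (f' (K i)) = c := by
    apply zmod_ind (p := fun i => min (f (K i)) (f' (K i)) = c) rfl
    intro i hi
    rw [← hi]; exact h1 i _ (kk_right _ _) _ (kk_left _ _)
  have h3 : ∀ x ∈ PP K, min (f x) (f' x) = c := by
    rintro x ⟨i, hi⟩
    rw [← h2 i]; exact h1 i _ hi _ (kk_left _ _)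
  have h4 : ∀ x ∈ ({0}ᶜ : Set E3), ∀ y ∈ ({0}ᶜ : Set E3), (f x = c ∨ f x = c + 1) = (f y = c ∨ f y = c + 1) := by
    apply lc_const ne0_conn (fun x => (f x = c ∨ f x = c + 1))
    intro x hx
    by_cases hP : x ∈ PP K
    · filter_upwards [hon x hP] with y hy _
      have h5 := (hon x hP).self_of_nhds
      rw [h3 x hP] at hy h5
      simp only [hy.1, h5.1]
    · filter_upwards [hoff x hx hP] with y hy _
      rw [hy]
  have h5 : K 0 ∈ PP K := ⟨0, kk_left _ _⟩
  have h6 : f (K 0) = c ∨ f (K 0) = c + 1 := by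
    have := (hon _ h5).self_of_nhds
    exact this.1
  refine ⟨c, fun x hx => ?_, h3⟩
  have h7 : f x = c ∨ f x = c + 1 := by rw [h4 x hx (K 0) (hne _ h5)]; exact h6
  refine ⟨h7, ?_⟩
  by_cases hP : x ∈ PP K
  · have := (hon x hP).self_of_nhds.2.1
    rwa [h3 x hP] at this
  · rwa [← heq x hx hP]

end GS

namespace GS
open Filter Topology Module

theorem sum_add1 {n : ℕ} [NeZero n] (F : ZMod n → ℚ) : ∑ i, F (i + 1) = ∑ i, F i :=
  Fintype.sum_equiv (Equiv.addRight 1) _ _ fun _ => rfl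
theorem sum_sub1 {n : ℕ} [NeZero n] (F : ZMod n → ℚ) : ∑ i, F (i - 1) = ∑ i, F i :=
  Fintype.sum_equiv (Equiv.subRight 1) _ _ fun _ => rfl

def eE {n : ℕ} (u : ZMod n → E3) (ζ : E3) (i : ZMod n) : ℝ := det3 ζ (u i) (u (i + 1))
def sS {n : ℕ} (u : ZMod n → E3) (i : ZMod n) : ℝ := det3 (u (i - 1)) (u i) (u (i + 1))
def ep {n : ℕ} (u : ZMod n → E3) (ζ : E3) (i : ZMod n) : ℚ := sg (eE u ζ i)
def ss {n : ℕ} (u : ZMod n → E3) (i : ZMod n) : ℚ := sg (sS u i)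
def epp {n : ℕ} (u : ZMod n → E3) (ζ : E3) (i : ZMod n) : ℚ := (1 + ep u ζ i) / 2
def epm {n : ℕ} (u : ZMod n → E3) (ζ : E3) (i : ZMod n) : ℚ := (ep u ζ i - 1) / 2
def tau {n : ℕ} (u : ZMod n → E3) (ζ : E3) (i : ZMod n) : ℚ := ss u i * (1 - ep u ζ (i - 1) * ep u ζ i) / 2

structure Hyp {n : ℕ} (u : ZMod n → E3) (ζ : E3) : Prop where
  hn : 3 ≤ n
  hS : ∀ i, sS u i ≠ 0
  hE : ∀ i, eE u ζ i ≠ 0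
  hP : ∀ i j, i ≠ j → j ≠ i + 1 → i ≠ j + 1 → ∀ x ∈ kk (u i) (u (i + 1)), x ∉ kk (u j) (u (j + 1))

theorem Hyp.ep_ne {n : ℕ} {u : ZMod n → E3} {ζ : E3} (H : Hyp u ζ) (i : ZMod n) : ep u ζ i = 1 ∨ ep u ζ i = -1 :=
  sg_ne (H.hE i)
theorem Hyp.ss_ne {n : ℕ} {u : ZMod n → E3} {ζ : E3} (H : Hyp u ζ) (i : ZMod n) : ss u i = 1 ∨ ss u i = -1 :=
  sg_ne (H.hS i)

theorem key_id {n : ℕ} (u : ZMod n → E3) (ζ : E3) (j : ZMod n) (ξ : E3) (h : ⟪u j, ξ⟫ = 0) :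
    sS u j * ⟪ζ, ξ⟫ = eE u ζ (j - 1) * ⟪u (j + 1), ξ⟫ + eE u ζ j * ⟪u (j - 1), ξ⟫ := by
  unfold sS eE
  rw [sub_add_cancel]
  have := congrArg (fun x => ⟪x, ξ⟫) (cramer (u (j-1)) (u j) (u (j+1)) ζ)
  simp only [inner_add_left, inner_smul_left, h] at this
  simp only [RCLike.conj_to_real] at this
  rw [this]
  have : det3 (u (j-1)) (u j) ζ = det3 ζ (u (j-1)) (u j) := by simp only [det3_eq]; ring
  rw [this]; ring

/-- two consecutive vanish -/
theorem Hyp.not_two {n : ℕ} {u : ZMod n → E3} {ζ : E3} (H : Hyp u ζ) {i : ZMod n} {ξ : E3} (h0 : ξ ≠ 0)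
    (hz : ⟪ζ, ξ⟫ = 0) (h1 : ⟪u i, ξ⟫ = 0) : ⟪u (i + 1), ξ⟫ ≠ 0 := by
  intro h2
  have := cramer_dual ζ (u i) (u (i+1)) ξ
  rw [real_inner_comm, hz, real_inner_comm, h1, real_inner_comm, h2] at this
  simp only [zero_smul, add_zero] at this
  rcases smul_eq_zero.1 this with h | h
  · exact H.hE i h
  · exact h0 h

theorem key_sg {n : ℕ} {u : ZMod n → E3} {ζ : E3} (H : Hyp u ζ) (i : ZMod n) (ξ : E3)
    (hz : ⟪ζ, ξ⟫ = 0) (h1 : ⟪u i, ξ⟫ = 0) :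
    ep u ζ i * sg ⟪u (i + 1), ξ⟫ + ep u ζ (i - 1) * sg ⟪u (i - 1), ξ⟫ = 0 := by
  have h := key_id u ζ i ξ h1
  rw [hz, mul_zero] at h
  have h2 : eE u ζ (i - 1) * ⟪u (i + 1), ξ⟫ = - (eE u ζ i * ⟪u (i - 1), ξ⟫) := by linarith
  have h3 := congrArg sg h2
  rw [sg_neg', sg_mul, sg_mul] at h3
  change ep u ζ (i-1) * _ = - (ep u ζ i * _) at h3
  have h4 : ep u ζ i * ep u ζ i = 1 := sg_sq (H.hE i)
  have h5 : ep u ζ (i-1) * ep u ζ (i-1) = 1 := sg_sq (H.hE (i-1))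
  linear_combination ep u ζ (i-1) * ep u ζ i * h3 - ep u ζ (i-1) * sg ⟪u (i-1), ξ⟫ * h4 - ep u ζ i * sg ⟪u (i+1), ξ⟫ * h5

def Wf {n : ℕ} [NeZero n] (u : ZMod n → E3) (ζ : E3) (ξ : E3) : ℚ :=
  (1/4) * ∑ i, ep u ζ i * (1 - sg ⟪u i, ξ⟫ * sg ⟪u (i + 1), ξ⟫)

/-- a bilinear sum with vanishing conditions -/
theorem bil {n : ℕ} [NeZero n] (e a b : ZMod n → ℚ)
    (h1 : ∀ i, a i ≠ b i → a (i + 1) = b (i + 1))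
    (h2 : ∀ i, a i ≠ b i → e i * b (i + 1) + e (i - 1) * b (i - 1) = 0) :
    ∑ i, e i * (a i * a (i + 1)) = ∑ i, e i * (b i * b (i + 1)) := by
  have h3 : ∀ i, e i * (a i * a (i + 1)) = e i * (b i * b (i+1)) + (a i - b i) * (e i * b (i+1)) + (a (i+1) - b (i+1)) * (e i * b i) := by
    intro i
    by_cases h : a i = b i
    · rw [h]; ring
    · rw [h1 i h]; ring
  rw [Finset.sum_congr rfl fun i _ => h3 i, Finset.sum_add_distrib, Finset.sum_add_distrib]
  have h4 := sum_sub1 (fun i => (a (i+1) - b (i+1)) * (e i * b i))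
  simp only [sub_add_cancel] at h4
  rw [← h4, add_assoc, ← Finset.sum_add_distrib]
  rw [Finset.sum_eq_zero (s := Finset.univ) (f := fun i => (a i - b i) * (e i * b (i + 1)) + (a i - b i) * (e (i - 1) * b (i - 1))), add_zero]
  intro i _
  by_cases h : a i = b i
  · rw [h]; ring
  · rw [← mul_add, h2 i h, mul_zero]

theorem Wf_loc {n : ℕ} [NeZero n] {u : ZMod n → E3} {ζ : E3} (H : Hyp u ζ) (ξ : E3) (h0 : ξ ≠ 0)
    (hz : ⟪ζ, ξ⟫ = 0) : ∀ᶠ y in 𝓝 ξ, Wf u ζ y = Wf u ζ ξ := by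
  have := freeze (F := fun i y => ⟪u i, y⟫) (fun i => by fun_prop) ξ
  filter_upwards [this] with y hy
  unfold Wf
  congr 1
  simp only [mul_sub, mul_one, Finset.sum_sub_distrib]
  congr 1
  apply bil _ (fun i => sg ⟪u i, y⟫) (fun i => sg ⟪u i, ξ⟫)
  · intro i hi
    apply hy
    by_contra h
    have h' : ⟪u i, ξ⟫ = 0 := by by_contra h'; exact hi (hy i h')
    exact H.not_two h0 hz h' h
  · intro i hi
    have h' : ⟪u i, ξ⟫ = 0 := by by_contra h'; exact hi (hy i h')
    exact key_sg H i ξ hz h'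

def WW {n : ℕ} [NeZero n] (u : ZMod n → E3) (ζ : E3) : ℚ := Wf u ζ (cross3 ζ (u 0))

theorem perp_conn {ζ : E3} (hζ : ζ ≠ 0) : IsPreconnected {x : E3 | x ≠ 0 ∧ ⟪ζ, x⟫ = 0} := by
  let K := (Submodule.span ℝ {ζ})ᗮ
  have hK : finrank ℝ K = 2 := by
    haveI : Fact (finrank ℝ E3 = 2 + 1) := ⟨by simp⟩
    exact Submodule.finrank_orthogonal_span_singleton hζ
  have h1 : IsPreconnected ({0}ᶜ : Set K) := by
    apply (isConnected_compl_singleton_of_one_lt_rank ?_ 0).isPreconnected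
    rw [← finrank_eq_rank, hK]; norm_num
  have h2 := h1.image (Subtype.val : K → E3) continuous_subtype_val.continuousOn
  convert h2 using 1
  ext x
  simp only [Set.mem_ofPred_eq, Set.mem_image, Set.mem_compl_iff, Set.mem_singleton_iff, Subtype.exists]
  constructor
  · rintro ⟨h, h'⟩
    refine ⟨x, (Submodule.mem_orthogonal_singleton_iff_inner_right).2 h', ?_, rfl⟩
    simpa using h
  · rintro ⟨a, ha, hne, rfl⟩
    refine ⟨by simpa using hne, (Submodule.mem_orthogonal_singleton_iff_inner_right).1 ha⟩

theorem Hyp.zne {n : ℕ} {u : ZMod n → E3} {ζ : E3} (H : Hyp u ζ) : ζ ≠ 0 := by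
  rintro rfl
  apply H.hE 0
  simp [eE, det3]

theorem det3_self (a b : E3) : det3 a a b = 0 := by rw [det3_eq]; ring
theorem det3_self' (a b : E3) : det3 b a b = 0 := by rw [det3_eq]; ring
theorem det3_self'' (a b : E3) : det3 a b b = 0 := by rw [det3_eq]; ring
theorem inner_cross_self (a b : E3) : ⟪a, cross3 a b⟫ = 0 := det3_self a b
theorem inner_cross_self' (a b : E3) : ⟪b, cross3 a b⟫ = 0 := det3_self' a b

theorem cross_ne {a b c : E3} (h : det3 a b c ≠ 0) : cross3 a b ≠ 0 := by
  intro h'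
  apply h
  have : det3 a b c = ⟪c, cross3 a b⟫ := by
    change _ = det3 c a b
    simp only [det3_eq]; ring
  rw [this, h', inner_zero_right]

theorem Wf_eq {n : ℕ} [NeZero n] {u : ZMod n → E3} {ζ : E3} (H : Hyp u ζ) (ξ : E3) (h0 : ξ ≠ 0)
    (hz : ⟪ζ, ξ⟫ = 0) : Wf u ζ ξ = WW u ζ := by
  refine lc_const (perp_conn H.zne) (Wf u ζ) (fun x hx => ?_) ξ ⟨h0, hz⟩ (cross3 ζ (u 0)) ⟨?_, ?_⟩
  · filter_upwards [Wf_loc H x hx.1 hx.2] with y hy _ using hy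
  · exact cross_ne (H.hE 0)
  · exact inner_cross_self _ _

/-- zero-one indicator of a proposition -/
def ib (p : Prop) [Decidable p] : ℚ := if p then 1 else 0

open Classical in
/-- `a`-version: b_i = 1 - 2 [u_i ξ ≤ 0]. -/
theorem Wd_aux {n : ℕ} [NeZero n] {u : ZMod n → E3} {ζ : E3} (H : Hyp u ζ) (ξ : E3) (h0 : ξ ≠ 0)
    (hz : ⟪ζ, ξ⟫ = 0) (b : ZMod n → ℚ) (hb : ∀ i, ⟪u i, ξ⟫ ≠ 0 → b i = sg ⟪u i, ξ⟫) :
    ∑ i, ep u ζ i * (1 - b i * b (i + 1)) = 4 * WW u ζ := by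
  rw [← Wf_eq H ξ h0 hz, Wf]
  rw [← mul_assoc]
  norm_num
  simp only [mul_sub, mul_one, Finset.sum_sub_distrib]
  congr 1
  apply bil _ b (fun i => sg ⟪u i, ξ⟫)
  · intro i hi
    have h' : ⟪u i, ξ⟫ = 0 := by by_contra h'; exact hi (hb i h')
    apply hb
    exact H.not_two h0 hz h'
  · intro i hi
    have h' : ⟪u i, ξ⟫ = 0 := by by_contra h'; exact hi (hb i h')
    exact key_sg H i ξ hz h'

end GS

namespace GS
open Filter Topology Module

/-! membership via coordinates -/
section basis
variable {a b c : E3} (h : det3 a b c ≠ 0) (x : E3)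
include h
theorem m111 : x ∈ pc ![a, b, c] ↔ 0 < det3 x b c / det3 a b c ∧ 0 < det3 a x c / det3 a b c ∧ 0 < det3 a b x / det3 a b c := by
  rw [mem_pc3]
  constructor
  · rintro ⟨s, t, r, hs, ht, hr, hx⟩
    obtain ⟨h1, h2, h3⟩ := coord_uniq h hx
    rw [h1, h2, h3]; exact ⟨hs, ht, hr⟩
  · rintro ⟨h1, h2, h3⟩
    exact ⟨_, _, _, h1, h2, h3, coord h x⟩
theorem m110 : x ∈ pc ![a, b] ↔ 0 < det3 x b c / det3 a b c ∧ 0 < det3 a x c / det3 a b c ∧ det3 a b x / det3 a b c = 0 := by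
  rw [mem_pc2]
  constructor
  · rintro ⟨s, t, hs, ht, hx⟩
    obtain ⟨h1, h2, h3⟩ := coord_uniq (x := x) (p := s) (q := t) (r := 0) h (by rw [hx]; module)
    rw [h1, h2, h3]; exact ⟨hs, ht, rfl⟩
  · rintro ⟨h1, h2, h3⟩
    have := coord h x
    rw [h3, zero_smul, add_zero] at this
    exact ⟨_, _, h1, h2, this⟩
theorem m101 : x ∈ pc ![a, c] ↔ 0 < det3 x b c / det3 a b c ∧ det3 a x c / det3 a b c = 0 ∧ 0 < det3 a b x / det3 a b c := by
  rw [mem_pc2]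
  constructor
  · rintro ⟨s, t, hs, ht, hx⟩
    obtain ⟨h1, h2, h3⟩ := coord_uniq (x := x) (p := s) (q := 0) (r := t) h (by rw [hx]; module)
    rw [h1, h2, h3]; exact ⟨hs, rfl, ht⟩
  · rintro ⟨h1, h2, h3⟩
    have := coord h x
    rw [h2, zero_smul, add_zero] at this
    exact ⟨_, _, h1, h3, this⟩
theorem m011 : x ∈ pc ![b, c] ↔ det3 x b c / det3 a b c = 0 ∧ 0 < det3 a x c / det3 a b c ∧ 0 < det3 a b x / det3 a b c := by
  rw [mem_pc2]
  constructor
  · rintro ⟨s, t, hs, ht, hx⟩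
    obtain ⟨h1, h2, h3⟩ := coord_uniq (x := x) (p := 0) (q := s) (r := t) h (by rw [hx]; module)
    rw [h1, h2, h3]; exact ⟨rfl, hs, ht⟩
  · rintro ⟨h1, h2, h3⟩
    have := coord h x
    rw [h1, zero_smul, zero_add] at this
    exact ⟨_, _, h2, h3, this⟩
theorem m0kk : x ∈ kk b c ↔ x ≠ 0 ∧ det3 x b c / det3 a b c = 0 ∧ 0 ≤ det3 a x c / det3 a b c ∧ 0 ≤ det3 a b x / det3 a b c := by
  constructor
  · rintro ⟨s, t, hs, ht, hst, hx⟩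
    obtain ⟨h1, h2, h3⟩ := coord_uniq (x := x) (p := 0) (q := s) (r := t) h (by rw [hx]; module)
    refine ⟨?_, ?_⟩
    · intro h'
      rw [h'] at h2 h3
      simp [det3_eq] at h2 h3
      linarith
    rw [h1, h2, h3]; exact ⟨rfl, hs, ht⟩
  · rintro ⟨h0, h1, h2, h3⟩
    have := coord h x
    rw [h1, zero_smul, zero_add] at this
    refine ⟨_, _, h2, h3, ?_, this⟩
    apply lt_of_le_of_ne (by positivity)
    intro h4
    have h5 : det3 a x c / det3 a b c = 0 := by linarith
    have h6 : det3 a b x / det3 a b c = 0 := by linarith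
    rw [h5, h6] at this
    exact h0 (by simpa using this)
theorem m100 : x ∈ pc ![a] ↔ 0 < det3 x b c / det3 a b c ∧ det3 a x c / det3 a b c = 0 ∧ det3 a b x / det3 a b c = 0 := by
  rw [mem_pc1]
  constructor
  · rintro ⟨s, hs, hx⟩
    obtain ⟨h1, h2, h3⟩ := coord_uniq (x := x) (p := s) (q := 0) (r := 0) h (by rw [hx]; module)
    rw [h1, h2, h3]; exact ⟨hs, rfl, rfl⟩
  · rintro ⟨h1, h2, h3⟩
    have := coord h x
    rw [h3, h2, zero_smul, add_zero, zero_smul, add_zero] at this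
    exact ⟨_, h1, this⟩
theorem m010 : x ∈ pc ![b] ↔ det3 x b c / det3 a b c = 0 ∧ 0 < det3 a x c / det3 a b c ∧ det3 a b x / det3 a b c = 0 := by
  rw [mem_pc1]
  constructor
  · rintro ⟨s, hs, hx⟩
    obtain ⟨h1, h2, h3⟩ := coord_uniq (x := x) (p := 0) (q := s) (r := 0) h (by rw [hx]; module)
    rw [h1, h2, h3]; exact ⟨rfl, hs, rfl⟩
  · rintro ⟨h1, h2, h3⟩
    have := coord h x
    rw [h3, h1, zero_smul, zero_add, zero_smul, add_zero] at this
    exact ⟨_, h2, this⟩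
theorem m001 : x ∈ pc ![c] ↔ det3 x b c / det3 a b c = 0 ∧ det3 a x c / det3 a b c = 0 ∧ 0 < det3 a b x / det3 a b c := by
  rw [mem_pc1]
  constructor
  · rintro ⟨s, hs, hx⟩
    obtain ⟨h1, h2, h3⟩ := coord_uniq (x := x) (p := 0) (q := 0) (r := s) h (by rw [hx]; module)
    rw [h1, h2, h3]; exact ⟨rfl, rfl, hs⟩
  · rintro ⟨h1, h2, h3⟩
    have := coord h x
    rw [h2, h1, zero_smul, zero_add, zero_smul, zero_add] at this
    exact ⟨_, h3, this⟩
theorem li1 : LinearIndependent ℝ ![a] := by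
  have : a ≠ 0 := by
    rintro rfl
    apply h; rw [det3_eq]; simp
  exact linearIndependent_unique_iff.2 (by simpa using this)
theorem li2 : LinearIndependent ℝ ![b] := by
  apply li1 (b := c) (c := a)
  convert h using 1; simp only [det3_eq]; ring
theorem li3 : LinearIndependent ℝ ![c] := by
  apply li1 (b := a) (c := b)
  convert h using 1; simp only [det3_eq]; ring
theorem li12 : LinearIndependent ℝ ![a, b] := by
  have := (det3_li h).comp ![0, 1] (by intro i j; fin_cases i <;> fin_cases j <;> simp)
  convert this using 1
  ext i; fin_cases i <;> rfl
theorem li23 : LinearIndependent ℝ ![b, c] := by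
  apply li12 (c := a)
  convert h using 1; simp only [det3_eq]; ring
theorem li13 : LinearIndependent ℝ ![a, c] := by
  apply li12 (c := b) (a := a) (b := c)
  intro h'; apply h
  rw [det3_eq] at h' ⊢; linarith
end basis

theorem kk_closed {b c a : E3} (h : det3 a b c ≠ 0) {x : E3} (h0 : x ≠ 0) (hx : x ∉ kk b c) :
    ∀ᶠ y in 𝓝 x, y ∉ kk b c := by
  have F := freeze (F := (![fun y => det3 y b c / det3 a b c, fun y => det3 a y c / det3 a b c, fun y => det3 a b y / det3 a b c] : Fin 3 → E3 → ℝ))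
    (by intro i; fin_cases i <;> simp [det3_eq] <;> fun_prop) x
  filter_upwards [F] with y hy
  have y0 := hy 0; have y1 := hy 1; have y2 := hy 2
  simp only [Matrix.cons_val_zero, Matrix.cons_val_one, Matrix.cons_val] at y0 y1 y2
  rw [m0kk h] at hx ⊢
  push Not at hx
  rintro ⟨hy0, h1, h2, h3⟩
  by_cases hp : det3 x b c / det3 a b c = 0
  · by_cases hq : 0 ≤ det3 a x c / det3 a b c
    · have hr := hx h0 hp hq
      have := y2 hr.ne
      rw [sg_neg hr, sg_eq_neg_one] at this
      linarith
    · push Not at hq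
      have := y1 hq.ne
      rw [sg_neg hq, sg_eq_neg_one] at this
      linarith
  · have := y0 hp
    rw [h1, sg_zero, eq_comm, sg_eq_zero] at this
    exact hp this

/-- nondegenerate simple spherical polygon (as a cone) -/
structure Poly {n : ℕ} (u : ZMod n → E3) : Prop where
  hn : 3 ≤ n
  hS : ∀ i, det3 (u (i - 1)) (u i) (u (i + 1)) ≠ 0
  hP : ∀ i j, i ≠ j → j ≠ i + 1 → i ≠ j + 1 → ∀ x ∈ kk (u i) (u (i + 1)), x ∉ kk (u j) (u (j + 1))

theorem Hyp.poly {n : ℕ} {u : ZMod n → E3} {ζ : E3} (H : Hyp u ζ) : Poly u := ⟨H.hn, H.hS, H.hP⟩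

theorem one_ne {n : ℕ} (hn : 3 ≤ n) : (1 : ZMod n) ≠ 0 ∧ (2 : ZMod n) ≠ 0 := by
  constructor
  · intro h
    have : ((1:ℕ) : ZMod n) = 0 := by exact_mod_cast h
    rw [ZMod.natCast_eq_zero_iff] at this
    have := Nat.le_of_dvd (by norm_num) this; omega
  · intro h
    have : ((2:ℕ) : ZMod n) = 0 := by exact_mod_cast h
    rw [ZMod.natCast_eq_zero_iff] at this
    have := Nat.le_of_dvd (by norm_num) this; omega

theorem ray_kk {a b x : E3} (h : x ∈ pc ![a]) : x ∈ kk a b := by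
  rw [mem_pc1] at h; obtain ⟨s, hs, rfl⟩ := h
  exact ⟨s, 0, hs.le, le_rfl, by linarith, by simp⟩
theorem ray_kk' {a b x : E3} (h : x ∈ pc ![b]) : x ∈ kk a b := by
  rw [mem_pc1] at h; obtain ⟨s, hs, rfl⟩ := h
  exact ⟨0, s, le_rfl, hs.le, by linarith, by simp⟩
theorem edge_kk {a b x : E3} (h : x ∈ pc ![a, b]) : x ∈ kk a b := by
  rw [mem_pc2] at h; obtain ⟨s, t, hs, ht, rfl⟩ := h
  exact ⟨s, t, hs.le, ht.le, by linarith, rfl⟩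
theorem kk_cases {a b x : E3} (h : x ∈ kk a b) : x ∈ pc ![a, b] ∨ x ∈ pc ![a] ∨ x ∈ pc ![b] := by
  obtain ⟨s, t, hs, ht, hst, rfl⟩ := h
  rcases hs.lt_or_eq with h1 | h1
  · rcases ht.lt_or_eq with h2 | h2
    · left; rw [mem_pc2]; exact ⟨s, t, h1, h2, rfl⟩
    · right; left; rw [mem_pc1]; exact ⟨s, h1, by rw [← h2]; simp⟩
  · right; right; rw [mem_pc1]; exact ⟨t, by linarith, by rw [← h1]; simp⟩

namespace Poly
variable {n : ℕ} [NeZero n] {u : ZMod n → E3} (H : Poly u)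
include H

theorem hS' (i : ZMod n) : det3 (u i) (u (i + 1)) (u (i + 1 + 1)) ≠ 0 := by
  have := H.hS (i + 1); rwa [add_sub_cancel_right] at this

theorem adj {i : ZMod n} {x : E3} (h1 : x ∈ kk (u i) (u (i+1))) (h2 : x ∈ kk (u (i+1)) (u (i+1+1))) :
    x ∈ pc ![u (i+1)] := by
  obtain ⟨s, t, hs, ht, hst, rfl⟩ := h1
  obtain ⟨s', t', hs', ht', hst', h⟩ := h2
  have h3 := coord_uniq (p := s) (q := t) (r := 0) (H.hS' i) (x := s • u i + t • u (i+1)) (by module)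
  have h4 := coord_uniq (p := 0) (q := s') (r := t') (H.hS' i) (x := s • u i + t • u (i+1)) (by rw [h]; module)
  have h5 : s = 0 := by rw [← h3.1, h4.1]
  rw [mem_pc1]
  exact ⟨t, by linarith, by rw [h5]; module⟩

theorem ray_ne {i : ZMod n} {x : E3} (h1 : x ∈ pc ![u i]) : x ∉ pc ![u (i + 1)] := by
  intro h2
  rw [m100 (H.hS' i)] at h1
  rw [m010 (H.hS' i)] at h2
  linarith [h1.1, h2.1]

theorem edge_ray1 {i : ZMod n} {x : E3} (h1 : x ∈ pc ![u i, u (i+1)]) : x ∉ pc ![u i] := by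
  intro h2
  rw [m110 (H.hS' i)] at h1
  rw [m100 (H.hS' i)] at h2
  linarith [h1.2.1, h2.2.1]
theorem edge_ray2 {i : ZMod n} {x : E3} (h1 : x ∈ pc ![u i, u (i+1)]) : x ∉ pc ![u (i+1)] := by
  intro h2
  rw [m110 (H.hS' i)] at h1
  rw [m010 (H.hS' i)] at h2
  linarith [h1.1, h2.1]

theorem D1 {i j : ZMod n} {x : E3} (h1 : x ∈ pc ![u i]) (h2 : x ∈ kk (u j) (u (j+1))) : j = i ∨ j = i - 1 := by
  by_contra hc
  push Not at hc
  have hi : x ∈ kk (u i) (u (i+1)) := ray_kk h1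
  by_cases hj : j = i + 1
  · subst hj
    exact H.ray_ne h1 (H.adj hi h2)
  · exact H.hP i j hc.1.symm hj (fun h => hc.2 (by rw [h]; ring)) x hi h2

theorem D2 {i j : ZMod n} {x : E3} (h1 : x ∈ pc ![u i, u (i+1)]) (h2 : x ∈ kk (u j) (u (j+1))) : j = i := by
  by_contra hc
  have hi : x ∈ kk (u i) (u (i+1)) := edge_kk h1
  by_cases hj : j = i + 1
  · subst hj
    exact H.edge_ray2 h1 (H.adj hi h2)
  · by_cases hj' : i = j + 1
    · subst hj'
      exact H.edge_ray1 h1 (H.adj h2 hi)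
    · exact H.hP i j (Ne.symm hc) hj hj' x hi h2

theorem D3 {i j : ZMod n} {x : E3} (h1 : x ∈ pc ![u i]) (h2 : x ∈ pc ![u j]) : j = i := by
  rcases H.D1 h1 (ray_kk (b := u (j+1)) h2) with h | h
  · exact h
  · subst h
    exfalso; apply H.ray_ne h2; rwa [sub_add_cancel]

theorem ne0 {x : E3} (h : x ∈ PP u) : x ≠ 0 := by
  obtain ⟨i, hi⟩ := h
  have hd : det3 (u (i + 1 + 1)) (u i) (u (i+1)) ≠ 0 := by
    convert H.hS' i using 1; simp only [det3_eq]; ring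
  exact ((m0kk hd x).1 hi).1

theorem kk_off (i : ZMod n) {x : E3} (h0 : x ≠ 0) (hx : x ∉ kk (u i) (u (i+1))) : ∀ᶠ y in 𝓝 x, y ∉ kk (u i) (u (i+1)) := by
  have hd : det3 (u (i + 1 + 1)) (u i) (u (i+1)) ≠ 0 := by
    convert H.hS' i using 1; simp only [det3_eq]; ring
  exact kk_closed hd h0 hx

/-- near a nonzero point, only the cones through that point matter -/
theorem near {x : E3} (h0 : x ≠ 0) : ∀ᶠ y in 𝓝 x, ∀ i, y ∈ kk (u i) (u (i+1)) → x ∈ kk (u i) (u (i+1)) := by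
  rw [eventually_all]
  intro i
  by_cases h : x ∈ kk (u i) (u (i+1))
  · simp [h]
  · filter_upwards [H.kk_off i h0 h] with y hy h'; exact absurd h' hy

theorem PP_cases {x : E3} (h : x ∈ PP u) : (∃ i, x ∈ pc ![u i, u (i+1)]) ∨ ∃ i, x ∈ pc ![u i] := by
  obtain ⟨i, hi⟩ := h
  rcases kk_cases hi with h | h | h
  · exact Or.inl ⟨_, h⟩
  · exact Or.inr ⟨_, h⟩
  · exact Or.inr ⟨_, h⟩

/-- indicator of the polygon as a sum of cells -/
theorem ind_PP : ind (PP u) = ∑ i, (ind (pc ![u i, u (i+1)]) + ind (pc ![u i])) := by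
  funext x
  rw [Finset.sum_apply]
  simp only [Pi.add_apply, Finset.sum_add_distrib]
  by_cases hx : x ∈ PP u
  · rw [ind_mem hx]
    rcases H.PP_cases hx with ⟨i, hi⟩ | ⟨i, hi⟩
    · rw [Finset.sum_eq_single i, ind_mem hi, Finset.sum_eq_zero]
      · simp
      · intro j _
        apply ind_not; intro hj
        have := H.D2 hi (ray_kk (b := u (j+1)) hj)
        subst this; exact H.edge_ray1 hi hj
      · intro j _ hj; exact ind_not fun h => hj (H.D2 hi (edge_kk h))
      · simp
    · rw [Finset.sum_eq_zero, Finset.sum_eq_single i, ind_mem hi]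
      · simp
      · intro j _ hj; exact ind_not fun h => hj (H.D3 hi h)
      · simp
      · intro j _
        apply ind_not; intro hj
        rcases H.D1 hi (edge_kk hj) with h | h
        · subst h; exact H.edge_ray1 hj hi
        · subst h; rw [sub_add_cancel] at hj
          have := H.edge_ray2 (i := i - 1) (by rwa [sub_add_cancel]) (x := x)
          rw [sub_add_cancel] at this; exact this hi
  · rw [ind_not hx, Finset.sum_eq_zero, Finset.sum_eq_zero]
    · simp
    · intro i _; exact ind_not fun h => hx ⟨i, ray_kk h⟩
    · intro i _; exact ind_not fun h => hx ⟨i, edge_kk h⟩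

theorem EE_PP : EE (ind (PP u)) = 0 := by
  rw [H.ind_PP, map_sum]
  apply Finset.sum_eq_zero
  intro i _
  rw [map_add, EE_pc (by norm_num) (li12 (H.hS' i)), EE_pc (by norm_num) (li1 (H.hS' i))]
  norm_num

theorem off {x : E3} (h0 : x ≠ 0) (h : x ∉ PP u) : ∀ᶠ y in 𝓝 x, y ∉ PP u := by
  filter_upwards [H.near h0] with y hy
  rintro ⟨i, hi⟩; exact h ⟨i, hy i hi⟩
end Poly

end GS

namespace GS
open Filter Topology Module

def tr {d : ℕ} (g : Fin d → E3) : (E3 → ℚ) × (E3 → ℚ) × (E3 → ℚ) := (ind (pc g), hc g, hc' g)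

/-- the fan triple -/
def FT {n : ℕ} [NeZero n] (u : ZMod n → E3) (ζ : E3) (e M : ZMod n → ℚ) : (E3 → ℚ) × (E3 → ℚ) × (E3 → ℚ) :=
  ∑ i, (ep u ζ i • tr ![ζ, u i, u (i+1)] + ((ep u ζ (i-1) + ep u ζ i)/2) • tr ![ζ, u i] +
    e i • tr ![u i, u (i+1)] + M i • tr ![u i]) + WW u ζ • tr ![ζ]

def Mp {n : ℕ} (u : ZMod n → E3) (ζ : E3) (i : ZMod n) : ℚ := (epp u ζ (i-1) + epp u ζ i + tau u ζ i) / 2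
def Mm {n : ℕ} (u : ZMod n → E3) (ζ : E3) (i : ZMod n) : ℚ := (epm u ζ (i-1) + epm u ζ i + tau u ζ i) / 2

theorem FT_mem {n : ℕ} [NeZero n] {u : ZMod n → E3} {ζ : E3} (H : Hyp u ζ) (e M : ZMod n → ℚ) : FT u ζ e M ∈ TT := by
  unfold FT
  refine TT.add_mem (TT.sum_mem fun i _ => ?_) (TT.smul_mem _ (TT_mem (by norm_num) (li1 (H.hE 0))))
  refine TT.add_mem (TT.add_mem (TT.add_mem ?_ ?_) ?_) ?_
  · exact TT.smul_mem _ (TT_mem (by norm_num) (det3_li (H.hE i)))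
  · exact TT.smul_mem _ (TT_mem (by norm_num) (li12 (H.hE i)))
  · exact TT.smul_mem _ (TT_mem (by norm_num) (li23 (H.hE i)))
  · exact TT.smul_mem _ (TT_mem (by norm_num) (li2 (H.hE i)))

theorem FT_1 {n : ℕ} [NeZero n] (u : ZMod n → E3) (ζ : E3) (e M : ZMod n → ℚ) : (FT u ζ e M).1 =
    ∑ i, (ep u ζ i • ind (pc ![ζ, u i, u (i+1)]) + ((ep u ζ (i-1) + ep u ζ i)/2) • ind (pc ![ζ, u i]) +
    e i • ind (pc ![u i, u (i+1)]) + M i • ind (pc ![u i])) + WW u ζ • ind (pc ![ζ]) := by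
  simp [FT, Prod.fst_sum, tr]

theorem EE_FT {n : ℕ} [NeZero n] {u : ZMod n → E3} {ζ : E3} (H : Hyp u ζ) (e M : ZMod n → ℚ) :
    EE (FT u ζ e M).1 = WW u ζ + ∑ i, (M i - e i) := by
  rw [FT_1, map_add, map_sum, map_smul, EE_pc (by norm_num) (li1 (H.hE 0))]
  have : ∀ i, EE (ep u ζ i • ind (pc ![ζ, u i, u (i+1)]) + ((ep u ζ (i-1) + ep u ζ i)/2) • ind (pc ![ζ, u i]) +
    e i • ind (pc ![u i, u (i+1)]) + M i • ind (pc ![u i])) = (ep u ζ i)/2 - ep u ζ (i-1) / 2 + (M i - e i) := by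
    intro i
    rw [map_add, map_add, map_add, map_smul, map_smul, map_smul, map_smul,
      EE_pc (by norm_num) (li12 (H.hE i)), EE_pc (by norm_num) (li23 (H.hE i)), EE_pc (by norm_num) (li2 (H.hE i)),
      EE_pc (by norm_num) (det3_li (H.hE i))]
    simp; ring
  rw [Finset.sum_congr rfl fun i _ => this i, Finset.sum_add_distrib, Finset.sum_sub_distrib,
    sum_sub1 (fun i => ep u ζ i / 2)]
  simp; ring

def ff {n : ℕ} [NeZero n] (u : ZMod n → E3) (ζ : E3) : E3 → ℚ := (FT u ζ (epp u ζ) (Mp u ζ)).1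
def ff' {n : ℕ} [NeZero n] (u : ZMod n → E3) (ζ : E3) : E3 → ℚ := (FT u ζ (epm u ζ) (Mm u ζ)).1

theorem ff_sub {n : ℕ} [NeZero n] {u : ZMod n → E3} {ζ : E3} (H : Hyp u ζ) : ff' u ζ = ff u ζ - ind (PP u) := by
  rw [ff, ff', FT_1, FT_1, H.poly.ind_PP]
  have : ∀ i, epm u ζ i = epp u ζ i - 1 := fun i => by unfold epm epp; ring
  have h2 : ∀ i, Mm u ζ i = Mp u ζ i - 1 := fun i => by unfold Mm Mp; rw [this, this]; ring
  simp only [this, h2, sub_smul, Finset.sum_add_distrib, Finset.sum_sub_distrib, one_smul]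
  abel

def cp {n : ℕ} (u : ZMod n → E3) (ζ : E3) (i : ZMod n) (x : E3) : ℝ := det3 x (u i) (u (i+1)) / eE u ζ i
def cq {n : ℕ} (u : ZMod n → E3) (ζ : E3) (i : ZMod n) (x : E3) : ℝ := det3 ζ x (u (i+1)) / eE u ζ i
def cr {n : ℕ} (u : ZMod n → E3) (ζ : E3) (i : ZMod n) (x : E3) : ℝ := det3 ζ (u i) x / eE u ζ i

open Classical in
def AA {n : ℕ} (u : ZMod n → E3) (ζ : E3) (i : ZMod n) (x : E3) : ℚ :=
  if 0 < cp u ζ i x ∧ 0 ≤ cq u ζ i x ∧ 0 ≤ cr u ζ i x then ep u ζ i * ((sg (cq u ζ i x) + sg (cr u ζ i x)) / 2) else 0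

theorem AA_eq {n : ℕ} {u : ZMod n → E3} {ζ : E3} (H : Hyp u ζ) (i : ZMod n) (x : E3) :
    AA u ζ i x = ep u ζ i * (ind (pc ![ζ, u i, u (i+1)]) x + ind (pc ![ζ, u i]) x / 2 + ind (pc ![ζ, u (i+1)]) x / 2) := by
  classical
  simp only [ind, m111 (H.hE i), m110 (H.hE i), m101 (H.hE i), AA]
  change (if _ then _ else _) = _ * ((if 0 < cp u ζ i x ∧ 0 < cq u ζ i x ∧ 0 < cr u ζ i x then (1:ℚ) else 0)
    + (if 0 < cp u ζ i x ∧ 0 < cq u ζ i x ∧ cr u ζ i x = 0 then (1:ℚ) else 0) / 2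
    + (if 0 < cp u ζ i x ∧ cq u ζ i x = 0 ∧ 0 < cr u ζ i x then (1:ℚ) else 0) / 2)
  generalize cp u ζ i x = p
  generalize cq u ζ i x = q
  generalize cr u ζ i x = r
  by_cases hp : 0 < p
  · rcases lt_trichotomy q 0 with hq | rfl | hq <;> rcases lt_trichotomy r 0 with hr | rfl | hr <;>
    simp [*, sg_pos, sg_neg, sg_zero, hp, not_le_of_gt, le_of_lt, not_lt_of_gt, ne_of_lt, ne_of_gt]
  · simp [hp]

theorem ff_eq {n : ℕ} [NeZero n] {u : ZMod n → E3} {ζ : E3} (H : Hyp u ζ) (e M : ZMod n → ℚ) (x : E3) :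
    (FT u ζ e M).1 x = ∑ i, AA u ζ i x + ∑ i, e i * ind (pc ![u i, u (i+1)]) x + ∑ i, M i * ind (pc ![u i]) x +
      WW u ζ * ind (pc ![ζ]) x := by
  have h2 := sum_add1 (fun i => ep u ζ (i - 1) * (ind (pc ![ζ, u i]) x / 2))
  simp only [add_sub_cancel_right] at h2
  rw [Finset.sum_congr rfl fun i _ => AA_eq H i x]
  rw [FT_1]
  simp only [mul_add, Finset.sum_add_distrib, Pi.add_apply, Finset.sum_apply, Pi.smul_apply, smul_eq_mul]
  rw [h2]
  have : ∑ i, (ep u ζ (i-1) + ep u ζ i) / 2 * ind (pc ![ζ, u i]) x = ∑ i, ep u ζ i * (ind (pc ![ζ, u i]) x / 2) +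
      ∑ i, ep u ζ (i-1) * (ind (pc ![ζ, u i]) x / 2) := by
    rw [← Finset.sum_add_distrib]; exact Finset.sum_congr rfl fun i _ => by ring
  rw [this]; ring

theorem sg_cq {n : ℕ} {u : ZMod n → E3} {ζ : E3} (H : Hyp u ζ) (i : ZMod n) (x : E3) :
    ep u ζ i * sg (cq u ζ i x) = sg (det3 ζ x (u (i+1))) := by
  have h4 : ep u ζ i * ep u ζ i = 1 := sg_sq (H.hE i)
  rw [cq, sg_div]
  change _ * (_ * ep u ζ i) = _
  linear_combination sg (det3 ζ x (u (i+1))) * h4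
theorem sg_cr {n : ℕ} {u : ZMod n → E3} {ζ : E3} (H : Hyp u ζ) (i : ZMod n) (x : E3) :
    ep u ζ i * sg (cr u ζ i x) = - sg (det3 ζ x (u i)) := by
  have h4 : ep u ζ i * ep u ζ i = 1 := sg_sq (H.hE i)
  have h5 : det3 ζ (u i) x = - det3 ζ x (u i) := by simp only [det3_eq]; ring
  rw [cr, sg_div, h5, sg_neg']
  change _ * (_ * ep u ζ i) = _
  linear_combination - sg (det3 ζ x (u i)) * h4

theorem det3_cont1 (b c : E3) : Continuous fun y => det3 y b c := by
  simp only [det3_eq]; fun_prop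
theorem det3_cont2 (b c : E3) : Continuous fun y => det3 b y c := by
  simp only [det3_eq]; fun_prop
theorem det3_cont3 (b c : E3) : Continuous fun y => det3 b c y := by
  simp only [det3_eq]; fun_prop

theorem kk_iff {n : ℕ} {u : ZMod n → E3} {ζ : E3} (H : Hyp u ζ) (i : ZMod n) (x : E3) :
    x ∈ kk (u i) (u (i+1)) ↔ x ≠ 0 ∧ cp u ζ i x = 0 ∧ 0 ≤ cq u ζ i x ∧ 0 ≤ cr u ζ i x := m0kk (H.hE i) x

theorem Zcoord {n : ℕ} {u : ZMod n → E3} {ζ : E3} (H : Hyp u ζ) (i : ZMod n) (x : E3) (hZ : det3 ζ x (u i) = 0) :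
    cr u ζ i x = 0 ∧ cq u ζ (i-1) x = 0 ∧ cp u ζ i x = cp u ζ (i-1) x ∧ cq u ζ i x = cr u ζ (i-1) x := by
  have h1 : cr u ζ i x = 0 := by
    have h5 : det3 ζ (u i) x = - det3 ζ x (u i) := by simp only [det3_eq]; ring
    rw [cr, h5, hZ]; simp
  have h2 : cq u ζ (i-1) x = 0 := by
    rw [cq, sub_add_cancel, hZ]; simp
  refine ⟨h1, h2, ?_⟩
  have h3 := coord (H.hE i) x
  change x = cp u ζ i x • ζ + cq u ζ i x • u i + cr u ζ i x • u (i+1) at h3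
  rw [h1, zero_smul, add_zero] at h3
  have h4 := coord_uniq (x := x) (p := cp u ζ i x) (q := 0) (r := cq u ζ i x) (H.hE (i-1)) (by
    rw [sub_add_cancel]; rw [← sub_eq_zero]; nth_rewrite 1 [h3]; module)
  exact ⟨h4.1.symm, h4.2.2.symm⟩

theorem sum_AA_loc {n : ℕ} [NeZero n] {u : ZMod n → E3} {ζ : E3} (H : Hyp u ζ) {x : E3} (h0 : x ≠ 0)
    (hx : x ∉ pc ![ζ]) :
    ∀ᶠ y in 𝓝 x, ∑ i, AA u ζ i y = ∑ i, AA u ζ i x + ∑ i, ind (kk (u i) (u (i+1))) x * AA u ζ i y := by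
  classical
  have F1 := freeze (F := fun i y => cp u ζ i y) (fun i => by unfold cp; exact (det3_cont1 _ _).div_const _) x
  have F2 := freeze (F := fun i y => cq u ζ i y) (fun i => by unfold cq; exact (det3_cont2 _ _).div_const _) x
  have F3 := freeze (F := fun i y => cr u ζ i y) (fun i => by unfold cr; exact (det3_cont3 _ _).div_const _) x
  have F4 := freeze (F := fun i y => det3 ζ y (u i)) (fun i => det3_cont2 _ _) x
  let χ : ZMod n → ℚ := fun i => if 0 < cp u ζ i x ∧ 0 ≤ cq u ζ i x ∧ 0 ≤ cr u ζ i x then 1 else 0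
  have hsum : ∀ y, ∑ i, χ i * (ep u ζ i * ((sg (cq u ζ i y) + sg (cr u ζ i y)) / 2)) =
      ∑ i, (χ (i-1) - χ i) * sg (det3 ζ y (u i)) / 2 := by
    intro y
    have h2 := sum_add1 (fun i => χ (i-1) * sg (det3 ζ y (u i)) / 2)
    simp only [add_sub_cancel_right] at h2
    simp only [sub_mul, sub_div, Finset.sum_sub_distrib]
    rw [← h2, ← Finset.sum_sub_distrib]
    refine Finset.sum_congr rfl fun i _ => ?_
    linear_combination χ i / 2 * sg_cq H i y + χ i / 2 * sg_cr H i y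
  filter_upwards [F1, F2, F3, F4] with y y1 y2 y3 y4
  have key : ∑ i, χ i * (ep u ζ i * ((sg (cq u ζ i y) + sg (cr u ζ i y)) / 2)) =
      ∑ i, χ i * (ep u ζ i * ((sg (cq u ζ i x) + sg (cr u ζ i x)) / 2)) := by
    rw [hsum, hsum]
    refine Finset.sum_congr rfl fun i _ => ?_
    by_cases hZ : det3 ζ x (u i) = 0
    · obtain ⟨a1, a2, a3, a4⟩ := Zcoord H i x hZ
      have : χ (i-1) = χ i := by simp only [χ, a1, a2, a3, a4, le_refl, true_and, and_true]
      rw [this]; simp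
    · rw [y4 i hZ]
  have hAx : ∀ i, AA u ζ i x = χ i * (ep u ζ i * ((sg (cq u ζ i x) + sg (cr u ζ i x)) / 2)) := by
    intro i; simp only [AA, χ]; split_ifs <;> simp
  rw [Finset.sum_congr rfl fun i _ => hAx i, ← key, ← Finset.sum_add_distrib]
  refine Finset.sum_congr rfl fun i _ => ?_
  have hz : ¬ (0 < cp u ζ i x ∧ cq u ζ i x = 0 ∧ cr u ζ i x = 0) := fun h => hx ((m100 (H.hE i) x).2 h)
  have y1' := y1 i; have y2' := y2 i; have y3' := y3 i
  simp only [ind, kk_iff H, h0, AA, χ, ne_eq, not_false_eq_true, true_and]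
  generalize cp u ζ i x = p at *
  generalize cq u ζ i x = q at *
  generalize cr u ζ i x = r at *
  generalize cp u ζ i y = p' at *
  generalize cq u ζ i y = q' at *
  generalize cr u ζ i y = r' at *
  rcases lt_trichotomy p 0 with hp | rfl | hp
  · have hp' := y1' hp.ne
    rw [sg_neg hp, sg_eq_neg_one] at hp'
    simp [not_lt_of_gt hp, not_lt_of_gt hp', hp.ne]
  · by_cases hk : 0 ≤ q ∧ 0 ≤ r
    · simp [hk]
    · have : ¬ (0 ≤ q' ∧ 0 ≤ r') := by
        rintro ⟨hq', hr'⟩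
        by_cases hq : 0 ≤ q
        · have hr : r < 0 := by by_contra h; push Not at h; exact hk ⟨hq, h⟩
          have := y3' hr.ne
          rw [sg_neg hr, sg_eq_neg_one] at this; linarith
        · push Not at hq
          have := y2' hq.ne
          rw [sg_neg hq, sg_eq_neg_one] at this; linarith
      simp [hk, this]
  · have hp' := y1' hp.ne'
    rw [sg_pos hp, sg_eq_one] at hp'
    simp only [hp, hp', true_and, hp.ne', false_and, if_false, add_zero]
    rcases lt_trichotomy q 0 with hq | rfl | hq
    · have hq' := y2' hq.ne
      rw [sg_neg hq, sg_eq_neg_one] at hq'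
      simp [not_le_of_gt hq, not_le_of_gt hq']
    · have hr0 : r ≠ 0 := fun h => hz ⟨hp, rfl, h⟩
      rcases lt_or_gt_of_ne hr0 with hr | hr
      · have hr' := y3' hr0
        rw [sg_neg hr, sg_eq_neg_one] at hr'
        simp [not_le_of_gt hr, not_le_of_gt hr']
      · have hr' := y3' hr0
        rw [sg_pos hr, sg_eq_one] at hr'
        rcases lt_or_ge q' 0 with h | h
        · simp [hr.le, not_le_of_gt h, sg_neg h, sg_pos hr']
        · simp [hr.le, h, hr'.le]
    · have hq' := y2' hq.ne'
      rw [sg_pos hq, sg_eq_one] at hq'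
      rcases lt_trichotomy r 0 with hr | rfl | hr
      · have hr' := y3' hr.ne
        rw [sg_neg hr, sg_eq_neg_one] at hr'
        simp [not_le_of_gt hr, not_le_of_gt hr']
      · rcases lt_or_ge r' 0 with h | h
        · simp [hq.le, not_le_of_gt h, sg_neg h, sg_pos hq']
        · simp [hq.le, h, hq'.le]
      · have hr' := y3' hr.ne'
        rw [sg_pos hr, sg_eq_one] at hr'
        simp [hr.le, hr'.le, hq.le, hq'.le]

end GS

namespace GS
open Filter Topology Module

theorem zray_off {n : ℕ} [NeZero n] {u : ZMod n → E3} {ζ : E3} (H : Hyp u ζ) {x : E3} (h0 : x ≠ 0)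
    (hx : x ∉ pc ![ζ]) : ∀ᶠ y in 𝓝 x, y ∉ pc ![ζ] := by
  have h1 : ∀ y, y ∈ pc ![ζ] → y ∈ kk ζ (u 0) := fun y hy => ray_kk hy
  have h2 : ∀ y, y ∈ pc ![ζ] → y ∈ kk ζ (u (0+1)) := fun y hy => ray_kk hy
  by_cases hk : x ∈ kk ζ (u 0)
  · have : x ∉ kk ζ (u (0+1)) := by
      intro hk2
      obtain ⟨s, t, hs, ht, hst, hx1⟩ := hk
      obtain ⟨s', t', hs', ht', hst', hx2⟩ := hk2
      have h3 := coord_uniq (p := s) (q := t) (r := 0) (H.hE 0) (x := x) (by rw [hx1]; module)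
      have h4 := coord_uniq (p := s') (q := 0) (r := t') (H.hE 0) (x := x) (by rw [hx2]; module)
      have h5 : t = 0 := by rw [← h3.2.1, h4.2.1]
      apply hx; rw [mem_pc1]; exact ⟨s, by linarith, by rw [hx1, h5]; module⟩
    have hd : det3 (u 0) ζ (u (0+1)) ≠ 0 := by
      intro h'; apply H.hE 0; unfold eE
      rw [det3_eq] at h' ⊢; linarith
    filter_upwards [kk_closed hd h0 this] with y hy h using hy (h2 y h)
  · have hd : det3 (u (0+1)) ζ (u 0) ≠ 0 := by
      intro h'; apply H.hE 0; unfold eE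
      rw [det3_eq] at h' ⊢; linarith
    filter_upwards [kk_closed hd h0 hk] with y hy h using hy (h1 y h)

theorem PP_not_zray {n : ℕ} [NeZero n] {u : ZMod n → E3} {ζ : E3} (H : Hyp u ζ) {x : E3} (h : x ∈ PP u) : x ∉ pc ![ζ] := by
  obtain ⟨i, hi⟩ := h
  rw [kk_iff H] at hi
  rw [m100 (H.hE i)]
  rintro ⟨h1, -⟩
  have := hi.2.1; unfold cp eE at this; linarith

theorem ff_zray {n : ℕ} [NeZero n] {u : ZMod n → E3} {ζ : E3} (H : Hyp u ζ) {x : E3} (hx : x ∈ pc ![ζ]) :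
    ∀ᶠ y in 𝓝 x, ff u ζ y = WW u ζ := by
  have hxx := fun i => (m100 (H.hE i) x).1 hx
  have h0 : x ≠ 0 := by
    rintro rfl
    have := (hxx 0).1
    simp [det3_eq] at this
  have hP : x ∉ PP u := fun h => PP_not_zray H h hx
  have F1 := freeze (F := fun i y => cp u ζ i y) (fun i => by unfold cp; exact (det3_cont1 _ _).div_const _) x
  filter_upwards [F1, H.poly.off h0 hP] with y y1 y2
  rw [ff, ff_eq H]
  have e1 : ∑ i, epp u ζ i * ind (pc ![u i, u (i+1)]) y = 0 := Finset.sum_eq_zero fun i _ => by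
    rw [ind_not fun h => y2 ⟨i, edge_kk h⟩, mul_zero]
  have e2 : ∑ i, Mp u ζ i * ind (pc ![u i]) y = 0 := Finset.sum_eq_zero fun i _ => by
    rw [ind_not fun h => y2 ⟨i, ray_kk h⟩, mul_zero]
  rw [e1, e2]
  have hp : ∀ i, 0 < cp u ζ i y := by
    intro i
    have h1 : 0 < cp u ζ i x := (hxx i).1
    have := y1 i h1.ne'
    rwa [sg_pos h1, sg_eq_one] at this
  by_cases hy : y ∈ pc ![ζ]
  · rw [ind_mem hy, Finset.sum_eq_zero]; · simp
    intro i _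
    obtain ⟨a1, a2, a3⟩ := (m100 (H.hE i) y).1 hy
    have a2' : cq u ζ i y = 0 := a2
    have a3' : cr u ζ i y = 0 := a3
    simp [AA, a2', a3', sg_zero]
  · rw [ind_not hy]
    have hA : ∀ i, AA u ζ i y = (1/4) * (sg (det3 ζ y (u (i+1))) - sg (det3 ζ y (u i))) +
        (1/4) * (ep u ζ i * (1 - sg (det3 ζ y (u i)) * sg (det3 ζ y (u (i+1))))) := by
      intro i
      have b1 := sg_cq H i y
      have b2 := sg_cr H i y
      have h4 : ep u ζ i * ep u ζ i = 1 := sg_sq (H.hE i)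
      have : AA u ζ i y = (1/4) * ep u ζ i * (sg (cq u ζ i y) + sg (cr u ζ i y) + 1 + sg (cq u ζ i y) * sg (cr u ζ i y)) := by
        have hz : ¬ (cq u ζ i y = 0 ∧ cr u ζ i y = 0) := fun h => hy ((m100 (H.hE i) y).2 ⟨hp i, h⟩)
        unfold AA
        simp only [hp i, true_and]
        generalize cq u ζ i y = q at *
        generalize cr u ζ i y = r at *
        rcases lt_trichotomy q 0 with hq | rfl | hq <;> rcases lt_trichotomy r 0 with hr | rfl | hr
        · simp [sg_neg hq, sg_neg hr, not_le_of_gt hq]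
        · simp [sg_neg hq, sg_zero, not_le_of_gt hq]
        · simp [sg_neg hq, sg_pos hr, not_le_of_gt hq]
        · simp [sg_zero, sg_neg hr, not_le_of_gt hr]
        · simp at hz
        · simp [sg_zero, sg_pos hr, hr.le]; ring
        · simp [sg_pos hq, sg_neg hr, not_le_of_gt hr]
        · simp [sg_pos hq, sg_zero, hq.le]; ring
        · simp [sg_pos hq, sg_pos hr, hq.le, hr.le]; ring
      rw [this, ← neg_eq_iff_eq_neg.2 b2, ← b1]
      linear_combination (-1/4) * ep u ζ i * sg (cq u ζ i y) * sg (cr u ζ i y) * h4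
    rw [Finset.sum_congr rfl fun i _ => hA i, Finset.sum_add_distrib, ← Finset.mul_sum, ← Finset.mul_sum,
      Finset.sum_sub_distrib, sum_add1 (fun i => sg (det3 ζ y (u i))), sub_self]
    have hc : cross3 ζ y ≠ 0 := by
      intro h
      apply hy
      rw [m100 (H.hE 0)]
      have h1 : ∀ c, det3 ζ y c = 0 := by
        intro c
        have : det3 ζ y c = ⟪c, cross3 ζ y⟫ := by
          change _ = det3 c ζ y; simp only [det3_eq]; ring
        rw [this, h, inner_zero_right]
      refine ⟨hp 0, by rw [h1]; simp, ?_⟩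
      have : det3 ζ (u 0) y = - det3 ζ y (u 0) := by simp only [det3_eq]; ring
      rw [this, h1]; simp
    have hW := Wf_eq H (cross3 ζ y) hc (inner_cross_self _ _)
    rw [Wf] at hW
    have h5 : ∀ i, ⟪u i, cross3 ζ y⟫ = det3 ζ y (u i) := by
      intro i; change det3 _ _ _ = _; simp only [det3_eq]; ring
    simp only [h5] at hW
    rw [hW]; ring

theorem ff_nzray {n : ℕ} [NeZero n] {u : ZMod n → E3} {ζ : E3} (H : Hyp u ζ) {x : E3} (h0 : x ≠ 0) (hx : x ∉ pc ![ζ]) :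
    ∀ᶠ y in 𝓝 x, ff u ζ y - ff u ζ x = ∑ i, ind (kk (u i) (u (i+1))) x * AA u ζ i y +
      ∑ i, epp u ζ i * (ind (pc ![u i, u (i+1)]) y - ind (pc ![u i, u (i+1)]) x) +
      ∑ i, Mp u ζ i * (ind (pc ![u i]) y - ind (pc ![u i]) x) := by
  filter_upwards [zray_off H h0 hx, sum_AA_loc H h0 hx] with y y1 y2
  rw [ff, ff_eq H, ff_eq H, ind_not y1, ind_not hx, y2]
  simp only [mul_sub, Finset.sum_sub_distrib]
  ring

theorem ff_off {n : ℕ} [NeZero n] {u : ZMod n → E3} {ζ : E3} (H : Hyp u ζ) {x : E3} (h0 : x ≠ 0) (hP : x ∉ PP u) :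
    ∀ᶠ y in 𝓝 x, ff u ζ y = ff u ζ x := by
  by_cases hx : x ∈ pc ![ζ]
  · have := ff_zray H hx
    filter_upwards [this] with y hy
    rw [hy, this.self_of_nhds]
  · filter_upwards [ff_nzray H h0 hx, H.poly.off h0 hP] with y hy hy2
    rw [← sub_eq_zero, hy]
    rw [Finset.sum_eq_zero, Finset.sum_eq_zero, Finset.sum_eq_zero]
    · simp
    · intro i _
      rw [ind_not fun h => hy2 ⟨i, ray_kk h⟩, ind_not fun h => hP ⟨i, ray_kk h⟩]; simp
    · intro i _
      rw [ind_not fun h => hy2 ⟨i, edge_kk h⟩, ind_not fun h => hP ⟨i, edge_kk h⟩]; simp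
    · intro i _
      rw [ind_not fun h => hP ⟨i, h⟩, zero_mul]

theorem ff_edge {n : ℕ} [NeZero n] {u : ZMod n → E3} {ζ : E3} (H : Hyp u ζ) {x : E3} {i : ZMod n}
    (hi : x ∈ pc ![u i, u (i+1)]) :
    ∀ᶠ y in 𝓝 x, (ff u ζ y = ff u ζ x ∨ ff u ζ y = ff u ζ x - 1) ∧ (y ∈ PP u → ff u ζ y = ff u ζ x) := by
  have hP : x ∈ PP u := ⟨i, edge_kk hi⟩
  have h0 := H.poly.ne0 hP
  have hx := PP_not_zray H hP
  have F2 := freeze (F := fun i y => cq u ζ i y) (fun i => by unfold cq; exact (det3_cont2 _ _).div_const _) x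
  have F3 := freeze (F := fun i y => cr u ζ i y) (fun i => by unfold cr; exact (det3_cont3 _ _).div_const _) x
  filter_upwards [ff_nzray H h0 hx, H.poly.near h0, F2, F3] with y hy hn y2 y3
  have hn' : ∀ j, y ∈ kk (u j) (u (j+1)) → j = i := fun j hj => H.poly.D2 hi (hn j hj)
  obtain ⟨a1, a2, a3⟩ := (m011 (H.hE i) x).1 hi
  have y2i := y2 i (ne_of_gt a2)
  have y3i := y3 i (ne_of_gt a3)
  rw [show sg (cq u ζ i x) = 1 from sg_pos a2, sg_eq_one] at y2i
  rw [show sg (cr u ζ i x) = 1 from sg_pos a3, sg_eq_one] at y3i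
  rw [Finset.sum_eq_single i, Finset.sum_eq_single i, Finset.sum_eq_zero] at hy
  · rw [ind_mem (edge_kk hi), ind_mem hi] at hy
    have hA : AA u ζ i y = if 0 < cp u ζ i y then ep u ζ i else 0 := by
      classical
      unfold AA
      simp only [y2i.le, y3i.le, and_true, sg_pos y2i, sg_pos y3i]
      split_ifs <;> ring
    have hB : ind (pc ![u i, u (i+1)]) y = if cp u ζ i y = 0 then 1 else 0 := by
      classical
      unfold ind
      simp only [m011 (H.hE i) y]
      change (if cp u ζ i y = 0 ∧ 0 < cq u ζ i y ∧ 0 < cr u ζ i y then (1:ℚ) else 0) = _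
      simp only [y2i, y3i, and_true]
    have hQ : y ∈ PP u → cp u ζ i y = 0 := by
      rintro ⟨j, hj⟩
      have := hn' j hj; subst this
      exact ((kk_iff H _ _).1 hj).2.1
    rw [hA, hB, epp] at hy
    have hff : ∀ d, ff u ζ y - ff u ζ x = d → ff u ζ y = ff u ζ x + d := fun d h => by linarith
    have := hff _ hy
    rw [this]
    rcases H.ep_ne i with h | h <;> rw [h] <;> rcases lt_trichotomy (cp u ζ i y) 0 with hp | hp | hp
    · simp [hp.ne, not_lt_of_gt hp]
      refine ⟨by ring, fun h => absurd (hQ h) hp.ne⟩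
    · simp [hp]
    · simp [hp, hp.ne']
    · simp [hp.ne, not_lt_of_gt hp]
    · simp [hp]
    · simp [hp, hp.ne']
      refine ⟨by ring, fun h => absurd (hQ h) hp.ne'⟩
  · intro j _
    rw [ind_not, ind_not]
    · simp
    · intro hj
      have := H.poly.D2 hi (ray_kk (b := u (j+1)) hj)
      subst this; exact H.poly.edge_ray1 hi hj
    · intro hj
      have h1 := hn' j (ray_kk hj)
      have h2 := hn' (j-1) (by rw [sub_add_cancel]; exact ray_kk' hj)
      exact (one_ne H.hn).1 (by linear_combination h1 - h2)
  · intro j _ hj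
    rw [ind_not fun h => hj (H.poly.D2 hi (edge_kk h)), ind_not fun h => hj (hn' j (edge_kk h))]; simp
  · simp
  · intro j _ hj
    rw [ind_not fun h => hj (H.poly.D2 hi h), zero_mul]
  · simp

set_option maxHeartbeats 2000000 in
open Classical in
theorem vertex_real (p r p' q' k l : ℝ) (e e' s : ℚ) (he : e = 1 ∨ e = -1) (he' : e' = 1 ∨ e' = -1) (hs : s = 1 ∨ s = -1)
    (hk : sg k = s * e') (hl : sg l = e * e') (hp : p' = p + k * r) (hq : q' = - (l * r)) (D : ℚ)
    (hD : D = (if 0 < p ∧ 0 ≤ r then e * ((1 + sg r) / 2) else 0) + (if 0 < p' ∧ 0 ≤ q' then e' * ((sg q' + 1)/2) else 0)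
      + (1 + e) / 2 * (if p = 0 ∧ 0 < r then 1 else 0) + (1 + e') / 2 * (if p' = 0 ∧ 0 < q' then 1 else 0)
      + ((1 + e')/2 + (1 + e)/2 + s * (1 - e' * e)/2)/2 * ((if p = 0 ∧ r = 0 then 1 else 0) - 1)) :
    (D = 0 ∨ D = -1) ∧ ((p = 0 ∧ 0 ≤ r) ∨ (p' = 0 ∧ 0 ≤ q') → D = 0) := by
  subst hD
  have hk' : (sg k = 1 → 0 < k) ∧ (sg k = -1 → k < 0) := ⟨sg_eq_one.1, sg_eq_neg_one.1⟩
  have hl' : (sg l = 1 → 0 < l) ∧ (sg l = -1 → l < 0) := ⟨sg_eq_one.1, sg_eq_neg_one.1⟩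
  rcases lt_trichotomy r 0 with hr | rfl | hr
  · rcases he with rfl | rfl <;> rcases he' with rfl | rfl <;> rcases hs with rfl | rfl <;>
    norm_num at hk hl <;> simp only [sg_eq_one, sg_eq_neg_one] at hk hl <;>
    (have hq' : 0 < q' ∨ q' < 0 := by first | (left; nlinarith; done) | (right; nlinarith; done)) <;>
    (have hpp : p < p' ∨ p' < p := by first | (left; nlinarith; done) | (right; nlinarith; done)) <;>
    (rcases hq' with hq' | hq' <;> rcases hpp with hpp | hpp <;>
     first
     | (exfalso; nlinarith; done)
     | (clear hp hq hk hl; rcases lt_trichotomy p' 0 with h2 | h2 | h2 <;> rcases lt_trichotomy p 0 with h1 | h1 | h1 <;>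
      first
      | (exfalso; linarith)
      | (simp [*, sg_pos, sg_neg, not_le_of_gt, not_lt_of_gt, ne_of_lt, ne_of_gt, le_of_lt]; done)
      | (simp [*, sg_pos, sg_neg, not_le_of_gt, not_lt_of_gt, ne_of_lt, ne_of_gt, le_of_lt]; norm_num; done)))
  · simp only [mul_zero, add_zero, neg_zero] at hp hq
    subst hp hq
    rcases lt_trichotomy p' 0 with h2 | h2 | h2 <;>
    rcases he with rfl | rfl <;> rcases he' with rfl | rfl <;> rcases hs with rfl | rfl <;>
    first
      | (simp [h2, sg_zero, not_lt_of_gt, ne_of_lt, ne_of_gt]; done)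
      | (simp [h2, sg_zero, not_lt_of_gt, ne_of_lt, ne_of_gt]; norm_num; done)
  · rcases he with rfl | rfl <;> rcases he' with rfl | rfl <;> rcases hs with rfl | rfl <;>
    norm_num at hk hl <;> simp only [sg_eq_one, sg_eq_neg_one] at hk hl <;>
    (have hq' : 0 < q' ∨ q' < 0 := by first | (left; nlinarith; done) | (right; nlinarith; done)) <;>
    (have hpp : p < p' ∨ p' < p := by first | (left; nlinarith; done) | (right; nlinarith; done)) <;>
    (rcases hq' with hq' | hq' <;> rcases hpp with hpp | hpp <;>
     first
     | (exfalso; nlinarith; done)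
     | (clear hp hq hk hl; rcases lt_trichotomy p' 0 with h2 | h2 | h2 <;> rcases lt_trichotomy p 0 with h1 | h1 | h1 <;>
      first
      | (exfalso; linarith)
      | (simp [*, sg_pos, sg_neg, not_le_of_gt, not_lt_of_gt, ne_of_lt, ne_of_gt, le_of_lt]; done)
      | (simp [*, sg_pos, sg_neg, not_le_of_gt, not_lt_of_gt, ne_of_lt, ne_of_gt, le_of_lt]; norm_num; done)))

end GS

namespace GS
open Filter Topology Module

theorem vcoord {n : ℕ} {u : ZMod n → E3} {ζ : E3} (H : Hyp u ζ) (i : ZMod n) (y : E3) :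
    cp u ζ (i-1) y = cp u ζ i y + (sS u i / eE u ζ (i-1)) * cr u ζ i y ∧
    cq u ζ (i-1) y = - ((eE u ζ i / eE u ζ (i-1)) * cr u ζ i y) := by
  have h3 := coord (H.hE i) y
  change y = cp u ζ i y • ζ + cq u ζ i y • u i + cr u ζ i y • u (i+1) at h3
  have h4 := coord (H.hE (i-1)) (u (i+1))
  rw [sub_add_cancel] at h4
  have h5 := coord_uniq (x := y) (p := cp u ζ i y + det3 (u (i+1)) (u (i-1)) (u i) / det3 ζ (u (i-1)) (u i) * cr u ζ i y)
    (q := det3 ζ (u (i+1)) (u i) / det3 ζ (u (i-1)) (u i) * cr u ζ i y)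
    (r := cq u ζ i y + det3 ζ (u (i-1)) (u (i+1)) / det3 ζ (u (i-1)) (u i) * cr u ζ i y) (H.hE (i-1)) (by
    rw [sub_add_cancel]; linear_combination (norm := module) h3 + cr u ζ i y • h4)
  obtain ⟨h6, h7, -⟩ := h5
  change cp u ζ (i-1) y = _ at h6
  change cq u ζ (i-1) y = _ at h7
  have e1 : det3 (u (i+1)) (u (i-1)) (u i) = sS u i := by unfold sS; simp only [det3_eq]; ring
  have e2 : det3 ζ (u (i+1)) (u i) = - eE u ζ i := by unfold eE; simp only [det3_eq]; ring
  have e3 : det3 ζ (u (i-1)) (u i) = eE u ζ (i-1) := by unfold eE; rw [sub_add_cancel]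
  rw [e1, e3] at h6
  rw [e2, e3] at h7
  exact ⟨h6, by rw [h7]; ring⟩

theorem ff_vertex {n : ℕ} [NeZero n] {u : ZMod n → E3} {ζ : E3} (H : Hyp u ζ) {x : E3} {i : ZMod n}
    (hi : x ∈ pc ![u i]) :
    ∀ᶠ y in 𝓝 x, (ff u ζ y = ff u ζ x ∨ ff u ζ y = ff u ζ x - 1) ∧ (y ∈ PP u → ff u ζ y = ff u ζ x) := by
  classical
  have hP : x ∈ PP u := ⟨i, ray_kk hi⟩
  have h0 := H.poly.ne0 hP
  have hx := PP_not_zray H hP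
  have hne : i ≠ i - 1 := fun h => (one_ne H.hn).1 (by linear_combination h)
  have F2 := freeze (F := fun i y => cq u ζ i y) (fun i => by unfold cq; exact (det3_cont2 _ _).div_const _) x
  have F3 := freeze (F := fun i y => cr u ζ i y) (fun i => by unfold cr; exact (det3_cont3 _ _).div_const _) x
  filter_upwards [ff_nzray H h0 hx, H.poly.near h0, F2, F3] with y hy hn y2 y3
  have hn' : ∀ j, y ∈ kk (u j) (u (j+1)) → j = i ∨ j = i - 1 := fun j hj => H.poly.D1 hi (hn j hj)
  obtain ⟨a1, a2, a3⟩ := (m010 (H.hE i) x).1 hi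
  obtain ⟨b1, b2, b3⟩ := (m001 (H.hE (i-1)) x).1 (by rw [sub_add_cancel]; exact hi)
  have y2i := y2 i (ne_of_gt a2)
  have y3i := y3 (i-1) (ne_of_gt b3)
  rw [show sg (cq u ζ i x) = 1 from sg_pos a2, sg_eq_one] at y2i
  rw [show sg (cr u ζ (i-1) x) = 1 from sg_pos b3, sg_eq_one] at y3i
  rw [Fintype.sum_eq_add i (i-1) hne, Fintype.sum_eq_add i (i-1) hne, Finset.sum_eq_single i] at hy
  · have kx' : x ∈ kk (u (i-1)) (u (i-1+1)) := by rw [sub_add_cancel]; exact ray_kk' hi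
    have ex : x ∉ pc ![u i, u (i+1)] := fun h => H.poly.edge_ray1 h hi
    have ex' : x ∉ pc ![u (i-1), u (i-1+1)] := fun h => H.poly.edge_ray2 h (by rw [sub_add_cancel]; exact hi)
    rw [ind_mem (ray_kk hi), ind_mem kx', ind_not ex, ind_not ex', ind_mem hi] at hy
    obtain ⟨v1, v2⟩ := vcoord H i y
    have hs := H.ss_ne i
    have hA : AA u ζ i y = if 0 < cp u ζ i y ∧ 0 ≤ cr u ζ i y then ep u ζ i * ((1 + sg (cr u ζ i y))/2) else 0 := by
      unfold AA
      simp only [y2i.le, true_and, sg_pos y2i]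
    have hA' : AA u ζ (i-1) y = if 0 < cp u ζ (i-1) y ∧ 0 ≤ cq u ζ (i-1) y then ep u ζ (i-1) * ((sg (cq u ζ (i-1) y) + 1)/2) else 0 := by
      unfold AA
      simp only [y3i.le, and_true, sg_pos y3i]
    have hB : ind (pc ![u i, u (i+1)]) y = if cp u ζ i y = 0 ∧ 0 < cr u ζ i y then 1 else 0 := by
      unfold ind
      simp only [m011 (H.hE i) y]
      change (if cp u ζ i y = 0 ∧ 0 < cq u ζ i y ∧ 0 < cr u ζ i y then (1:ℚ) else 0) = _
      simp only [y2i, true_and]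
    have hB' : ind (pc ![u (i-1), u (i-1+1)]) y = if cp u ζ (i-1) y = 0 ∧ 0 < cq u ζ (i-1) y then 1 else 0 := by
      unfold ind
      simp only [m011 (H.hE (i-1)) y]
      change (if cp u ζ (i-1) y = 0 ∧ 0 < cq u ζ (i-1) y ∧ 0 < cr u ζ (i-1) y then (1:ℚ) else 0) = _
      simp only [y3i, and_true]
    have hC : ind (pc ![u i]) y = if cp u ζ i y = 0 ∧ cr u ζ i y = 0 then 1 else 0 := by
      unfold ind
      simp only [m010 (H.hE i) y]
      change (if cp u ζ i y = 0 ∧ 0 < cq u ζ i y ∧ cr u ζ i y = 0 then (1:ℚ) else 0) = _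
      simp only [y2i, true_and]
    have hV := vertex_real (cp u ζ i y) (cr u ζ i y) (cp u ζ (i-1) y) (cq u ζ (i-1) y) (sS u i / eE u ζ (i-1))
      (eE u ζ i / eE u ζ (i-1)) (ep u ζ i) (ep u ζ (i-1)) (ss u i) (H.ep_ne i) (H.ep_ne (i-1)) hs
      (sg_div _ _) (sg_div _ _) v1 v2 (ff u ζ y - ff u ζ x) (by
        rw [hy, hA, hA', hB, hB', hC, Mp, epp, epp, tau]; ring)
    obtain ⟨hV1, hV2⟩ := hV
    refine ⟨by rcases hV1 with h | h; · left; linarith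
               · right; linarith, fun hyP => ?_⟩
    rw [← sub_eq_zero]
    apply hV2
    obtain ⟨j, hj⟩ := hyP
    rcases hn' j hj with rfl | rfl
    · left; exact ⟨((kk_iff H _ _).1 hj).2.1, ((kk_iff H _ _).1 hj).2.2.2⟩
    · right; exact ⟨((kk_iff H _ _).1 hj).2.1, ((kk_iff H _ _).1 hj).2.2.1⟩
  · intro j _ hj
    rw [ind_not, ind_not]
    · simp
    · intro h; exact hj (H.poly.D3 hi h)
    · intro h
      have h1 := hn' j (ray_kk h)
      have h2 := hn' (j-1) (by rw [sub_add_cancel]; exact ray_kk' h)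
      rcases h1 with h1 | h1
      · exact hj h1
      · subst h1
        rcases h2 with h2 | h2
        · exact (one_ne H.hn).2 (by linear_combination -h2)
        · exact (one_ne H.hn).1 (by linear_combination -h2)
  · simp
  · rintro j ⟨h1, h2⟩
    rw [ind_not, ind_not]
    · simp
    · intro h; rcases H.poly.D1 hi (edge_kk h) with h | h
      · exact h1 h
      · exact h2 h
    · intro h; rcases hn' j (edge_kk h) with h | h
      · exact h1 h
      · exact h2 h
  · rintro j ⟨h1, h2⟩
    rw [ind_not, zero_mul]
    intro h; rcases H.poly.D1 hi h with h | h
    · exact h1 h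
    · exact h2 h

theorem ff_on {n : ℕ} [NeZero n] {u : ZMod n → E3} {ζ : E3} (H : Hyp u ζ) {x : E3} (hx : x ∈ PP u) :
    ∀ᶠ y in 𝓝 x, (ff u ζ y = ff u ζ x ∨ ff u ζ y = ff u ζ x - 1) ∧ (y ∈ PP u → ff u ζ y = ff u ζ x) := by
  rcases H.poly.PP_cases hx with ⟨i, h⟩ | ⟨i, h⟩
  · exact ff_edge H h
  · exact ff_vertex H h

theorem ff_two {n : ℕ} [NeZero n] {u : ZMod n → E3} {ζ : E3} (H : Hyp u ζ) :
    ∃ a : ℚ, (∀ x, x ≠ 0 → ff u ζ x = a ∨ ff u ζ x = a + 1) ∧ ∀ x ∈ PP u, ff u ζ x = a + 1 := by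
  obtain ⟨c, h1, h2⟩ := two_val u (fun x hx => H.poly.ne0 hx) (ff u ζ) (ff' u ζ)
    (fun x _ hx => by rw [ff_sub H]; simp [ind_not hx]) (fun x h0 hx => ff_off H h0 hx) (fun x hx => by
      have hm : ∀ y ∈ PP u, ff' u ζ y = ff u ζ y - 1 := fun y hy => by rw [ff_sub H]; simp [ind_mem hy]
      have hm' : ∀ y ∈ PP u, min (ff u ζ y) (ff' u ζ y) = ff u ζ y - 1 := fun y hy => by
        rw [hm y hy]; exact min_eq_right (by linarith)
      rw [hm' x hx]
      filter_upwards [ff_on H hx] with y ⟨hy1, hy2⟩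
      refine ⟨?_, ?_, fun h => by rw [hm' y h, hy2 h]⟩
      · rcases hy1 with h | h
        · right; linarith
        · left; linarith
      · by_cases hyP : y ∈ PP u
        · left; rw [hm y hyP, hy2 hyP]
        · have : ff' u ζ y = ff u ζ y := by rw [ff_sub H]; simp [ind_not hyP]
          rw [this]
          rcases hy1 with h | h
          · right; linarith
          · left; linarith)
  refine ⟨c, fun x hx => (h1 x hx).1, fun x hx => ?_⟩
  have := h2 x hx
  rw [ff_sub H] at this
  simp [ind_mem hx] at this
  linarith

theorem ff_int {n : ℕ} [NeZero n] {u : ZMod n → E3} {ζ : E3} (H : Hyp u ζ) :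
    ∃ a W : ℤ, WW u ζ = W ∧ (∀ x, x ≠ 0 → ff u ζ x = a ∨ ff u ζ x = a + 1) ∧ ∀ x ∈ PP u, ff u ζ x = a + 1 := by
  obtain ⟨a, h1, h2⟩ := ff_two H
  have h3 : ff u ζ (-ζ) = 0 := by
    have hz : ∀ i, cp u ζ i (-ζ) < 0 := by
      intro i
      have : cp u ζ i (-ζ) = -1 := by
        have : det3 (-ζ) (u i) (u (i+1)) = - eE u ζ i := by unfold eE; simp [det3_eq]; ring
        rw [cp, this, neg_div, div_self (H.hE i)]
      rw [this]; norm_num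
    rw [ff, ff_eq H]
    have e0 : ∑ i, AA u ζ i (-ζ) = 0 := Finset.sum_eq_zero fun i _ => by
      simp [AA, not_lt_of_gt (hz i)]
    have e1 : ∑ i, epp u ζ i * ind (pc ![u i, u (i+1)]) (-ζ) = 0 := Finset.sum_eq_zero fun i _ => by
      rw [ind_not fun h => (hz i).ne ((m011 (H.hE i) _).1 h).1, mul_zero]
    have e2 : ∑ i, Mp u ζ i * ind (pc ![u i]) (-ζ) = 0 := Finset.sum_eq_zero fun i _ => by
      rw [ind_not fun h => (hz i).ne ((m010 (H.hE i) _).1 h).1, mul_zero]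
    rw [e0, e1, e2, ind_not fun h => ?_]
    · simp
    · have := ((m100 (H.hE 0) _).1 h).1
      have h2 := hz 0
      unfold cp eE at h2; linarith
  have h4 : ff u ζ ζ = WW u ζ := (ff_zray H ((mem_pc1 _ _).2 ⟨1, by norm_num, by simp⟩)).self_of_nhds
  have ha : ∃ a' : ℤ, a = a' := by
    rcases h1 (-ζ) (neg_ne_zero.2 H.zne) with h | h <;> rw [h3] at h
    · exact ⟨0, by simp [← h]⟩
    · exact ⟨-1, by push_cast; linarith⟩
  obtain ⟨a', rfl⟩ := ha
  rcases h1 ζ H.zne with h | h <;> rw [h4] at h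
  · exact ⟨a', a', h, h1, h2⟩
  · exact ⟨a', a' + 1, by push_cast; exact h, h1, h2⟩

end GS

namespace GS
open Filter Topology Module

open Classical in
def aa (a ξ : E3) : ℚ := if ⟪a, ξ⟫ ≤ 0 then 1 else 0

theorem aa_cases (a ξ : E3) : aa a ξ = 0 ∨ aa a ξ = 1 := by unfold aa; split_ifs <;> simp

def hh {n : ℕ} [NeZero n] (u : ZMod n → E3) (ζ : E3) : E3 → ℚ := (FT u ζ (epp u ζ) (Mp u ζ)).2.1
def hh' {n : ℕ} [NeZero n] (u : ZMod n → E3) (ζ : E3) : E3 → ℚ := (FT u ζ (epm u ζ) (Mm u ζ)).2.2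
def dd {n : ℕ} (u : ZMod n → E3) (i : ZMod n) (ξ : E3) : ℚ := aa (u i) ξ + aa (u (i+1)) ξ - 2 * (aa (u i) ξ * aa (u (i+1)) ξ)
def beta {n : ℕ} [NeZero n] (u : ZMod n → E3) (ζ : E3) : ℚ := WW u ζ + (1/2) * ∑ i, tau u ζ i

theorem ind_pol1 (a x : E3) : ind (pol ![a]) x = aa a x := by
  classical
  simp only [ind, aa, pol, Set.mem_ofPred_eq, Fin.forall_fin_one]
  rfl
theorem ind_pol2 (a b x : E3) : ind (pol ![a, b]) x = aa a x * aa b x := by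
  classical
  simp only [ind, aa, pol, Set.mem_ofPred_eq, Fin.forall_fin_two]
  simp only [Matrix.cons_val_zero, Matrix.cons_val_one]
  by_cases h1 : ⟪a, x⟫ ≤ 0 <;> by_cases h2 : ⟪b, x⟫ ≤ 0 <;> simp [h1, h2]
theorem ind_pol3 (a b c x : E3) : ind (pol ![a, b, c]) x = aa a x * (aa b x * aa c x) := by
  classical
  simp only [ind, aa, pol, Set.mem_ofPred_eq, Fin.forall_fin_succ]
  simp
  by_cases h1 : ⟪a, x⟫ ≤ 0 <;> by_cases h2 : ⟪b, x⟫ ≤ 0 <;> by_cases h3 : ⟪c, x⟫ ≤ 0 <;> simp [h1, h2, h3]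

theorem neg1 (a : E3) : (fun i => - (![a] : Fin 1 → E3) i) = ![-a] := by ext i; fin_cases i; rfl
theorem neg2 (a b : E3) : (fun i => - (![a, b] : Fin 2 → E3) i) = ![-a, -b] := by
  funext i; fin_cases i <;> rfl
theorem neg3 (a b c : E3) : (fun i => - (![a, b, c] : Fin 3 → E3) i) = ![-a, -b, -c] := by
  funext i; fin_cases i <;> rfl

theorem hh_eq {n : ℕ} [NeZero n] (u : ZMod n → E3) (ζ ξ : E3) :
    2 * hh u ζ ξ = aa ζ ξ * (2 * WW u ζ - ∑ i, ep u ζ i * dd u i ξ) + ∑ i, epp u ζ i * dd u i ξ + ∑ i, tau u ζ i * aa (u i) ξ := by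
  have h1 : hh u ζ ξ = ∑ i, (ep u ζ i * (aa ζ ξ * (aa (u i) ξ * aa (u (i+1)) ξ)) - ((ep u ζ (i-1) + ep u ζ i)/2) * (aa ζ ξ * aa (u i) ξ)
      - epp u ζ i * (aa (u i) ξ * aa (u (i+1)) ξ) + Mp u ζ i * aa (u i) ξ) + WW u ζ * aa ζ ξ := by
    unfold hh FT
    simp only [Prod.snd_add, Prod.fst_add, Prod.snd_sum, Prod.fst_sum, Prod.smul_snd, Prod.smul_fst, tr, hc, Pi.add_apply,
      Finset.sum_apply, Pi.smul_apply, smul_eq_mul, ind_pol1, ind_pol2, ind_pol3]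
    congr 1
    · refine Finset.sum_congr rfl fun i _ => ?_
      ring
    · ring
  have e1 := sum_sub1 (fun i => ep u ζ i * aa (u (i+1)) ξ)
  have e2 := sum_sub1 (fun i => epp u ζ i * aa (u (i+1)) ξ)
  simp only [sub_add_cancel] at e1 e2
  rw [h1]
  have e3 : ∀ i, ep u ζ i * (aa ζ ξ * (aa (u i) ξ * aa (u (i+1)) ξ)) - ((ep u ζ (i-1) + ep u ζ i)/2) * (aa ζ ξ * aa (u i) ξ)
      - epp u ζ i * (aa (u i) ξ * aa (u (i+1)) ξ) + Mp u ζ i * aa (u i) ξ =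
      (1/2) * (epp u ζ i * dd u i ξ) - aa ζ ξ / 2 * (ep u ζ i * dd u i ξ) + 1/2 * (tau u ζ i * aa (u i) ξ)
       + (1/2) * (epp u ζ (i-1) * aa (u i) ξ) - (1/2) * (epp u ζ i * aa (u (i+1)) ξ)
       - aa ζ ξ / 2 * (ep u ζ (i-1) * aa (u i) ξ) + aa ζ ξ / 2 * (ep u ζ i * aa (u (i+1)) ξ) := by
    intro i; unfold dd Mp; ring
  rw [Finset.sum_congr rfl fun i _ => e3 i]
  simp only [Finset.sum_add_distrib, Finset.sum_sub_distrib, ← Finset.mul_sum, e1, e2]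
  ring

theorem ep_neg {n : ℕ} [NeZero n] (u : ZMod n → E3) (ζ : E3) (i : ZMod n) : ep (-u) (-ζ) i = - ep u ζ i := by
  rw [ep, ep, ← sg_neg']; congr 1; simp [eE, det3_eq]; ring
theorem ss_neg {n : ℕ} (u : ZMod n → E3) (i : ZMod n) : ss (-u) i = - ss u i := by
  rw [ss, ss, ← sg_neg']; congr 1; simp [sS, det3_eq]; ring
theorem tau_neg {n : ℕ} [NeZero n] (u : ZMod n → E3) (ζ : E3) (i : ZMod n) : tau (-u) (-ζ) i = - tau u ζ i := by
  rw [tau, tau, ss_neg, ep_neg, ep_neg]; ring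
theorem cross_neg (a b : E3) : cross3 (-a) (-b) = cross3 a b := by
  apply ext3 <;> simp [cross3_apply]
theorem WW_neg {n : ℕ} [NeZero n] (u : ZMod n → E3) (ζ : E3) : WW (-u) (-ζ) = - WW u ζ := by
  rw [WW, WW, Pi.neg_apply, cross_neg]
  unfold Wf
  rw [← mul_neg, ← Finset.sum_neg_distrib]
  congr 1
  refine Finset.sum_congr rfl fun i _ => ?_
  rw [ep_neg]; simp [sg_neg']

theorem Hyp.neg {n : ℕ} [NeZero n] {u : ZMod n → E3} {ζ : E3} (H : Hyp u ζ) : Hyp (-u) (-ζ) := by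
  refine ⟨H.hn, fun i => ?_, fun i => ?_, ?_⟩
  · have := H.hS i; simp [sS, det3_eq] at this ⊢; contrapose! this; linarith
  · have := H.hE i; simp [eE, det3_eq] at this ⊢; contrapose! this; linarith
  · rintro i j h1 h2 h3 x ⟨s, t, hs, ht, hst, hx⟩ ⟨s', t', hs', ht', hst', hx'⟩
    exact H.hP i j h1 h2 h3 (-x) ⟨s, t, hs, ht, hst, by rw [hx]; simp; abel⟩ ⟨s', t', hs', ht', hst', by rw [hx']; simp; abel⟩

theorem hh'_eq {n : ℕ} [NeZero n] (u : ZMod n → E3) (ζ ξ : E3) :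
    hh' u ζ ξ = beta u ζ + hh (-u) (-ζ) ξ := by
  have h1 : hh' u ζ ξ = ∑ i, (ep u ζ i * (1 - aa (-ζ) ξ * (aa (-u i) ξ * aa (-u (i+1)) ξ)) - ((ep u ζ (i-1) + ep u ζ i)/2) * (1 - aa (-ζ) ξ * aa (-u i) ξ)
      - epm u ζ i * (1 - aa (-u i) ξ * aa (-u (i+1)) ξ) + Mm u ζ i * (1 - aa (-u i) ξ)) + WW u ζ * (1 - aa (-ζ) ξ) := by
    unfold hh' FT
    simp only [Prod.snd_add, Prod.fst_add, Prod.snd_sum, Prod.fst_sum, Prod.smul_snd, Prod.smul_fst, tr, hc', Pi.add_apply,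
      Finset.sum_apply, Pi.smul_apply, smul_eq_mul, neg1, neg2, neg3, ind_pol1, ind_pol2, ind_pol3, Pi.sub_apply, Pi.one_apply]
    congr 1
    · refine Finset.sum_congr rfl fun i _ => ?_
      ring
    · ring
  have h2 := hh_eq (-u) (-ζ) ξ
  rw [WW_neg] at h2
  simp only [ep_neg, tau_neg] at h2
  have e1 := sum_sub1 (fun i => ep u ζ i * aa (-u (i+1)) ξ)
  have e2 := sum_sub1 (fun i => epm u ζ i * aa (-u (i+1)) ξ)
  have e4 := sum_sub1 (fun i => ep u ζ i)
  have e5 := sum_sub1 (fun i => epm u ζ i)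
  simp only [sub_add_cancel] at e1 e2
  have e3 : ∀ i, (ep u ζ i * (1 - aa (-ζ) ξ * (aa (-u i) ξ * aa (-u (i+1)) ξ)) - ((ep u ζ (i-1) + ep u ζ i)/2) * (1 - aa (-ζ) ξ * aa (-u i) ξ)
      - epm u ζ i * (1 - aa (-u i) ξ * aa (-u (i+1)) ξ) + Mm u ζ i * (1 - aa (-u i) ξ)) =
      (1/2) * (epp (-u) (-ζ) i * dd (-u) i ξ) - aa (-ζ) ξ / 2 * (-ep u ζ i * dd (-u) i ξ) + 1/2 * (-tau u ζ i * aa ((-u) i) ξ)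
       - (1/2) * (epm u ζ (i-1) * aa (-u i) ξ) + (1/2) * (epm u ζ i * aa (-u (i+1)) ξ)
       + aa (-ζ) ξ / 2 * (ep u ζ (i-1) * aa (-u i) ξ) - aa (-ζ) ξ / 2 * (ep u ζ i * aa (-u (i+1)) ξ) 
       + (1/2) * ep u ζ i - (1/2) * ep u ζ (i-1) + (1/2) * epm u ζ (i-1) - (1/2) * epm u ζ i + (1/2) * tau u ζ i := by
    intro i; unfold dd Mm; rw [epp, ep_neg, epm, epm]; simp only [Pi.neg_apply]; ring
  rw [h1, Finset.sum_congr rfl fun i _ => e3 i, beta]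
  simp only [Finset.sum_add_distrib, Finset.sum_sub_distrib, ← Finset.mul_sum, e1, e2, e4, e5]
  linear_combination (-1/2) * h2

theorem EE_ff {n : ℕ} [NeZero n] {u : ZMod n → E3} {ζ : E3} (H : Hyp u ζ) : EE (ff u ζ) = beta u ζ := by
  rw [ff, EE_FT H, beta, Finset.mul_sum]
  have e5 := sum_sub1 (fun i => epp u ζ i)
  have : ∀ i, Mp u ζ i - epp u ζ i = (1/2) * tau u ζ i + (1/2) * epp u ζ (i-1) - (1/2) * epp u ζ i := by
    intro i; unfold Mp; ring
  simp only [this, Finset.sum_add_distrib, Finset.sum_sub_distrib, ← Finset.mul_sum, e5]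
  ring

theorem EE_hh {n : ℕ} [NeZero n] {u : ZMod n → E3} {ζ : E3} (H : Hyp u ζ) : EE (hh u ζ) = beta u ζ := by
  rw [← EE_ff H, hh, (TT_EE (FT_mem H _ _)).1]; rfl

theorem EE_hh' {n : ℕ} [NeZero n] {u : ZMod n → E3} {ζ : E3} (H : Hyp u ζ) : EE (hh' u ζ) = beta u ζ := by
  rw [hh', (TT_EE (FT_mem H _ _)).2]
  change EE (ff' u ζ) = _
  rw [ff_sub H, map_sub, H.poly.EE_PP, EE_ff H, sub_zero]

theorem planch_u {n : ℕ} [NeZero n] {u : ZMod n → E3} {ζ : E3} (H : Hyp u ζ) :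
    EE (hh u ζ * hh' u ζ) = EE (ff u ζ * ff' u ζ) := TT_planch (FT_mem H _ _) (FT_mem H _ _)

set_option maxHeartbeats 4000000 in
open Classical in
theorem c_real (S E E' p q z : ℝ) (hS : S ≠ 0) (hE : E ≠ 0) (hE' : E' ≠ 0) (hpq : ¬ (p = 0 ∧ q = 0))
    (key : S * z = E' * q + E * p) (σ : ℚ) (hσ : σ = if 0 ≤ z then 1 else -1) :
    (1 + sg E * σ) / 2 * (1 - 2 * (if q ≤ 0 then 1 else 0)) + (1 + sg E' * σ) / 2 * (1 - 2 * (if p ≤ 0 then 1 else 0))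
      + sg S * (1 - sg E' * sg E) / 2 = 2 * (if 0 < p * S ∧ 0 < q * S then 1 else 0) * sg S +
      ((if q = 0 ∧ 0 < p * S then 1 else 0) + (if p = 0 ∧ 0 < q * S then 1 else 0)) * (sg S - 1) := by
  have hp' : p * S = 0 ↔ p = 0 := by simp [hS]
  have hq' : q * S = 0 ↔ q = 0 := by simp [hS]
  have key' : sg (S * z) = sg (E' * q + E * p) := by rw [key]
  clear key
  have hadd1 : ∀ a b : ℝ, sg a = 1 → sg b = 1 → sg (a + b) = 1 := fun a b => by
    simp only [sg_eq_one]; intros; linarith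
  have hadd2 : ∀ a b : ℝ, sg a = -1 → sg b = -1 → sg (a + b) = -1 := fun a b => by
    simp only [sg_eq_neg_one]; intros; linarith
  have k1 : sg p * sg E = 1 → sg q * sg E' = 1 → sg S * sg z = 1 := by
    intro h1 h2; rw [← sg_mul, key']; apply hadd1 <;> rw [sg_mul, mul_comm] <;> assumption
  have k2 : sg p * sg E = -1 → sg q * sg E' = -1 → sg S * sg z = -1 := by
    intro h1 h2; rw [← sg_mul, key']; apply hadd2 <;> rw [sg_mul, mul_comm] <;> assumption
  have k3 : p = 0 → sg S * sg z = sg E' * sg q := by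
    intro h1; rw [← sg_mul, key', h1]; simp [sg_mul]
  have k4 : q = 0 → sg S * sg z = sg E * sg p := by
    intro h1; rw [← sg_mul, key', h1]; simp [sg_mul]
  have c1 : (0 < p * S) ↔ sg p * sg S = 1 := by rw [← sg_mul, sg_eq_one]
  have c2 : (0 < q * S) ↔ sg q * sg S = 1 := by rw [← sg_mul, sg_eq_one]
  simp only [c1, c2]
  clear hp' hq' c1 c2 key' hadd1 hadd2
  have hz : σ = 1 ∧ (sg z = 0 ∨ sg z = 1) ∨ σ = -1 ∧ sg z = -1 := by
    rw [hσ]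
    rcases lt_trichotomy z 0 with h | h | h
    · right; simp [h, sg_neg h]
    · left; simp [h, sg_zero]
    · left; simp [h.le, sg_pos h]
  clear hσ
  have hS' := sg_ne hS
  have h1 := sg_ne hE
  have h2 := sg_ne hE'
  generalize sg S = S at *
  generalize sg E = E at *
  generalize sg E' = E' at *
  generalize sg z = z at *
  have P : ∀ p : ℝ, (sg p = -1 ∧ (p ≤ 0) ∧ ¬ p=0) ∨ (sg p = 0 ∧ p ≤ 0 ∧ p = 0) ∨ (sg p=1 ∧ ¬ p≤0 ∧ ¬ p=0) := by
    intro p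
    rcases lt_trichotomy p 0 with hp | hp | hp
    · left; exact ⟨sg_neg hp, hp.le, hp.ne⟩
    · right; left; exact ⟨by rw [hp, sg_zero], hp.le, hp⟩
    · right; right; exact ⟨sg_pos hp, not_le_of_gt hp, hp.ne'⟩
  rcases P p with ⟨f1, f2, f3⟩ | ⟨f1, f2, f3⟩ | ⟨f1, f2, f3⟩ <;> rcases P q with ⟨g1, g2, g3⟩ | ⟨g1, g2, g3⟩ | ⟨g1, g2, g3⟩
  case inr.inl.inr.inl => exact absurd ⟨f3, g3⟩ hpq
  all_goals
    simp only [f1, f2, f3, g1, g2, g3, sg_zero, if_true, if_false, le_refl, true_and, false_and, forall_true_left, true_imp_iff, false_imp_iff] at k1 k2 k3 k4 ⊢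
    clear f1 f2 f3 g1 g2 g3 P hpq
    rcases hS' with rfl | rfl <;> rcases h1 with rfl | rfl <;> rcases h2 with rfl | rfl <;>
    rcases hz with ⟨rfl, rfl | rfl⟩ | ⟨rfl, rfl⟩ <;> revert k1 k2 k3 k4 <;> norm_num

end GS

namespace GS
open Filter Topology Module

def mm {n : ℕ} (u : ZMod n → E3) (i : ZMod n) : E3 := cross3 (u i) (u (i+1))

section
variable {a b c : E3} (h : det3 a b c ≠ 0)
include h
theorem dual_exp {ξ : E3} (hb : ⟪b, ξ⟫ = 0) :
    ξ = (⟪a, ξ⟫ / det3 a b c) • cross3 b c + (⟪c, ξ⟫ / det3 a b c) • cross3 a b := by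
  have h1 := cramer_dual a b c ξ
  rw [real_inner_comm] at hb
  rw [hb, zero_smul, add_zero, ← real_inner_comm, ← real_inner_comm ξ c] at h1
  have h2 : det3 a b c • ξ = det3 a b c • ((⟪a, ξ⟫ / det3 a b c) • cross3 b c + (⟪c, ξ⟫ / det3 a b c) • cross3 a b) := by
    rw [smul_add, smul_smul, smul_smul, mul_div_cancel₀ _ h, mul_div_cancel₀ _ h, h1]
  exact smul_right_injective _ h h2

omit h in
theorem dual_inn (a b c : E3) (s t : ℝ) : ⟪a, s • cross3 b c + t • cross3 a b⟫ = s * det3 a b c ∧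
    ⟪b, s • cross3 b c + t • cross3 a b⟫ = 0 ∧ ⟪c, s • cross3 b c + t • cross3 a b⟫ = t * det3 a b c := by
  have h1 : ⟪a, cross3 b c⟫ = det3 a b c := rfl
  have h2 : ⟪c, cross3 a b⟫ = det3 a b c := by change det3 _ _ _ = _; simp only [det3_eq]; ring
  refine ⟨?_, ?_, ?_⟩ <;> rw [inner_add_right, inner_smul_right, inner_smul_right]
  · rw [inner_cross_self, h1]; ring
  · rw [inner_cross_self, inner_cross_self']; ring
  · rw [inner_cross_self', h2]; ring

theorem dpos {p : ℝ} (hp : 0 < p * det3 a b c) : 0 < p / det3 a b c := by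
  rw [← sg_eq_one, sg_div, ← sg_mul, sg_eq_one]; exact hp

theorem L1 (ξ : E3) : ξ ∈ pc ![cross3 a b, cross3 b c] ↔ ⟪b, ξ⟫ = 0 ∧ 0 < ⟪a, ξ⟫ * det3 a b c ∧ 0 < ⟪c, ξ⟫ * det3 a b c := by
  rw [mem_pc2]
  constructor
  · rintro ⟨s, t, hs, ht, hx⟩
    have := dual_inn a b c t s
    rw [add_comm, ← hx] at this
    obtain ⟨h1, h2, h3⟩ := this
    rw [h1, h3, mul_assoc, mul_assoc]
    exact ⟨h2, mul_pos ht (mul_self_pos.2 h), mul_pos hs (mul_self_pos.2 h)⟩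
  · rintro ⟨h1, h2, h3⟩
    refine ⟨_, _, dpos h h3, dpos h h2, ?_⟩
    rw [add_comm]
    exact dual_exp h h1

theorem L2 (ξ : E3) : ξ ∈ pc ![cross3 b c] ↔ ⟪b, ξ⟫ = 0 ∧ ⟪c, ξ⟫ = 0 ∧ 0 < ⟪a, ξ⟫ * det3 a b c := by
  rw [mem_pc1]
  constructor
  · rintro ⟨s, hs, hx⟩
    have := dual_inn a b c s 0
    rw [zero_smul, add_zero, ← hx] at this
    obtain ⟨h1, h2, h3⟩ := this
    rw [h1, h3, mul_assoc]
    exact ⟨h2, by ring, mul_pos hs (mul_self_pos.2 h)⟩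
  · rintro ⟨h1, h2, h3⟩
    refine ⟨_, dpos h h3, ?_⟩
    have := dual_exp h h1
    rwa [h2, zero_div, zero_smul, add_zero] at this

theorem L3 (ξ : E3) : ξ ∈ pc ![cross3 a b] ↔ ⟪b, ξ⟫ = 0 ∧ ⟪a, ξ⟫ = 0 ∧ 0 < ⟪c, ξ⟫ * det3 a b c := by
  rw [mem_pc1]
  constructor
  · rintro ⟨s, hs, hx⟩
    have := dual_inn a b c 0 s
    rw [zero_smul, zero_add, ← hx] at this
    obtain ⟨h1, h2, h3⟩ := this
    rw [h1, h3, mul_assoc]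
    exact ⟨h2, by ring, mul_pos hs (mul_self_pos.2 h)⟩
  · rintro ⟨h1, h2, h3⟩
    refine ⟨_, dpos h h3, ?_⟩
    have := dual_exp h h1
    rwa [h2, zero_div, zero_smul, zero_add] at this
end

theorem ind_if {C : Set E3} {x : E3} {P : Prop} [Decidable P] (h : x ∈ C ↔ P) : ind C x = if P then 1 else 0 := by
  by_cases hp : P
  · rw [if_pos hp, ind_mem (h.2 hp)]
  · rw [if_neg hp, ind_not (fun hx => hp (h.1 hx))]

theorem aa_sg {a ξ : E3} (h : ⟪a, ξ⟫ ≠ 0) : 1 - 2 * aa a ξ = sg ⟪a, ξ⟫ := by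
  classical
  unfold aa
  rcases lt_or_gt_of_ne h with h | h
  · rw [if_pos h.le, sg_neg h]; norm_num
  · rw [if_neg (not_le_of_gt h), sg_pos h]; norm_num

theorem aa_fr {a ξ y : E3} (h : ⟪a, ξ⟫ ≠ 0) (hs : sg ⟪a, y⟫ = sg ⟪a, ξ⟫) : aa a y = aa a ξ := by
  have : ⟪a, y⟫ ≠ 0 := by
    intro h'; rw [h', sg_zero] at hs; exact h (sg_eq_zero.1 hs.symm)
  have h1 := aa_sg h; have h2 := aa_sg this; linarith

open Classical in
def sig (ζ ξ : E3) : ℚ := if 0 ≤ ⟪ζ, ξ⟫ then 1 else -1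

theorem hh_near {n : ℕ} [NeZero n] {u : ZMod n → E3} {ζ : E3} (H : Hyp u ζ) {ξ : E3} (h0 : ξ ≠ 0) :
    ∃ C : ℚ, ∀ᶠ y in 𝓝 ξ, 2 * hh u ζ y = C + ∑ i, (1 + ep u ζ i * sig ζ ξ) / 2 * dd u i y + ∑ i, tau u ζ i * aa (u i) y := by
  have F1 := freeze (F := fun i y => ⟪u i, y⟫) (fun i => by fun_prop) ξ
  have F2 := freeze (F := fun (_ : Unit) y => ⟪ζ, y⟫) (fun i => by fun_prop) ξ
  rcases lt_trichotomy ⟪ζ, ξ⟫ 0 with hz | hz | hz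
  · refine ⟨2 * WW u ζ, ?_⟩
    filter_upwards [F2] with y y2
    have h1 := y2 () hz.ne
    rw [sg_neg hz, sg_eq_neg_one] at h1
    have h2 : sig ζ ξ = -1 := by simp [sig, hz]
    have h3 : aa ζ y = 1 := by simp [aa, h1.le]
    rw [hh_eq, h2, h3]
    have : ∀ i, (1 + ep u ζ i * -1) / 2 * dd u i y = epp u ζ i * dd u i y - ep u ζ i * dd u i y := by
      intro i; unfold epp; ring
    simp only [this, Finset.sum_sub_distrib]; ring
  · refine ⟨0, ?_⟩
    filter_upwards [F1] with y y1
    have h2 : sig ζ ξ = 1 := by simp [sig, hz]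
    have h3 := Wd_aux H ξ h0 hz (fun i => 1 - 2 * aa (u i) y) (fun i hi => by
      rw [aa_fr hi (y1 i hi), aa_sg hi])
    have h4 : ∑ i, ep u ζ i * dd u i y = 2 * WW u ζ := by
      have : ∀ i, ep u ζ i * dd u i y = (1/2) * (ep u ζ i * (1 - (1 - 2 * aa (u i) y) * (1 - 2 * aa (u (i+1)) y))) := by
        intro i; unfold dd; ring
      simp only [this, ← Finset.mul_sum]; rw [h3]; ring
    rw [hh_eq, h4, h2]
    simp [epp]
  · refine ⟨0, ?_⟩
    filter_upwards [F2] with y y2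
    have h1 := y2 () hz.ne'
    rw [sg_pos hz, sg_eq_one] at h1
    have h2 : sig ζ ξ = 1 := by simp [sig, hz.le]
    have h3 : aa ζ y = 0 := by simp [aa, h1]
    rw [hh_eq, h2, h3]
    simp [epp]

theorem not_both {n : ℕ} {u : ZMod n → E3} (hS : ∀ i, sS u i ≠ 0) {ξ : E3} (h0 : ξ ≠ 0) {i : ZMod n} (h1 : ⟪u i, ξ⟫ = 0) :
    ¬ (⟪u (i-1), ξ⟫ = 0 ∧ ⟪u (i+1), ξ⟫ = 0) := by
  rintro ⟨h2, h3⟩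
  have := dual_exp (hS i) h1
  rw [h2, h3] at this
  apply h0; rw [this]; simp

def xx {n : ℕ} (u : ZMod n → E3) (ξ : E3) (i : ZMod n) (y : E3) : ℚ := aa (u i) y - aa (u i) ξ

theorem hh_loc {n : ℕ} [NeZero n] {u : ZMod n → E3} {ζ : E3} (H : Hyp u ζ) {ξ : E3} (h0 : ξ ≠ 0) :
    ∀ᶠ y in 𝓝 ξ, hh u ζ y - hh u ζ ξ = ∑ i, ind (pc ![mm u (i-1), mm u i]) ξ * (ss u i * xx u ξ i y) +
      ∑ i, ind (pc ![mm u i]) ξ * ((ss u i - 1) / 2 * xx u ξ i y + (ss u (i+1) - 1)/2 * xx u ξ (i+1) y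
        - xx u ξ i y * xx u ξ (i+1) y) := by
  classical
  obtain ⟨C, hC⟩ := hh_near H h0
  have F1 := freeze (F := fun i y => ⟪u i, y⟫) (fun i => by fun_prop) ξ
  have hξ := hC.self_of_nhds
  filter_upwards [hC, F1] with y hy y1
  have hx : ∀ i, xx u ξ i y ≠ 0 → ⟪u i, ξ⟫ = 0 := by
    intro i hi
    by_contra h
    exact hi (sub_eq_zero.2 (aa_fr h (y1 i h)))
  set e : ZMod n → ℚ := fun i => (1 + ep u ζ i * sig ζ ξ) / 2 with he
  set x : ZMod n → ℚ := fun i => xx u ξ i y with hxx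
  set a : ZMod n → ℚ := fun i => aa (u i) ξ with ha
  set V : ZMod n → ℚ := fun i => ind (pc ![mm u i]) ξ with hV
  set A : ZMod n → ℚ := fun i => ind (pc ![mm u (i-1), mm u i]) ξ with hA
  have hm : ∀ i, mm u (i-1) = cross3 (u (i-1)) (u i) := fun i => by rw [mm, sub_add_cancel]
  have key1 : ∀ i, x i * (e i * (1 - 2 * a (i+1)) + e (i-1) * (1 - 2 * a (i-1)) + tau u ζ i) =
      x i * (2 * A i * ss u i + (V i + V (i-1)) * (ss u i - 1)) := by
    intro i
    by_cases hi : x i = 0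
    · rw [hi]; ring
    congr 1
    have hu := hx i hi
    have hc := c_real (sS u i) (eE u ζ i) (eE u ζ (i-1)) ⟪u (i-1), ξ⟫ ⟪u (i+1), ξ⟫ ⟪ζ, ξ⟫ (H.hS i) (H.hE i) (H.hE (i-1))
      (not_both H.hS h0 hu) (key_id u ζ i ξ hu) (sig ζ ξ) rfl
    have g1 : A i = if 0 < ⟪u (i-1), ξ⟫ * sS u i ∧ 0 < ⟪u (i+1), ξ⟫ * sS u i then 1 else 0 := by
      simp only [hA]; rw [hm, mm]
      exact ind_if ((L1 (H.hS i) ξ).trans (and_iff_right hu))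
    have g2 : V i = if ⟪u (i+1), ξ⟫ = 0 ∧ 0 < ⟪u (i-1), ξ⟫ * sS u i then 1 else 0 := by
      simp only [hV]; rw [mm]
      exact ind_if ((L2 (H.hS i) ξ).trans (and_iff_right hu))
    have g3 : V (i-1) = if ⟪u (i-1), ξ⟫ = 0 ∧ 0 < ⟪u (i+1), ξ⟫ * sS u i then 1 else 0 := by
      simp only [hV]; rw [hm]
      exact ind_if ((L3 (H.hS i) ξ).trans (and_iff_right hu))
    rw [g1, g2, g3]
    exact hc
  have key2 : ∀ i, e i * (x i * x (i+1)) = V i * (x i * x (i+1)) := by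
    intro i
    by_cases hi : x i = 0
    · rw [hi]; ring
    by_cases hi' : x (i+1) = 0
    · rw [hi']; ring
    congr 1
    have hu := hx i hi
    have hu' := hx (i+1) hi'
    have hp : ⟪u (i-1), ξ⟫ ≠ 0 := fun h => not_both H.hS h0 hu ⟨h, hu'⟩
    have g2 : V i = if 0 < ⟪u (i-1), ξ⟫ * sS u i then 1 else 0 := by
      simp only [hV]; rw [mm]
      exact ind_if (by rw [L2 (H.hS i)]; simp only [hu, hu', true_and]; rfl)
    have hk := key_id u ζ i ξ hu
    rw [hu', mul_zero, zero_add] at hk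
    have hk1 : ss u i * sg ⟪ζ, ξ⟫ = ep u ζ i * sg ⟪u (i-1), ξ⟫ := by
      have := congrArg sg hk; rwa [sg_mul, sg_mul] at this
    have g4 : (0 < ⟪u (i-1), ξ⟫ * sS u i) ↔ sg ⟪u (i-1), ξ⟫ * ss u i = 1 := by rw [← sg_eq_one, sg_mul]; rfl
    have hzz : sig ζ ξ = 1 ∧ (sg ⟪ζ, ξ⟫ = 0 ∨ sg ⟪ζ, ξ⟫ = 1) ∨ sig ζ ξ = -1 ∧ sg ⟪ζ, ξ⟫ = -1 := by
      unfold sig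
      rcases lt_trichotomy ⟪ζ, ξ⟫ 0 with h | h | h
      · right; simp [h, sg_neg h]
      · left; simp [h, sg_zero]
      · left; simp [h.le, sg_pos h]
    simp only [g4] at g2
    simp only [he]
    rw [g2]
    have q1 := H.ep_ne i; have q2 := H.ss_ne i; have q3 := sg_ne hp
    clear * - q1 q2 q3 hk1 hzz
    generalize ep u ζ i = e at *
    generalize ss u i = s at *
    generalize sg ⟪u (i-1), ξ⟫ = p at *
    generalize sg ⟪ζ, ξ⟫ = z at *
    generalize sig ζ ξ = σ at *
    rcases q1 with rfl | rfl <;> rcases q2 with rfl | rfl <;> rcases q3 with rfl | rfl <;>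
    rcases hzz with ⟨rfl, rfl | rfl⟩ | ⟨rfl, rfl⟩ <;> revert hk1 <;> norm_num
  have main : 2 * hh u ζ y - 2 * hh u ζ ξ = ∑ i, (x i * (e i * (1 - 2 * a (i+1)) + e (i-1) * (1 - 2 * a (i-1)) + tau u ζ i) - 2 * (e i * (x i * x (i+1)))) := by
    rw [hy, hξ]
    have hs := sum_sub1 (fun i => x (i+1) * (e i * (1 - 2 * a i)))
    simp only [sub_add_cancel] at hs
    have hterm : ∀ i, x i * (e i * (1 - 2 * a (i+1)) + e (i-1) * (1 - 2 * a (i-1)) + tau u ζ i) - 2 * (e i * (x i * x (i+1)))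
        = (e i * dd u i y - e i * dd u i ξ) + (tau u ζ i * aa (u i) y - tau u ζ i * aa (u i) ξ) + x i * (e (i-1) * (1 - 2 * a (i-1))) - x (i+1) * (e i * (1 - 2 * a i)) := by
      intro i; simp only [hxx, ha, xx, dd]; ring
    rw [Finset.sum_congr rfl fun i _ => hterm i]
    simp only [Finset.sum_add_distrib, Finset.sum_sub_distrib, hs]
    ring
  rw [Finset.sum_congr rfl fun i _ => by rw [key1 i, key2 i]] at main
  have hs := sum_sub1 (fun i => V i * ((ss u (i+1) - 1) / 2 * x (i+1)))
  simp only [sub_add_cancel] at hs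
  have hterm : ∀ i, x i * (2 * A i * ss u i + (V i + V (i-1)) * (ss u i - 1)) - 2 * (V i * (x i * x (i+1))) =
     2 * (A i * (ss u i * x i) + V i * ((ss u i - 1) / 2 * x i + (ss u (i+1) - 1)/2 * x (i+1) - x i * x (i+1)))
      + 2 * (V (i-1) * ((ss u i - 1) / 2 * x i)) - 2 * (V i * ((ss u (i+1) - 1) / 2 * x (i+1))) := by
    intro i; ring
  rw [Finset.sum_congr rfl fun i _ => hterm i] at main
  simp only [Finset.sum_add_distrib, Finset.sum_sub_distrib, ← Finset.mul_sum, hs] at main ⊢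
  linarith

end GS

namespace GS
open Filter Topology Module

theorem gen_dense {ι : Type} [Finite ι] {p : ι → E3} (hp : ∀ i, p i ≠ 0) (ξ : E3) :
    ∃ᶠ y in 𝓝 ξ, ∀ i, ⟪p i, y⟫ ≠ 0 := by
  have h1 : ∀ i, Dense {y : E3 | ⟪p i, y⟫ ≠ 0} := by
    intro i y
    rw [mem_closure_iff_frequently]
    by_cases hy : ⟪p i, y⟫ = 0
    · have hc : Tendsto (fun t : ℝ => y + t • p i) (𝓝[≠] 0) (𝓝 y) := by
        have : Tendsto (fun t : ℝ => y + t • p i) (𝓝 0) (𝓝 (y + (0:ℝ) • p i)) := Continuous.tendsto (by fun_prop) 0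
        rw [zero_smul, add_zero] at this
        exact this.mono_left nhdsWithin_le_nhds
      refine hc.frequently (Eventually.frequently ?_)
      filter_upwards [self_mem_nhdsWithin] with t ht
      simp only [Set.mem_ofPred_eq, inner_add_right, hy, inner_smul_right, zero_add]
      exact mul_ne_zero ht (by simpa using hp i)
    · apply Filter.Frequently.filter_mono (f := pure y) _ (pure_le_nhds y)
      simpa using hy
  have h2 : Dense (⋂ i, {y : E3 | ⟪p i, y⟫ ≠ 0}) := dense_iInter_of_isOpen (fun i => by
    have : Continuous fun y : E3 => ⟪p i, y⟫ := by fun_prop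
    exact isOpen_ne_fun this continuous_const) h1
  have := h2 ξ
  rw [mem_closure_iff_frequently] at this
  simpa using this

def KK {n : ℕ} (u : ZMod n → E3) (i : ZMod n) : E3 := mm u (i - 1)

theorem KK_succ {n : ℕ} (u : ZMod n → E3) (i : ZMod n) : KK u (i+1) = mm u i := by rw [KK, add_sub_cancel_right]
theorem mm_pred {n : ℕ} (u : ZMod n → E3) (i : ZMod n) : mm u (i-1) = cross3 (u (i-1)) (u i) := by rw [mm, sub_add_cancel]

theorem mm_neg {n : ℕ} (u : ZMod n → E3) (i : ZMod n) : mm (-u) i = mm u i := by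
  simp only [mm, Pi.neg_apply, cross_neg]

theorem aa_neg {a ξ : E3} (h : ⟪a, ξ⟫ ≠ 0) : aa (-a) ξ = 1 - aa a ξ := by
  have h1 := aa_sg h
  have h2 := aa_sg (a := -a) (ξ := ξ) (by rw [inner_neg_left]; exact neg_ne_zero.2 h)
  rw [inner_neg_left, sg_neg'] at h2; linarith
theorem aa_neg' {a ξ : E3} (h : ⟪a, ξ⟫ ≠ 0) : aa a (-ξ) = 1 - aa a ξ := by
  rw [← aa_neg h]; unfold aa; simp

theorem dd_neg {n : ℕ} {u : ZMod n → E3} {ξ : E3} (h : ∀ i, ⟪u i, ξ⟫ ≠ 0) (i : ZMod n) : dd (-u) i ξ = dd u i ξ := by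
  simp only [dd, Pi.neg_apply, aa_neg (h _)]; ring
theorem dd_neg' {n : ℕ} {u : ZMod n → E3} {ξ : E3} (h : ∀ i, ⟪u i, ξ⟫ ≠ 0) (i : ZMod n) : dd u i (-ξ) = dd u i ξ := by
  simp only [dd, aa_neg' (h _)]; ring

theorem hh_gen {n : ℕ} [NeZero n] {u : ZMod n → E3} {ζ ξ : E3} (hz : ⟪ζ, ξ⟫ ≠ 0) (h : ∀ i, ⟪u i, ξ⟫ ≠ 0) :
    hh u ζ ξ = hh' u ζ ξ := by
  have h1 := hh_eq u ζ ξ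
  have h2 := hh_eq (-u) (-ζ) ξ
  have h3 := hh'_eq u ζ ξ
  simp only [aa_neg hz, WW_neg, ep_neg, dd_neg h, tau_neg, epp, Pi.neg_apply, aa_neg (h _)] at h1 h2
  have e1 : ∀ i, (1 + ep u ζ i) / 2 * dd u i ξ = (1/2) * dd u i ξ + (1/2) * (ep u ζ i * dd u i ξ) := fun i => by ring
  have e2 : ∀ i, (1 + -ep u ζ i) / 2 * dd u i ξ = (1/2) * dd u i ξ - (1/2) * (ep u ζ i * dd u i ξ) := fun i => by ring
  have e3 : ∀ i, -tau u ζ i * (1 - aa (u i) ξ) = tau u ζ i * aa (u i) ξ - tau u ζ i := fun i => by ring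
  simp only [e1, e2, e3, Finset.sum_add_distrib, Finset.sum_sub_distrib, ← Finset.mul_sum, neg_mul, Finset.sum_neg_distrib] at h1 h2
  rw [beta] at h3
  linarith

theorem hh_N {n : ℕ} [NeZero n] {u : ZMod n → E3} {ζ ξ : E3} (hz : ⟪ζ, ξ⟫ ≠ 0) (h : ∀ i, ⟪u i, ξ⟫ ≠ 0) :
    hh u ζ ξ + hh u ζ (-ξ) = beta u ζ + (1/2) * ∑ i, dd u i ξ := by
  have h1 := hh_eq u ζ ξ
  have h2 := hh_eq u ζ (-ξ)
  simp only [aa_neg' hz, dd_neg' h, epp, aa_neg' (h _)] at h1 h2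
  have e1 : ∀ i, (1 + ep u ζ i) / 2 * dd u i ξ = (1/2) * dd u i ξ + (1/2) * (ep u ζ i * dd u i ξ) := fun i => by ring
  have e3 : ∀ i, tau u ζ i * (1 - aa (u i) ξ) = tau u ζ i - tau u ζ i * aa (u i) ξ := fun i => by ring
  simp only [e1, e3, Finset.sum_add_distrib, Finset.sum_sub_distrib, ← Finset.mul_sum] at h1 h2
  rw [beta]
  linarith

theorem Hyp.une {n : ℕ} {u : ZMod n → E3} {ζ : E3} (H : Hyp u ζ) (i : ZMod n) : u i ≠ 0 := by
  intro h; apply H.hS i; simp [sS, det3_eq, h]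

theorem hh_freq {n : ℕ} [NeZero n] {u : ZMod n → E3} {ζ : E3} (H : Hyp u ζ) (ξ : E3) :
    ∃ᶠ y in 𝓝 ξ, (∀ i, ⟪u i, y⟫ ≠ 0) ∧ hh u ζ y = hh' u ζ y := by
  refine (gen_dense (p := fun i : Option (ZMod n) => i.elim ζ u) (by rintro (_ | i); exacts [H.zne, H.une i]) ξ).mono ?_
  intro y hy
  exact ⟨fun i => hy (some i), hh_gen (hy none) fun i => hy (some i)⟩

theorem xcase {n : ℕ} {u : ZMod n → E3} {ξ : E3} {i : ZMod n} (h : ⟪u i, ξ⟫ = 0) (y : E3) :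
    (⟪u i, y⟫ < 0 ∧ xx u ξ i y = 0 ∧ xx (-u) ξ i y = -1) ∨ (⟪u i, y⟫ = 0 ∧ xx u ξ i y = 0 ∧ xx (-u) ξ i y = 0) ∨
      (0 < ⟪u i, y⟫ ∧ xx u ξ i y = -1 ∧ xx (-u) ξ i y = 0) := by
  unfold xx aa
  rcases lt_trichotomy ⟪u i, y⟫ 0 with h1 | h1 | h1
  · left; simp [h, h1, h1.le]
  · right; left; simp [h, h1]
  · right; right; simp [h, h1, h1.le]

/-- local forms -/
theorem hh_off {n : ℕ} [NeZero n] {u : ZMod n → E3} {ζ : E3} (H : Hyp u ζ) {ξ : E3} (h0 : ξ ≠ 0)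
    (hg : ξ ∉ PP (KK u)) : ∀ᶠ y in 𝓝 ξ, hh u ζ y = hh u ζ ξ ∧ hh' u ζ y = hh' u ζ ξ := by
  have hA : ∀ i, ξ ∉ pc ![mm u (i-1), mm u i] := fun i h => hg ⟨i, by rw [KK_succ]; exact edge_kk h⟩
  have hV : ∀ i, ξ ∉ pc ![mm u i] := fun i h => hg ⟨i, by rw [KK_succ]; exact ray_kk' h⟩
  filter_upwards [hh_loc H h0, hh_loc H.neg h0] with y h1 h2
  simp only [mm_neg, ind_not (hA _), ind_not (hV _), zero_mul, Finset.sum_const_zero, add_zero] at h1 h2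
  rw [hh'_eq, hh'_eq]
  exact ⟨by linarith, by linarith⟩

theorem hh_arc {n : ℕ} [NeZero n] {u : ZMod n → E3} {ζ : E3} (H : Hyp u ζ) (G : Poly (KK u)) {ξ : E3} {j : ZMod n}
    (hg : ξ ∈ pc ![mm u (j-1), mm u j]) : ∀ᶠ y in 𝓝 ξ, hh u ζ y - hh u ζ ξ = ss u j * xx u ξ j y ∧
      hh' u ζ y - hh' u ζ ξ = - ss u j * xx (-u) ξ j y := by
  have hg' : ξ ∈ pc ![KK u j, KK u (j+1)] := by rw [KK_succ]; exact hg
  have h0 := G.ne0 ⟨j, edge_kk hg'⟩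
  have hA : ∀ i ≠ j, ξ ∉ pc ![mm u (i-1), mm u i] := fun i hi h => hi (G.D2 hg' (by rw [KK_succ]; exact edge_kk h))
  have hV : ∀ i, ξ ∉ pc ![mm u i] := fun i h => by
    have h1 := G.D2 hg' (j := i) (by rw [KK_succ]; exact ray_kk' h)
    subst h1
    exact G.edge_ray2 hg' (by rw [KK_succ]; exact h)
  filter_upwards [hh_loc H h0, hh_loc H.neg h0] with y h1 h2
  simp only [mm_neg, ss_neg, ind_not (hV _), zero_mul, Finset.sum_const_zero, add_zero] at h1 h2
  rw [Finset.sum_eq_single j (fun i _ hi => by rw [ind_not (hA i hi), zero_mul]) (by simp), ind_mem hg, one_mul] at h1 h2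
  rw [hh'_eq, hh'_eq]
  exact ⟨h1, by linarith⟩

theorem hh_vert {n : ℕ} [NeZero n] {u : ZMod n → E3} {ζ : E3} (H : Hyp u ζ) (G : Poly (KK u)) {ξ : E3} {j : ZMod n}
    (hg : ξ ∈ pc ![mm u j]) : ∀ᶠ y in 𝓝 ξ, hh u ζ y - hh u ζ ξ = 
       ((ss u j - 1) / 2 * xx u ξ j y + (ss u (j+1) - 1)/2 * xx u ξ (j+1) y - xx u ξ j y * xx u ξ (j+1) y) ∧
      hh' u ζ y - hh' u ζ ξ = ((-ss u j - 1) / 2 * xx (-u) ξ j y + (-ss u (j+1) - 1)/2 * xx (-u) ξ (j+1) y - xx (-u) ξ j y * xx (-u) ξ (j+1) y) := by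
  have hg' : ξ ∈ pc ![KK u (j+1)] := by rw [KK_succ]; exact hg
  have h0 := G.ne0 ⟨j, ray_kk' hg'⟩
  have hA : ∀ i, ξ ∉ pc ![mm u (i-1), mm u i] := fun i h => by
    have h1 : ξ ∈ pc ![KK u i, KK u (i+1)] := by rw [KK_succ]; exact h
    have h2 := G.D2 h1 (ray_kk hg')
    subst h2
    exact G.edge_ray1 h1 hg'
  have hV : ∀ i ≠ j, ξ ∉ pc ![mm u i] := fun i hi h => by
    have h1 := G.D3 hg' (j := i+1) (by rw [KK_succ]; exact h)
    exact hi (add_right_cancel h1)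
  filter_upwards [hh_loc H h0, hh_loc H.neg h0] with y h1 h2
  simp only [mm_neg, ss_neg, ind_not (hA _), zero_mul, Finset.sum_const_zero, zero_add] at h1 h2
  rw [Finset.sum_eq_single j (fun i _ hi => by rw [ind_not (hV i hi), zero_mul]) (by simp), ind_mem hg, one_mul] at h1 h2
  rw [hh'_eq, hh'_eq]
  exact ⟨h1, by linarith⟩

theorem L4 {a b c : E3} (h : det3 a b c ≠ 0) {ξ : E3} (h0 : ξ ≠ 0) : ξ ∈ kk (cross3 a b) (cross3 b c) ↔ ⟪b, ξ⟫ = 0 ∧ 0 ≤ ⟪a, ξ⟫ * det3 a b c ∧ 0 ≤ ⟪c, ξ⟫ * det3 a b c := by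
  constructor
  · intro hk
    rcases kk_cases hk with h1 | h1 | h1
    · have := (L1 h ξ).1 h1; exact ⟨this.1, this.2.1.le, this.2.2.le⟩
    · have := (L3 h ξ).1 h1; exact ⟨this.1, by rw [this.2.1, zero_mul], this.2.2.le⟩
    · have := (L2 h ξ).1 h1; exact ⟨this.1, this.2.2.le, by rw [this.2.1, zero_mul]⟩
  · rintro ⟨h1, h2, h3⟩
    rcases h2.eq_or_lt with h4 | h4
    · have h4' : ⟪a, ξ⟫ = 0 := by simpa [h] using h4.symm
      rcases h3.eq_or_lt with h5 | h5
      · have h5' : ⟪c, ξ⟫ = 0 := by simpa [h] using h5.symm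
        exfalso; apply h0; rw [dual_exp h h1, h4', h5']; simp
      · exact ray_kk ((L3 h ξ).2 ⟨h1, h4', h5⟩)
    · rcases h3.eq_or_lt with h5 | h5
      · have h5' : ⟪c, ξ⟫ = 0 := by simpa [h] using h5.symm
        exact ray_kk' ((L2 h ξ).2 ⟨h1, h5', h4⟩)
      · exact edge_kk ((L1 h ξ).2 ⟨h1, h4, h5⟩)

theorem kkK {n : ℕ} {u : ZMod n → E3} {ζ : E3} (H : Hyp u ζ) {y : E3} (h0 : y ≠ 0) (i : ZMod n) :
    y ∈ kk (KK u i) (KK u (i+1)) ↔ ⟪u i, y⟫ = 0 ∧ 0 ≤ ⟪u (i-1), y⟫ * sS u i ∧ 0 ≤ ⟪u (i+1), y⟫ * sS u i := by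
  rw [KK_succ, KK, mm_pred, mm]
  exact L4 (H.hS i) h0

theorem pos_near {a : E3} {ξ : E3} {S : ℝ} (h : 0 < ⟪a, ξ⟫ * S) : ∀ᶠ y in 𝓝 ξ, 0 < ⟪a, y⟫ * S := by
  have : Continuous fun y : E3 => ⟪a, y⟫ * S := by fun_prop
  exact this.continuousAt.eventually (lt_mem_nhds h)

theorem ne0_near {ξ : E3} (h : ξ ≠ 0) : ∀ᶠ y in 𝓝 ξ, y ≠ 0 := isOpen_ne.mem_nhds h

theorem g_arc {n : ℕ} [NeZero n] {u : ZMod n → E3} {ζ : E3} (H : Hyp u ζ) (G : Poly (KK u)) {ξ : E3} {j : ZMod n}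
    (hg : ξ ∈ pc ![mm u (j-1), mm u j]) : ⟪u j, ξ⟫ = 0 ∧ ∀ᶠ y in 𝓝 ξ, y ∈ PP (KK u) ↔ ⟪u j, y⟫ = 0 := by
  have hg' : ξ ∈ pc ![KK u j, KK u (j+1)] := by rw [KK_succ]; exact hg
  have h0 := G.ne0 ⟨j, edge_kk hg'⟩
  rw [mm_pred, mm, L1 (H.hS j)] at hg
  refine ⟨hg.1, ?_⟩
  filter_upwards [G.near h0, ne0_near h0, pos_near hg.2.1, pos_near hg.2.2] with y hy y0 y1 y2
  constructor
  · rintro ⟨i, hi⟩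
    obtain rfl := G.D2 hg' (hy i hi)
    exact ((kkK H y0 _).1 hi).1
  · intro h
    exact ⟨j, (kkK H y0 _).2 ⟨h, y1.le, y2.le⟩⟩

theorem g_vert {n : ℕ} [NeZero n] {u : ZMod n → E3} {ζ : E3} (H : Hyp u ζ) (G : Poly (KK u)) {ξ : E3} {j : ZMod n}
    (hg : ξ ∈ pc ![mm u j]) : ⟪u j, ξ⟫ = 0 ∧ ⟪u (j+1), ξ⟫ = 0 ∧ ∀ᶠ y in 𝓝 ξ, y ∈ PP (KK u) ↔
     (⟪u j, y⟫ = 0 ∧ 0 ≤ ⟪u (j+1), y⟫ * sS u j) ∨ (⟪u (j+1), y⟫ = 0 ∧ 0 ≤ ⟪u j, y⟫ * sS u (j+1)) := by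
  have hg' : ξ ∈ pc ![KK u (j+1)] := by rw [KK_succ]; exact hg
  have h0 := G.ne0 ⟨j, ray_kk' hg'⟩
  have h1 := hg
  rw [mm, L2 (H.hS j)] at h1
  have h2 := hg
  have h3 : mm u j = cross3 (u (j+1-1)) (u (j+1)) := by rw [add_sub_cancel_right, mm]
  rw [h3, L3 (H.hS (j+1))] at h2
  refine ⟨h1.1, h1.2.1, ?_⟩
  filter_upwards [G.near h0, ne0_near h0, pos_near h1.2.2, pos_near h2.2.2] with y hy y0 y1 y2
  constructor
  · rintro ⟨i, hi⟩
    rcases G.D1 hg' (hy i hi) with rfl | rfl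
    · right
      have := (kkK H y0 _).1 hi
      rw [add_sub_cancel_right] at this
      exact ⟨this.1, this.2.1⟩
    · left
      rw [add_sub_cancel_right] at hi
      have := (kkK H y0 _).1 hi
      exact ⟨this.1, this.2.2⟩
  · rintro (⟨h, h'⟩ | ⟨h, h'⟩)
    · exact ⟨j, (kkK H y0 _).2 ⟨h, y1.le, h'⟩⟩
    · exact ⟨j+1, (kkK H y0 _).2 ⟨h, by rw [add_sub_cancel_right]; exact h', y2.le⟩⟩

end GS

namespace GS
open Filter Topology Module

structure TL (g : Set E3) (h h' : E3 → ℚ) (v : ℚ) (R L : Prop) (y : E3) : Prop where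
  r : R → h y = v + 1 ∧ h' y = v + 1 ∧ y ∉ g
  l : L → h y = v ∧ h' y = v ∧ y ∉ g
  b : ¬ R → ¬ L → y ∈ g ∧ min (h y) (h' y) = v ∧ (h y = v ∨ h y = v + 1) ∧ (h' y = v ∨ h' y = v + 1)

def LocG (g : Set E3) (h h' : E3 → ℚ) (v : ℚ) (ξ : E3) : Prop :=
  ∃ p q d : E3, ⟪p, ξ⟫ = 0 ∧ ⟪q, ξ⟫ = 0 ∧ ⟪p, d⟫ < 0 ∧ ⟪q, d⟫ < 0 ∧
    ((∀ᶠ y in 𝓝 ξ, TL g h h' v (⟪p, y⟫ < 0 ∧ ⟪q, y⟫ < 0) (0 < ⟪p, y⟫ ∨ 0 < ⟪q, y⟫) y) ∨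
     (∀ᶠ y in 𝓝 ξ, TL g h h' v (0 < ⟪p, y⟫ ∨ 0 < ⟪q, y⟫) (⟪p, y⟫ < 0 ∧ ⟪q, y⟫ < 0) y))

theorem loc_arc {n : ℕ} [NeZero n] {u : ZMod n → E3} {ζ : E3} (H : Hyp u ζ) (G : Poly (KK u)) {ξ : E3} {j : ZMod n}
    (hg : ξ ∈ pc ![mm u (j-1), mm u j]) : ∃ v, hh u ζ ξ = v + (1 + ss u j)/2 ∧ hh' u ζ ξ = v + (1 - ss u j)/2 ∧
      LocG (PP (KK u)) (hh u ζ) (hh' u ζ) v ξ := by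
  obtain ⟨hu, hP⟩ := g_arc H G hg
  have h1 := hh_arc H G hg
  have hv : hh' u ζ ξ = hh u ζ ξ - ss u j := by
    obtain ⟨y, ⟨hy1, hy2⟩, hy3, hy4⟩ := ((hh_freq H ξ).and_eventually h1).exists
    rcases xcase hu y with ⟨a1, a2, a3⟩ | ⟨a1, a2, a3⟩ | ⟨a1, a2, a3⟩
    · rw [a2] at hy3; rw [a3] at hy4; linarith
    · exact absurd a1 (hy1 j)
    · rw [a2] at hy3; rw [a3] at hy4; linarith
  refine ⟨hh u ζ ξ - (1 + ss u j)/2, by ring, by rw [hv]; ring, ?_⟩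
  rcases H.ss_ne j with hs | hs
  · refine ⟨u j, u j, - u j, hu, hu, ?_, ?_, Or.inl ?_⟩
    · rw [inner_neg_right, neg_lt_zero]; exact real_inner_self_pos.2 (H.une j)
    · rw [inner_neg_right, neg_lt_zero]; exact real_inner_self_pos.2 (H.une j)
    filter_upwards [h1, hP] with y ⟨hy1, hy2⟩ hy3
    rw [hs] at hy1 hy2 hv ⊢
    rcases xcase hu y with ⟨a1, a2, a3⟩ | ⟨a1, a2, a3⟩ | ⟨a1, a2, a3⟩ <;> rw [a2] at hy1 <;> rw [a3] at hy2
    · exact ⟨fun _ => ⟨by linarith, by linarith, fun h => a1.ne (hy3.1 h)⟩, fun h => by rcases h with h | h <;> exact absurd h (not_lt.2 a1.le),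
        fun h => absurd ⟨a1, a1⟩ h⟩
    · refine ⟨fun h => absurd h.1 (by rw [a1]; simp), fun h => by rcases h with h | h <;> exact absurd h (by rw [a1]; simp), fun _ _ => ⟨hy3.2 a1, ?_, Or.inr (by linarith), Or.inl (by linarith)⟩⟩
      rw [min_eq_right] <;> linarith
    · exact ⟨fun h => absurd h.1 (not_lt.2 a1.le), fun _ => ⟨by linarith, by linarith, fun h => a1.ne' (hy3.1 h)⟩,
        fun _ h => absurd (Or.inl a1) h⟩
  · refine ⟨u j, u j, - u j, hu, hu, ?_, ?_, Or.inr ?_⟩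
    · rw [inner_neg_right, neg_lt_zero]; exact real_inner_self_pos.2 (H.une j)
    · rw [inner_neg_right, neg_lt_zero]; exact real_inner_self_pos.2 (H.une j)
    filter_upwards [h1, hP] with y ⟨hy1, hy2⟩ hy3
    rw [hs] at hy1 hy2 hv ⊢
    rcases xcase hu y with ⟨a1, a2, a3⟩ | ⟨a1, a2, a3⟩ | ⟨a1, a2, a3⟩ <;> rw [a2] at hy1 <;> rw [a3] at hy2
    · exact ⟨fun h => by rcases h with h | h <;> exact absurd h (not_lt.2 a1.le), fun _ => ⟨by linarith, by linarith, fun h => a1.ne (hy3.1 h)⟩, 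
        fun _ h => absurd ⟨a1, a1⟩ h⟩
    · refine ⟨fun h => by rcases h with h | h <;> exact absurd h (by rw [a1]; simp), fun h => absurd h.1 (by rw [a1]; simp), fun _ _ => ⟨hy3.2 a1, ?_, Or.inl (by linarith), Or.inr (by linarith)⟩⟩
      rw [min_eq_left] <;> linarith
    · exact ⟨fun _ => ⟨by linarith, by linarith, fun h => a1.ne' (hy3.1 h)⟩, fun h => absurd h.1 (not_lt.2 a1.le), 
        fun h => absurd (Or.inl a1) h⟩

theorem TL.of {g : Set E3} {h h' : E3 → ℚ} {v : ℚ} {R L : Prop} {y : E3} (e e' : ℚ) (h1 : h y = v + e) (h1' : h' y = v + e')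
    (hc : (R ∧ ¬ L ∧ e = 1 ∧ e' = 1 ∧ y ∉ g) ∨ (L ∧ ¬ R ∧ e = 0 ∧ e' = 0 ∧ y ∉ g) ∨
      (¬ R ∧ ¬ L ∧ y ∈ g ∧ ((e = 0 ∧ e' = 0) ∨ (e = 0 ∧ e' = 1) ∨ (e = 1 ∧ e' = 0)))) : TL g h h' v R L y := by
  rcases hc with ⟨a1, a2, a3, a4, a5⟩ | ⟨a1, a2, a3, a4, a5⟩ | ⟨a1, a2, a3, a4⟩
  · exact ⟨fun _ => ⟨by rw [h1, a3], by rw [h1', a4], a5⟩, fun h => absurd h a2, fun h => absurd a1 h⟩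
  · exact ⟨fun h => absurd h a2, fun _ => ⟨by rw [h1, a3, add_zero], by rw [h1', a4, add_zero], a5⟩, fun _ h => absurd a1 h⟩
  · refine ⟨fun h => absurd h a1, fun h => absurd h a2, fun _ _ => ⟨a3, ?_⟩⟩
    rw [h1, h1']
    rcases a4 with ⟨rfl, rfl⟩ | ⟨rfl, rfl⟩ | ⟨rfl, rfl⟩ <;> simp

theorem two_dir {a b c : E3} (h : det3 a b c ≠ 0) (s t : ℝ) : ∃ d, ⟪b, d⟫ = s ∧ ⟪c, d⟫ = t := by
  have h' : det3 c a b ≠ 0 := by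
    intro h0; apply h; rw [← h0]; simp only [det3_eq]; ring
  have e1 := dual_inn a b c 0 (t / det3 a b c)
  have e2 := dual_inn c a b 0 0
  have e3 := dual_inn b c a 0 0
  have k1 : ⟪b, cross3 c a⟫ = det3 a b c := by change det3 _ _ _ = _; simp only [det3_eq]; ring
  have k2 : ⟪c, cross3 a b⟫ = det3 a b c := by change det3 _ _ _ = _; simp only [det3_eq]; ring
  refine ⟨(s / det3 a b c) • cross3 c a + (t / det3 a b c) • cross3 a b, ?_, ?_⟩ <;>
    rw [inner_add_right, inner_smul_right, inner_smul_right]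
  · rw [k1, inner_cross_self']; field_simp; ring
  · rw [k2, inner_cross_self]; field_simp; ring

set_option maxHeartbeats 2000000 in
theorem loc_vert {n : ℕ} [NeZero n] {u : ZMod n → E3} {ζ : E3} (H : Hyp u ζ) (G : Poly (KK u)) {ξ : E3} {j : ZMod n}
    (hg : ξ ∈ pc ![mm u j]) : ∃ v, hh u ζ ξ = v + (1 + ss u j)*(1 + ss u (j+1))/4 ∧ hh' u ζ ξ = v + (1 - ss u j)*(1 - ss u (j+1))/4 ∧
      LocG (PP (KK u)) (hh u ζ) (hh' u ζ) v ξ := by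
  obtain ⟨hu, hu', hP⟩ := g_vert H G hg
  have h1 := hh_vert H G hg
  have hv : hh' u ζ ξ = hh u ζ ξ - (ss u j + ss u (j+1))/2 := by
    obtain ⟨y, ⟨hy1, hy2⟩, hy3, hy4⟩ := ((hh_freq H ξ).and_eventually h1).exists
    rcases xcase hu y with ⟨a1, a2, a3⟩ | ⟨a1, a2, a3⟩ | ⟨a1, a2, a3⟩ <;>
    rcases xcase hu' y with ⟨b1, b2, b3⟩ | ⟨b1, b2, b3⟩ | ⟨b1, b2, b3⟩ <;>
    first
    | exact absurd a1 (hy1 j)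
    | exact absurd b1 (hy1 (j+1))
    | (rw [a2, b2] at hy3; rw [a3, b3] at hy4
       linarith)
  refine ⟨hh u ζ ξ - (1 + ss u j)*(1 + ss u (j+1))/4, by ring, by rw [hv]; ring, ?_⟩
  have hd := two_dir (H.hS j)
  have hd' : ∀ s t : ℝ, ∃ d, ⟪u j, d⟫ = s ∧ ⟪u (j+1), d⟫ = t := by
    have := two_dir (H.hS (j+1)) 
    intro s t
    have h3 : det3 (u (j+1+1)) (u j) (u (j+1)) ≠ 0 := by
      have := H.hS (j+1); rw [sS, add_sub_cancel_right] at this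
      intro h; apply this; rw [← h]; simp only [det3_eq]; ring
    exact two_dir h3 s t
  set v := hh u ζ ξ - (1 + ss u j)*(1 + ss u (j+1))/4 with hvd
  rcases H.ss_ne j with hs | hs <;> rcases H.ss_ne (j+1) with hs' | hs'
  all_goals
    have q1 : sg (sS u j) = ss u j := rfl
    have q2 : sg (sS u (j+1)) = ss u (j+1) := rfl
    rw [hs] at q1; rw [hs'] at q2; rw [hs, hs'] at hv hvd
    simp only [sg_eq_one, sg_eq_neg_one] at q1 q2
    simp only [hs, hs'] at h1
    have w1 : ∀ x : ℝ, 0 < sS u j → (0 ≤ x * sS u j ↔ 0 ≤ x) := fun x h => mul_nonneg_iff_of_pos_right h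
    have w2 : ∀ x : ℝ, 0 < sS u (j+1) → (0 ≤ x * sS u (j+1) ↔ 0 ≤ x) := fun x h => mul_nonneg_iff_of_pos_right h
    have w3 : ∀ x : ℝ, sS u j < 0 → (0 ≤ x * sS u j ↔ x ≤ 0) := fun x h => by
      constructor <;> intro h' <;> nlinarith
    have w4 : ∀ x : ℝ, sS u (j+1) < 0 → (0 ≤ x * sS u (j+1) ↔ x ≤ 0) := fun x h => by
      constructor <;> intro h' <;> nlinarith
  · simp only [w1 _ q1, w2 _ q2] at hP
    clear w1 w2 w3 w4
    obtain ⟨d, hd1, hd2⟩ := hd' 1 1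
    refine ⟨-u j, -u (j+1), d, by simp [hu], by simp [hu'], by simp [hd1], by simp [hd2], Or.inr ?_⟩
    filter_upwards [h1, hP] with y ⟨hy1, hy2⟩ hy3
    refine TL.of (hh u ζ y - v) (hh' u ζ y - v) (by ring) (by ring) ?_
    rw [hy3]; clear hy3
    try simp only [inner_neg_left, Left.neg_pos_iff, Left.neg_neg_iff]
    have k1 := xcase hu y
    have k2 := xcase hu' y
    clear * - k1 k2 hy1 hy2 hv hvd
    rw [hv] at hy2
    generalize ⟪u j, y⟫ = A at *
    generalize ⟪u (j+1), y⟫ = B at *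
    rcases k1 with ⟨a1, a2, a3⟩ | ⟨a1, a2, a3⟩ | ⟨a1, a2, a3⟩ <;>
    rcases k2 with ⟨b1, b2, b3⟩ | ⟨b1, b2, b3⟩ | ⟨b1, b2, b3⟩ <;>
    rw [a2, b2] at hy1 <;> rw [a3, b3] at hy2 <;> grind
  · simp only [w1 _ q1, w4 _ q2] at hP
    clear w1 w2 w3 w4
    obtain ⟨d, hd1, hd2⟩ := hd' (-1) 1
    refine ⟨u j, -u (j+1), d, by simp [hu], by simp [hu'], by simp [hd1], by simp [hd2], Or.inl ?_⟩
    filter_upwards [h1, hP] with y ⟨hy1, hy2⟩ hy3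
    refine TL.of (hh u ζ y - v) (hh' u ζ y - v) (by ring) (by ring) ?_
    rw [hy3]; clear hy3
    try simp only [inner_neg_left, Left.neg_pos_iff, Left.neg_neg_iff]
    have k1 := xcase hu y
    have k2 := xcase hu' y
    clear * - k1 k2 hy1 hy2 hv hvd
    rw [hv] at hy2
    generalize ⟪u j, y⟫ = A at *
    generalize ⟪u (j+1), y⟫ = B at *
    rcases k1 with ⟨a1, a2, a3⟩ | ⟨a1, a2, a3⟩ | ⟨a1, a2, a3⟩ <;>
    rcases k2 with ⟨b1, b2, b3⟩ | ⟨b1, b2, b3⟩ | ⟨b1, b2, b3⟩ <;>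
    rw [a2, b2] at hy1 <;> rw [a3, b3] at hy2 <;> grind
  · simp only [w3 _ q1, w2 _ q2] at hP
    clear w1 w2 w3 w4
    obtain ⟨d, hd1, hd2⟩ := hd' 1 (-1)
    refine ⟨-u j, u (j+1), d, by simp [hu], by simp [hu'], by simp [hd1], by simp [hd2], Or.inl ?_⟩
    filter_upwards [h1, hP] with y ⟨hy1, hy2⟩ hy3
    refine TL.of (hh u ζ y - v) (hh' u ζ y - v) (by ring) (by ring) ?_
    rw [hy3]; clear hy3
    try simp only [inner_neg_left, Left.neg_pos_iff, Left.neg_neg_iff]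
    have k1 := xcase hu y
    have k2 := xcase hu' y
    clear * - k1 k2 hy1 hy2 hv hvd
    rw [hv] at hy2
    generalize ⟪u j, y⟫ = A at *
    generalize ⟪u (j+1), y⟫ = B at *
    rcases k1 with ⟨a1, a2, a3⟩ | ⟨a1, a2, a3⟩ | ⟨a1, a2, a3⟩ <;>
    rcases k2 with ⟨b1, b2, b3⟩ | ⟨b1, b2, b3⟩ | ⟨b1, b2, b3⟩ <;>
    rw [a2, b2] at hy1 <;> rw [a3, b3] at hy2 <;> grind
  · simp only [w3 _ q1, w4 _ q2] at hP
    clear w1 w2 w3 w4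
    obtain ⟨d, hd1, hd2⟩ := hd' (-1) (-1)
    refine ⟨u j, u (j+1), d, by simp [hu], by simp [hu'], by simp [hd1], by simp [hd2], Or.inr ?_⟩
    filter_upwards [h1, hP] with y ⟨hy1, hy2⟩ hy3
    refine TL.of (hh u ζ y - v) (hh' u ζ y - v) (by ring) (by ring) ?_
    rw [hy3]; clear hy3
    try simp only [inner_neg_left, Left.neg_pos_iff, Left.neg_neg_iff]
    have k1 := xcase hu y
    have k2 := xcase hu' y
    clear * - k1 k2 hy1 hy2 hv hvd
    rw [hv] at hy2
    generalize ⟪u j, y⟫ = A at *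
    generalize ⟪u (j+1), y⟫ = B at *
    rcases k1 with ⟨a1, a2, a3⟩ | ⟨a1, a2, a3⟩ | ⟨a1, a2, a3⟩ <;>
    rcases k2 with ⟨b1, b2, b3⟩ | ⟨b1, b2, b3⟩ | ⟨b1, b2, b3⟩ <;>
    rw [a2, b2] at hy1 <;> rw [a3, b3] at hy2 <;> grind

end GS

namespace GS
open Filter Topology Module

theorem TL.two {g : Set E3} {h h' : E3 → ℚ} {v : ℚ} {R L : Prop} {y : E3} (T : TL g h h' v R L y) :
    (h y = v ∨ h y = v + 1) ∧ (h' y = v ∨ h' y = v + 1) ∧ (y ∈ g → min (h y) (h' y) = v) := by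
  by_cases hR : R
  · have := T.r hR; exact ⟨Or.inr this.1, Or.inr this.2.1, fun h => absurd h this.2.2⟩
  by_cases hL : L
  · have := T.l hL; exact ⟨Or.inl this.1, Or.inl this.2.1, fun h => absurd h this.2.2⟩
  have := T.b hR hL
  exact ⟨this.2.2.1, this.2.2.2, fun _ => this.2.1⟩

theorem LocG.two {g : Set E3} {h h' : E3 → ℚ} {v : ℚ} {ξ : E3} (T : LocG g h h' v ξ) :
    ∀ᶠ y in 𝓝 ξ, (h y = v ∨ h y = v + 1) ∧ (h' y = v ∨ h' y = v + 1) ∧ (y ∈ g → min (h y) (h' y) = v) := by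
  obtain ⟨p, q, d, -, -, -, -, h1 | h1⟩ := T <;> filter_upwards [h1] with y hy using hy.two

theorem Mp_int {n : ℕ} [NeZero n] {u : ZMod n → E3} {ζ : E3} (H : Hyp u ζ) (i : ZMod n) :
    ∃ m : ℤ, tau u ζ i + epp u ζ (i-1) + epp u ζ i = 2 * m := by
  unfold tau epp
  rcases H.ep_ne i with h | h <;> rcases H.ep_ne (i-1) with h' | h' <;> rcases H.ss_ne i with h2 | h2 <;> rw [h, h', h2] <;> norm_num
  all_goals first | exact ⟨0, by norm_num⟩ | exact ⟨1, by norm_num⟩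

theorem epp_int {n : ℕ} [NeZero n] {u : ZMod n → E3} {ζ : E3} (H : Hyp u ζ) (i : ZMod n) :
    ∃ m : ℤ, epp u ζ i = m := by
  unfold epp
  rcases H.ep_ne i with h | h <;> rw [h] <;> norm_num
  · exact ⟨1, by norm_num⟩
  · exact ⟨0, by norm_num⟩

theorem beta_int {n : ℕ} [NeZero n] {u : ZMod n → E3} {ζ : E3} (H : Hyp u ζ) : ∃ b : ℤ, beta u ζ = b := by
  obtain ⟨a, W, hW, -⟩ := ff_int H
  choose M hM using Mp_int H
  choose e he using epp_int H
  refine ⟨W + ∑ i, (M i - e i), ?_⟩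
  have e5 := sum_sub1 (fun i => epp u ζ i)
  have : ∀ i, tau u ζ i = 2 * M i - epp u ζ (i-1) - epp u ζ i := fun i => by rw [← hM]; ring
  rw [beta, hW]
  simp only [this, Finset.sum_sub_distrib, e5]
  push_cast
  simp only [Finset.sum_sub_distrib, ← Finset.mul_sum, he]
  ring

theorem hh_int {n : ℕ} [NeZero n] {u : ZMod n → E3} {ζ : E3} (H : Hyp u ζ) : ∃ b : ℤ, hh u ζ ζ = b := by
  choose M hM using Mp_int H
  choose e he using epp_int H
  have ha : ∀ i, ∃ a : ℤ, aa (u i) ζ = a := fun i => by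
    rcases aa_cases (u i) ζ with h | h <;> rw [h]
    exacts [⟨0, by norm_num⟩, ⟨1, by norm_num⟩]
  choose a ha using ha
  refine ⟨∑ i, (M i * a i - e i * a i * a (i+1)), ?_⟩
  have h1 := hh_eq u ζ ζ
  have h2 : aa ζ ζ = 0 := by
    unfold aa; rw [if_neg]; exact not_le.2 (real_inner_self_pos.2 H.zne)
  rw [h2, zero_mul, zero_add, ← Finset.sum_add_distrib] at h1
  have h3 := sum_sub1 (fun i => epp u ζ i * aa (u (i+1)) ζ)
  have h4 : ∀ i, epp u ζ i * dd u i ζ + tau u ζ i * aa (u i) ζ = 2 * (M i * a i - e i * a i * a (i+1) : ℚ)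
     + epp u ζ i * aa (u (i+1)) ζ - epp u ζ (i-1) * aa (u (i-1+1)) ζ := by
    intro i
    rw [sub_add_cancel, dd]
    linear_combination aa (u i) ζ * hM i - 2 * a i * a (i+1) * he i + (2 * M i - 2 * epp u ζ i * a (i+1)) * ha i
      - 2 * epp u ζ i * aa (u i) ζ * ha (i+1)
  simp only [h4, Finset.sum_add_distrib, Finset.sum_sub_distrib, h3, ← Finset.mul_sum] at h1
  push_cast
  rw [Finset.sum_sub_distrib]
  linarith

theorem hh_off_eq {n : ℕ} [NeZero n] {u : ZMod n → E3} {ζ : E3} (H : Hyp u ζ) {ξ : E3} (h0 : ξ ≠ 0)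
    (hg : ξ ∉ PP (KK u)) : hh u ζ ξ = hh' u ζ ξ := by
  obtain ⟨y, ⟨-, h1⟩, h2, h3⟩ := ((hh_freq H ξ).and_eventually (hh_off H h0 hg)).exists
  rw [← h2, ← h3, h1]

theorem min_arc {v s : ℚ} (hs : s = 1 ∨ s = -1) : min (v + (1 + s)/2) (v + (1 - s)/2) = v := by
  rcases hs with rfl | rfl <;> norm_num
theorem min_vert {v s s' : ℚ} (hs : s = 1 ∨ s = -1) (hs' : s' = 1 ∨ s' = -1) :
    min (v + (1 + s)*(1+s')/4) (v + (1 - s)*(1-s')/4) = v := by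
  rcases hs with rfl | rfl <;> rcases hs' with rfl | rfl <;> norm_num

theorem loc_any {n : ℕ} [NeZero n] {u : ZMod n → E3} {ζ : E3} (H : Hyp u ζ) (G : Poly (KK u)) {ξ : E3}
    (hg : ξ ∈ PP (KK u)) : LocG (PP (KK u)) (hh u ζ) (hh' u ζ) (min (hh u ζ ξ) (hh' u ζ ξ)) ξ := by
  rcases G.PP_cases hg with ⟨i, hi⟩ | ⟨i, hi⟩
  · rw [KK_succ] at hi
    obtain ⟨v, h1, h2, h3⟩ := loc_arc H G hi
    rw [h1, h2, min_arc (H.ss_ne i)]; exact h3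
  · obtain ⟨v, h1, h2, h3⟩ := loc_vert H G hi
    rw [h1, h2, min_vert (H.ss_ne _) (H.ss_ne _)]; exact h3

theorem xi_side {n : ℕ} [NeZero n] {u : ZMod n → E3} {ζ : E3} (H : Hyp u ζ) (G : Poly (KK u)) :
    ∃ c : ℤ, (∀ x, x ≠ 0 → (hh u ζ x = c ∨ hh u ζ x = c + 1) ∧ (hh' u ζ x = c ∨ hh' u ζ x = c + 1)) ∧
      (∀ x ∈ PP (KK u), LocG (PP (KK u)) (hh u ζ) (hh' u ζ) c x) ∧
      (∀ i, ∀ x ∈ pc ![mm u (i-1), mm u i], hh u ζ x = c + (1 + ss u i)/2 ∧ hh' u ζ x = c + (1 - ss u i)/2) ∧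
      (∀ i, ∀ x ∈ pc ![mm u i], hh u ζ x = c + (1 + ss u i)*(1 + ss u (i+1))/4 ∧ hh' u ζ x = c + (1 - ss u i)*(1 - ss u (i+1))/4) := by
  obtain ⟨c, h1, h2⟩ := two_val (KK u) (fun x hx => G.ne0 hx) (hh u ζ) (hh' u ζ) (fun x => hh_off_eq H)
    (fun x h0 hx => (hh_off H h0 hx).mono fun y hy => hy.1) (fun x hx => (loc_any H G hx).two)
  obtain ⟨c', hc'⟩ : ∃ c' : ℤ, c = c' := by
    obtain ⟨b, hb⟩ := hh_int H
    rcases (h1 ζ H.zne).1 with h | h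
    · exact ⟨b, by rw [← h, hb]⟩
    · exact ⟨b - 1, by push_cast; rw [← hb, h]; ring⟩
  subst hc'
  refine ⟨c', h1, fun x hx => ?_, fun i x hx => ?_, fun i x hx => ?_⟩
  · rw [← h2 x hx]; exact loc_any H G hx
  · have hg : x ∈ PP (KK u) := ⟨i, by rw [KK_succ]; exact edge_kk hx⟩
    obtain ⟨v, e1, e2, e3⟩ := loc_arc H G hx
    have := h2 x hg
    rw [e1, e2, min_arc (H.ss_ne i)] at this
    rw [← this]; exact ⟨e1, e2⟩
  · have hg : x ∈ PP (KK u) := ⟨i, by rw [KK_succ]; exact ray_kk' hx⟩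
    obtain ⟨v, e1, e2, e3⟩ := loc_vert H G hx
    have := h2 x hg
    rw [e1, e2, min_vert (H.ss_ne _) (H.ss_ne _)] at this
    rw [← this]; exact ⟨e1, e2⟩

end GS

namespace GS
open Filter Topology Module

theorem oneD (Φ : Set ℝ → ℚ) (hadd : ∀ S T, Disjoint S T → Φ (S ∪ T) = Φ S + Φ T)
    (hI : ∀ b, Φ (Set.Ioi b) = -1) (hu : Φ Set.univ = -1) (hs : ∀ b, Φ {b} = 1) (B : Finset ℝ) :
    ∀ U : Set ℝ, IsOpen U → (∀ x y, x < y → (∀ b ∈ B, b ∉ Set.Icc x y) → (x ∈ U ↔ y ∈ U)) →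
    ∀ M, (∀ b ∈ B, b < M) → ∃ X : Finset ℝ, (∀ x ∈ X, x ∈ U ∧ x < M) ∧ (X.card : ℚ) = - Φ U ∧
      ∀ x ∈ U, ∃ x' ∈ X, Set.uIcc x x' ⊆ U := by
  have h0 : Φ ∅ = 0 := by
    have := hadd ∅ ∅ (by simp)
    simp at this; exact this
  have hIc : ∀ b, Φ (Set.Ici b) = 0 := by
    intro b
    have h := hadd {b} (Set.Ioi b) (by simp)
    rw [hs, hI] at h
    have e : {b} ∪ Set.Ioi b = Set.Ici b := by
      rw [Set.union_comm, Set.Ioi_union_left]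
    rw [e] at h; rw [h]; norm_num
  induction B using Finset.induction_on_max with
  | empty =>
    intro U hU hc M _
    have hc' : ∀ x y, x ∈ U → y ∈ U := by
      intro x y hx
      rcases lt_trichotomy x y with h | h | h
      · exact (hc x y h (by simp)).1 hx
      · exact h ▸ hx
      · exact (hc y x h (by simp)).2 hx
    rcases Set.eq_empty_or_nonempty U with rfl | ⟨x, hx⟩
    · exact ⟨∅, by simp, by simp [h0], by simp⟩
    · have e : U = Set.univ := Set.eq_univ_of_forall fun y => hc' x y hx
      subst e
      exact ⟨{M - 1}, by simp, by simp [hu], fun x _ => ⟨M - 1, by simp, by simp⟩⟩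
  | insert b B hB ih =>
    intro U hU hc M hM
    have hbM : b < M := hM b (by simp)
    obtain ⟨e, heb, he⟩ : ∃ e, e < b ∧ ∀ c ∈ B, c < e := by
      have h1 : ∀ᶠ e in 𝓝[<] b, ∀ c ∈ B, c < e := by
        rw [Filter.eventually_all_finset]
        intro c hcB
        exact (eventually_gt_nhds (hB c hcB)).filter_mono nhdsWithin_le_nhds
      obtain ⟨e, h1, h2⟩ := (h1.and self_mem_nhdsWithin).exists
      exact ⟨e, h2, h1⟩
    set U' : Set ℝ := (fun t => min t e) ⁻¹' U with hU'
    have hmid : ∀ t, e ≤ t → t < b → (e ∈ U ↔ t ∈ U) := by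
      intro t h1 h2
      rcases h1.eq_or_lt with h | h
      · rw [h]
      · apply hc e t h
        intro c hcB hcI
        rcases Finset.mem_insert.1 hcB with rfl | h3
        · exact absurd hcI.2 (not_le.2 h2)
        · exact absurd hcI.1 (not_le.2 (he c h3))
    have hr : ∀ t t', b < t → b < t' → t ∈ U → t' ∈ U := by
      have key : ∀ x y, b < x → x < y → (x ∈ U ↔ y ∈ U) := by
        intro x y hx hxy
        apply hc x y hxy
        intro c hcB hcI
        rcases Finset.mem_insert.1 hcB with rfl | h3
        · exact absurd hcI.1 (not_le.2 hx)
        · exact absurd hcI.1 (not_le.2 ((hB c h3).trans hx))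
      intro t t' ht ht' h
      rcases lt_trichotomy t t' with h1 | h1 | h1
      · exact (key t t' ht h1).1 h
      · exact h1 ▸ h
      · exact (key t' t ht' h1).2 h
    have hlt : ∀ t, t < b → (t ∈ U' ↔ t ∈ U) := by
      intro t ht
      simp only [hU', Set.mem_preimage]
      rcases le_total t e with h | h
      · rw [min_eq_left h]
      · rw [min_eq_right h]; exact hmid t h ht
    have hge : ∀ t, e ≤ t → (t ∈ U' ↔ e ∈ U) := by
      intro t ht
      simp only [hU', Set.mem_preimage, min_eq_right ht]
    obtain ⟨X', hX1, hX2, hX3⟩ := ih U' (hU.preimage (by fun_prop)) (by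
      intro x y hxy hxB
      simp only [hU', Set.mem_preimage]
      rcases (min_le_min_right e hxy.le).eq_or_lt with h | h
      · rw [h]
      · apply hc _ _ h
        intro c hcB hcI
        rcases Finset.mem_insert.1 hcB with rfl | h3
        · exact absurd (hcI.2.trans (min_le_right _ _)) (not_le.2 heb)
        · refine hxB c h3 ⟨?_, hcI.2.trans (min_le_left _ _)⟩
          rcases min_choice x e with h4 | h4
          · rw [h4] at hcI; exact hcI.1
          · rw [h4] at hcI; exact absurd hcI.1 (not_le.2 (he c h3))) e he
    have hX1' : ∀ x ∈ X', x ∈ U ∧ x < e := fun x hx =>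
      ⟨(hlt x ((hX1 x hx).2.trans heb)).1 (hX1 x hx).1, (hX1 x hx).2⟩
    have hjoin : ∀ x ∈ U, x < b → ∃ x' ∈ X', Set.uIcc x x' ⊆ U := by
      intro x hx hxb
      obtain ⟨x', h1, h2⟩ := hX3 x ((hlt x hxb).2 hx)
      refine ⟨x', h1, fun z hz => (hlt z ?_).1 (h2 hz)⟩
      exact lt_of_le_of_lt hz.2 (max_lt hxb ((hX1 x' h1).2.trans heb))
    by_cases hbU : b ∈ U
    · have h1 : ∀ᶠ t in 𝓝 b, t ∈ U := hU.mem_nhds hbU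
      have heU : e ∈ U := by
        obtain ⟨t, h2, h3⟩ := ((h1.filter_mono (nhdsWithin_le_nhds (s := Set.Iio b))).and
          (Ioo_mem_nhdsLT heb)).exists
        exact (hmid t h3.1.le h3.2).2 h2
      have hrU : ∀ t, b < t → t ∈ U := by
        obtain ⟨t, h2, h3⟩ := ((h1.filter_mono (nhdsWithin_le_nhds (s := Set.Ioi b))).and
          (self_mem_nhdsWithin)).exists
        intro t' ht'
        exact hr t t' h3 ht' h2
      have eU : U' = U := by
        ext t
        rcases lt_trichotomy t b with h | h | h
        · exact hlt t h
        · subst h; exact ⟨fun _ => hbU, fun _ => (hge t heb.le).2 heU⟩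
        · exact ⟨fun _ => hrU t h, fun _ => (hge t (heb.trans h).le).2 heU⟩
      rw [eU] at hX2 hX3
      exact ⟨X', fun x hx => ⟨(hX1' x hx).1, (hX1' x hx).2.trans (heb.trans hbM)⟩, hX2, hX3⟩
    · have hΦ' : Φ U' = Φ (U' ∩ Set.Iio b) := by
        by_cases heU : e ∈ U
        · have : U' = (U' ∩ Set.Iio b) ∪ Set.Ici b := by
            ext t
            simp only [Set.mem_union, Set.mem_inter_iff, Set.mem_Iio, Set.mem_Ici]
            constructor
            · intro h; rcases lt_or_ge t b with h1 | h1
              · exact Or.inl ⟨h, h1⟩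
              · exact Or.inr h1
            · rintro (h | h)
              · exact h.1
              · exact (hge t (heb.le.trans h)).2 heU
          conv_lhs => rw [this]
          rw [hadd _ _ (by
            rw [Set.disjoint_left]; intro t h1 h2; exact absurd (Set.mem_Iio.1 h1.2) (not_lt.2 (Set.mem_Ici.1 h2))), hIc, add_zero]
        · congr 1
          ext t
          simp only [Set.mem_inter_iff, Set.mem_Iio]
          refine ⟨fun h => ⟨h, ?_⟩, fun h => h.1⟩
          by_contra h1
          exact heU ((hge t (heb.le.trans (not_lt.1 h1))).1 h)
      have eI : U' ∩ Set.Iio b = U ∩ Set.Iio b := by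
        ext t; simp only [Set.mem_inter_iff, Set.mem_Iio]
        exact ⟨fun h => ⟨(hlt t h.2).1 h.1, h.2⟩, fun h => ⟨(hlt t h.2).2 h.1, h.2⟩⟩
      by_cases hR : b + 1 ∈ U
      · have hrU : ∀ t, b < t → t ∈ U := fun t ht => hr (b+1) t (by simp) ht hR
        have e1 : U = (U ∩ Set.Iio b) ∪ Set.Ioi b := by
          ext t
          simp only [Set.mem_union, Set.mem_inter_iff, Set.mem_Iio, Set.mem_Ioi]
          constructor
          · intro h
            rcases lt_trichotomy t b with h1 | h1 | h1
            · exact Or.inl ⟨h, h1⟩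
            · exact absurd (h1 ▸ h) hbU
            · exact Or.inr h1
          · rintro (h | h)
            · exact h.1
            · exact hrU t h
        have e2 : Φ U = Φ U' - 1 := by
          conv_lhs => rw [e1]
          rw [hadd _ _ (by
            rw [Set.disjoint_left]; intro t h1 h2; exact lt_asymm (Set.mem_Iio.1 h1.2) (Set.mem_Ioi.1 h2)), hI, hΦ', eI]; ring
        have hn : (b + M) / 2 ∉ X' := by
          intro h
          have := (hX1' _ h).2
          linarith
        refine ⟨insert ((b + M) / 2) X', ?_, ?_, ?_⟩
        · intro x hx
          rcases Finset.mem_insert.1 hx with rfl | h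
          · exact ⟨hrU _ (by linarith), by linarith⟩
          · exact ⟨(hX1' x h).1, (hX1' x h).2.trans (heb.trans hbM)⟩
        · rw [Finset.card_insert_of_notMem hn, e2]; push_cast; rw [hX2]; ring
        · intro x hx
          rcases lt_trichotomy x b with h1 | h1 | h1
          · obtain ⟨x', h2, h3⟩ := hjoin x hx h1
            exact ⟨x', Finset.mem_insert_of_mem h2, h3⟩
          · exact absurd (h1 ▸ hx) hbU
          · refine ⟨_, Finset.mem_insert_self _ _, fun z hz => hrU z ?_⟩
            exact lt_of_lt_of_le (lt_min h1 (by linarith)) hz.1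
      · have hxb : ∀ t ∈ U, t < b := by
          intro t ht
          rcases lt_trichotomy t b with h1 | h1 | h1
          · exact h1
          · exact absurd (h1 ▸ ht) hbU
          · exact absurd (hr t (b+1) h1 (by simp) ht) hR
        have e1 : U ∩ Set.Iio b = U := Set.inter_eq_left.2 hxb
        refine ⟨X', fun x hx => ⟨(hX1' x hx).1, (hX1' x hx).2.trans (heb.trans hbM)⟩, ?_,
          fun x hx => hjoin x hx (hxb x hx)⟩
        rw [hX2, hΦ', eI, e1]
end GS

namespace GS
open Filter Topology Module

structure Fr (a q b : E3) : Prop where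
  aq : ⟪a, q⟫ = 0
  ab : ⟪a, b⟫ = 0
  qq : ⟪q, q⟫ = 1
  bb : ⟪b, b⟫ = 1
  qb : ⟪q, b⟫ = 0
  ex : ∀ x, ⟪a, x⟫ = 0 → x = ⟪q, x⟫ • q + ⟪b, x⟫ • b

theorem Fr.bq {a q b : E3} (F : Fr a q b) : ⟪b, q⟫ = 0 := by rw [real_inner_comm]; exact F.qb

theorem Fr.neg {a q b : E3} (F : Fr a q b) : Fr a q (-b) where
  aq := F.aq
  ab := by rw [inner_neg_right, F.ab, neg_zero]
  qq := F.qq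
  bb := by rw [inner_neg_right, inner_neg_left, F.bb, neg_neg]
  qb := by rw [inner_neg_right, F.qb, neg_zero]
  ex x hx := by
    have := F.ex x hx
    rw [inner_neg_left, smul_neg, neg_smul, neg_neg]; exact this

theorem Fr_ex {a q : E3} (ha : a ≠ 0) (hq : ⟪q, q⟫ = 1) (haq : ⟪a, q⟫ = 0) : ∃ b, Fr a q b := by
  set c := cross3 a q with hc
  have h1 : ⟪a, c⟫ = 0 := inner_cross_self a q
  have h2 : ⟪q, c⟫ = 0 := inner_cross_self' a q
  have haa := real_inner_self_pos.2 ha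
  have h3 : ⟪c, c⟫ = ⟪a, a⟫ := by
    have : ⟪c, c⟫ = ⟪a, a⟫ * ⟪q, q⟫ - ⟪a, q⟫ * ⟪a, q⟫ := by
      obtain ⟨e0, e1, e2⟩ := cross3_apply a q
      rw [hc, inner3, inner3, inner3, inner3, e0, e1, e2]; ring
    rw [this, hq, haq]; ring
  have hc0 : c ≠ 0 := by
    intro h; rw [h, inner_zero_left] at h3; exact haa.ne h3
  have hn : ‖c‖ ≠ 0 := norm_ne_zero_iff.2 hc0
  have hn2 : ⟪c, c⟫ = ‖c‖ * ‖c‖ := real_inner_self_eq_norm_mul_norm c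
  refine ⟨‖c‖⁻¹ • c, haq, ?_, hq, ?_, ?_, ?_⟩
  · rw [inner_smul_right, h1, mul_zero]
  · rw [inner_smul_right, inner_smul_left, hn2]; simp; field_simp
  · rw [inner_smul_right, h2, mul_zero]
  · intro x hx
    have hd : det3 a q c = ⟪a, a⟫ := by
      rw [← h3]; rw [hc]
      obtain ⟨e0, e1, e2⟩ := cross3_apply a q
      rw [det3_eq, inner3, e0, e1, e2]; ring
    have key := cramer_dual a q c x
    rw [real_inner_comm, hx, hd, zero_smul, zero_add] at key
    have e1 : cross3 c a = ⟪a, a⟫ • q := by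
      obtain ⟨f0, f1, f2⟩ := cross3_apply a q
      rw [inner3] at haq
      rw [inner3]
      apply ext3 <;> simp [cross3_apply, hc]
      · linear_combination (- a 0) * haq
      · linear_combination (- a 1) * haq
      · linear_combination (- a 2) * haq
    have e2 : cross3 a q = c := rfl
    rw [e1, e2] at key
    have h4 : ⟪a, a⟫ • x = ⟪a, a⟫ • (⟪q, x⟫ • q + ⟪‖c‖⁻¹ • c, x⟫ • ‖c‖⁻¹ • c) := by
      have : (⟪a, a⟫ : ℝ) = ‖c‖ * ‖c‖ := by rw [← h3, hn2]
      rw [key, inner_smul_left, real_inner_comm x q, real_inner_comm x c, this]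
      simp only [conj_trivial]
      match_scalars <;> field_simp
    exact smul_right_injective _ haa.ne' h4

def ga (q b : E3) (t : ℝ) : E3 := (t ^ 2 - 1) • q + (2 * t) • b
def th (q b x : E3) : ℝ := ⟪b, x⟫ / (√(⟪q, x⟫ ^ 2 + ⟪b, x⟫ ^ 2) - ⟪q, x⟫)
def PM (a q b : E3) : Set E3 := {x | ⟪a, x⟫ = 0 ∧ ¬ (⟪b, x⟫ = 0 ∧ 0 ≤ ⟪q, x⟫)}

section
variable {a q b : E3} (F : Fr a q b)
include F

theorem ga_a (t : ℝ) : ⟪a, ga q b t⟫ = 0 := by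
  simp [ga, inner_add_right, inner_smul_right, F.aq, F.ab]
theorem ga_q (t : ℝ) : ⟪q, ga q b t⟫ = t ^ 2 - 1 := by
  simp only [ga, inner_add_right, inner_smul_right, F.qq, F.qb, mul_one, mul_zero, add_zero, zero_add]
theorem ga_b (t : ℝ) : ⟪b, ga q b t⟫ = 2 * t := by
  simp only [ga, inner_add_right, inner_smul_right, F.bb, F.bq, mul_one, mul_zero, add_zero, zero_add]

theorem th_ga {s t : ℝ} (hs : 0 < s) : th q b (s • ga q b t) = t := by
  rw [th, inner_smul_right, inner_smul_right, ga_q F, ga_b F]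
  have : (s * (t ^ 2 - 1)) ^ 2 + (s * (2 * t)) ^ 2 = (s * (t ^ 2 + 1)) ^ 2 := by ring
  rw [this, Real.sqrt_sq (by positivity)]
  have : s * (t ^ 2 + 1) - s * (t ^ 2 - 1) = 2 * s := by ring
  rw [this]; field_simp

theorem ga_mem {s : ℝ} (t : ℝ) (hs : 0 < s) : s • ga q b t ∈ PM a q b := by
  refine ⟨by rw [inner_smul_right, ga_a F, mul_zero], ?_⟩
  rw [inner_smul_right, inner_smul_right, ga_q F, ga_b F]
  rintro ⟨h1, h2⟩
  have : t = 0 := by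
    rcases mul_eq_zero.1 h1 with h | h
    · exact absurd h hs.ne'
    · linarith
  subst this
  nlinarith

theorem PM_ex {x : E3} (hx : x ∈ PM a q b) : ∃ s : ℝ, 0 < s ∧ x = s • ga q b (th q b x) := by
  obtain ⟨h1, h2⟩ := hx
  set X := ⟪q, x⟫ with hX
  set Y := ⟪b, x⟫ with hY
  set r := √(X ^ 2 + Y ^ 2) with hr
  have hr2 : r ^ 2 = X ^ 2 + Y ^ 2 := Real.sq_sqrt (by positivity)
  have hr0 : 0 ≤ r := Real.sqrt_nonneg _
  have hlt : 0 < r - X := by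
    by_contra h
    push Not at h
    have hY0 : Y = 0 := by
      have : Y ^ 2 ≤ 0 := by nlinarith
      nlinarith [sq_nonneg Y]
    exact h2 ⟨hY0, by linarith⟩
  refine ⟨(r - X) / 2, by linarith, ?_⟩
  have e : x = X • q + Y • b := F.ex x h1
  have et : th q b x = Y / (r - X) := rfl
  rw [et, ga, smul_add, smul_smul, smul_smul]
  conv_lhs => rw [e]
  congr 2
  · rw [div_pow, ]; field_simp; linear_combination hr2
  · field_simp

def Ph (a q b : E3) (S : Set ℝ) : Set E3 := {x | x ∈ PM a q b ∧ th q b x ∈ S}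

omit F in
theorem ind_Ph_add {S T : Set ℝ} (h : Disjoint S T) :
    EE (ind (Ph a q b (S ∪ T))) = EE (ind (Ph a q b S)) + EE (ind (Ph a q b T)) := by
  rw [← map_add]; congr 1
  funext x
  simp only [Pi.add_apply]
  by_cases h1 : x ∈ PM a q b
  · by_cases hS : th q b x ∈ S
    · have hT := Set.disjoint_left.1 h hS
      rw [ind_mem (show x ∈ Ph a q b (S ∪ T) from ⟨h1, Or.inl hS⟩), ind_mem (show x ∈ Ph a q b S from ⟨h1, hS⟩),
        ind_not (fun h => hT h.2)]; ring
    · by_cases hT : th q b x ∈ T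
      · rw [ind_mem (show x ∈ Ph a q b (S ∪ T) from ⟨h1, Or.inr hT⟩), ind_mem (show x ∈ Ph a q b T from ⟨h1, hT⟩),
          ind_not (fun h => hS h.2)]; ring
      · rw [ind_not (fun h => h.2.elim hS hT), ind_not (s := Ph a q b T) (fun h => hT h.2),
          ind_not (s := Ph a q b S) (fun h => hS h.2)]; ring
  · rw [ind_not (fun h => h1 h.1), ind_not (fun h => h1 h.1), ind_not (fun h => h1 h.1)]; ring

theorem mem_Ph {S : Set ℝ} {x : E3} : x ∈ Ph a q b S ↔ ∃ s t : ℝ, 0 < s ∧ t ∈ S ∧ x = s • ga q b t := by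
  constructor
  · rintro ⟨h1, h2⟩
    obtain ⟨s, hs, e⟩ := PM_ex F h1
    exact ⟨s, _, hs, h2, e⟩
  · rintro ⟨s, t, hs, ht, rfl⟩
    exact ⟨ga_mem F t hs, by rwa [th_ga F hs]⟩

theorem Fr.li : LinearIndependent ℝ ![q, b] := by
  rw [LinearIndependent.pair_iff]
  intro s t h
  constructor
  · have := congrArg (fun z => ⟪q, z⟫) h
    simpa only [inner_add_right, inner_smul_right, F.qq, F.qb, mul_one, mul_zero, add_zero, zero_add, inner_zero_right] using this
  · have := congrArg (fun z => ⟪b, z⟫) h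
    simpa only [inner_add_right, inner_smul_right, F.bb, F.bq, mul_one, mul_zero, add_zero, zero_add, inner_zero_right] using this

theorem Ph_one (t : ℝ) : EE (ind (Ph a q b {t})) = 1 := by
  have e : Ph a q b {t} = pc ![ga q b t] := by
    ext x
    rw [mem_Ph F, mem_pc1]
    constructor
    · rintro ⟨s, t', hs, ht, rfl⟩; rw [Set.mem_singleton_iff.1 ht]; exact ⟨s, hs, rfl⟩
    · rintro ⟨s, hs, rfl⟩; exact ⟨s, t, hs, rfl, rfl⟩
  rw [e, EE_pc (by norm_num)]
  · norm_num
  · rw [linearIndependent_unique_iff]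
    simp
    intro h
    have h1 := ga_b F t
    have h2 := ga_q F t
    rw [h, inner_zero_right] at h1 h2
    have : t = 0 := by linarith
    subst this; norm_num at h2

theorem comb_q (x y : ℝ) : ⟪q, x • q + y • b⟫ = x := by
  simp only [inner_add_right, inner_smul_right, F.qq, F.qb, mul_one, mul_zero, add_zero, zero_add]
theorem comb_b (x y : ℝ) : ⟪b, x • q + y • b⟫ = y := by
  simp only [inner_add_right, inner_smul_right, F.bb, F.bq, mul_one, mul_zero, add_zero, zero_add]

theorem Ph_Ioi_pos {t : ℝ} (ht : 0 < t) : EE (ind (Ph a q b (Set.Ioi t))) = -1 := by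
  have e : Ph a q b (Set.Ioi t) = pc ![ga q b t, q] := by
    ext x
    rw [mem_pc2]
    constructor
    · rw [mem_Ph F]
      rintro ⟨s, t', hs, ht', rfl⟩
      have ht'' : t < t' := ht'
      refine ⟨t' * s / t, s * (t' - t) * (t' + 1 / t), by have := ht.trans ht''; positivity, ?_, ?_⟩
      · have := ht.trans ht''
        have : 0 < t' - t := by linarith
        positivity
      · rw [ga, ga]
        match_scalars <;> field_simp <;> ring
    · rintro ⟨x', y', hx, hy, rfl⟩
      have h1 : x' • ga q b t + y' • q = (x' * (t^2 - 1) + y') • q + (2 * x' * t) • b := by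
        rw [ga]; module
      have hm : x' • ga q b t + y' • q ∈ PM a q b := by
        refine ⟨by rw [inner_add_right, inner_smul_right, inner_smul_right, ga_a F, F.aq]; simp, ?_⟩
        rintro ⟨h2, -⟩
        rw [h1, comb_b F] at h2
        have : 0 < 2 * x' * t := by positivity
        linarith
      refine ⟨hm, ?_⟩
      obtain ⟨s, hs, e⟩ := PM_ex F hm
      set t' := th q b (x' • ga q b t + y' • q)
      have e1 := congrArg (fun z => ⟪q, z⟫) e
      have e2 := congrArg (fun z => ⟪b, z⟫) e
      simp only [h1, comb_q F, comb_b F, inner_smul_right, ga_q F, ga_b F] at e1 e2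
      have ht' : 0 < t' := by
        have : 0 < 2 * x' * t := by positivity
        rw [e2] at this
        have := pos_of_mul_pos_right this hs.le
        linarith
      have key : s * (t' - t) * (t * t' + 1) = y' * t := by
        linear_combination (-t) * e1 + (t ^ 2 - 1) / 2 * e2
      have h5 : 0 < s * (t * t' + 1) := by positivity
      have h6 : 0 < (t' - t) * (s * (t * t' + 1)) := by
        have : 0 < y' * t := by positivity
        rw [← key] at this; linarith
      have h7 := pos_of_mul_pos_left h6 h5.le
      change t < t'
      linarith
  rw [e, EE_pc (by norm_num)]
  · norm_num
  · rw [LinearIndependent.pair_iff]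
    intro s r h
    have h1 := congrArg (fun z => ⟪q, z⟫) h
    have h2 := congrArg (fun z => ⟪b, z⟫) h
    simp only [inner_add_right, inner_smul_right, ga_q F, ga_b F, F.qq, F.bq, inner_zero_right] at h1 h2
    have hs : s = 0 := by
      have : s * t = 0 := by linarith
      exact (mul_eq_zero.1 this).resolve_right ht.ne'
    subst hs
    exact ⟨rfl, by linarith⟩

theorem Ph_Ioo01 : EE (ind (Ph a q b (Set.Ioo 0 1))) = -1 := by
  have e : Ph a q b (Set.Ioo 0 1) = pc ![-q, b] := by
    ext x
    rw [mem_pc2]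
    constructor
    · rw [mem_Ph F]
      rintro ⟨s, t, hs, ht, rfl⟩
      refine ⟨s * (1 - t ^ 2), s * (2 * t), ?_, by have := ht.1; positivity, ?_⟩
      · have : 0 < 1 - t ^ 2 := by nlinarith [ht.1, ht.2]
        positivity
      · rw [ga]; module
    · rintro ⟨x', y', hx, hy, rfl⟩
      have h1 : x' • -q + y' • b = (-x') • q + y' • b := by module
      rw [h1]
      have hm : (-x') • q + y' • b ∈ PM a q b := by
        refine ⟨by simp [inner_add_right, inner_smul_right, F.aq, F.ab], ?_⟩
        rintro ⟨h2, -⟩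
        rw [comb_b F] at h2; linarith
      refine ⟨hm, ?_⟩
      obtain ⟨s, hs, e⟩ := PM_ex F hm
      set t' := th q b ((-x') • q + y' • b)
      have e1 := congrArg (fun z => ⟪q, z⟫) e
      have e2 := congrArg (fun z => ⟪b, z⟫) e
      simp only [comb_q F, comb_b F, inner_smul_right, ga_q F, ga_b F] at e1 e2
      have ht' : 0 < t' := by
        rw [e2] at hy
        have := pos_of_mul_pos_right hy hs.le
        linarith
      refine ⟨ht', ?_⟩
      have h3 : 0 < s * (1 - t' ^ 2) := by linarith
      have := pos_of_mul_pos_right h3 hs.le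
      nlinarith
  rw [e, EE_pc (by norm_num)]
  · norm_num
  · have := F.li
    rw [LinearIndependent.pair_iff] at this ⊢
    intro s t h
    have := this (-s) t (by rw [← h]; module)
    exact ⟨by linarith [this.1], this.2⟩

theorem Ph_Ioi_zero : EE (ind (Ph a q b (Set.Ioi 0))) = -1 := by
  have e : Set.Ioi (0:ℝ) = (Set.Ioo 0 1 ∪ {1}) ∪ Set.Ioi 1 := by
    rw [Set.Ioo_union_right zero_lt_one, Set.Ioc_union_Ioi_eq_Ioi zero_le_one]
  rw [e, ind_Ph_add, ind_Ph_add, Ph_Ioo01 F, Ph_one F, Ph_Ioi_pos F one_pos]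
  · ring
  · simp
  · rw [Set.disjoint_left]
    rintro x (h | h) h2
    · exact lt_asymm h.2 h2
    · rw [Set.mem_singleton_iff.1 h] at h2; exact lt_irrefl _ (Set.mem_Ioi.1 h2)

theorem Ph_neg (S : Set ℝ) : Ph a q (-b) S = Ph a q b (Neg.neg ⁻¹' S) := by
  ext x
  rw [mem_Ph F, mem_Ph F.neg]
  constructor
  · rintro ⟨s, t, hs, ht, rfl⟩
    exact ⟨s, -t, hs, by simpa using ht, by rw [ga, ga]; module⟩
  · rintro ⟨s, t, hs, ht, rfl⟩
    exact ⟨s, -t, hs, by simpa using ht, by rw [ga, ga]; module⟩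

theorem Ph_Ioi_nn {t : ℝ} (ht : 0 ≤ t) : EE (ind (Ph a q b (Set.Ioi t))) = -1 := by
  rcases ht.eq_or_lt with rfl | h
  · exact Ph_Ioi_zero F
  · exact Ph_Ioi_pos F h

theorem Ph_Iio {t : ℝ} (ht : t ≤ 0) : EE (ind (Ph a q b (Set.Iio t))) = -1 := by
  have h := Ph_Ioi_nn F.neg (t := -t) (by linarith)
  rw [Ph_neg F] at h
  have : (Neg.neg ⁻¹' Set.Ioi (-t) : Set ℝ) = Set.Iio t := by ext; simp
  rwa [this] at h

theorem Ph_univ : EE (ind (Ph a q b Set.univ)) = -1 := by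
  have e : (Set.univ : Set ℝ) = (Set.Iio 0 ∪ {0}) ∪ Set.Ioi 0 := by
    ext x; rcases lt_trichotomy x 0 with h | h | h <;> simp [h]
  rw [e, ind_Ph_add, ind_Ph_add, Ph_Iio F le_rfl, Ph_one F, Ph_Ioi_zero F]
  · ring
  · simp
  · rw [Set.disjoint_left]
    rintro x (h | h) h2
    · exact lt_asymm (Set.mem_Iio.1 h) (Set.mem_Ioi.1 h2)
    · rw [Set.mem_singleton_iff.1 h] at h2; exact lt_irrefl _ (Set.mem_Ioi.1 h2)

theorem Ph_Ioi (t : ℝ) : EE (ind (Ph a q b (Set.Ioi t))) = -1 := by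
  rcases le_total 0 t with ht | ht
  · exact Ph_Ioi_nn F ht
  · have h := Ph_univ F
    have e : (Set.univ : Set ℝ) = (Set.Iio t ∪ {t}) ∪ Set.Ioi t := by
      ext x; rcases lt_trichotomy x t with h | h | h <;> simp [h]
    rw [e, ind_Ph_add, ind_Ph_add, Ph_Iio F ht, Ph_one F] at h
    · linarith
    · simp
    · rw [Set.disjoint_left]
      rintro x (h | h) h2
      · exact lt_asymm (Set.mem_Iio.1 h) (Set.mem_Ioi.1 h2)
      · rw [Set.mem_singleton_iff.1 h] at h2; exact lt_irrefl _ (Set.mem_Ioi.1 h2)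
end
end GS

namespace GS
open Filter Topology Module

theorem sg_const {f : ℝ → ℝ} (hf : Continuous f) {x y : ℝ} (hxy : x ≤ y) (h : ∀ z ∈ Set.Icc x y, f z ≠ 0) :
    sg (f x) = sg (f y) := by
  have hx := h x ⟨le_rfl, hxy⟩
  have hy := h y ⟨hxy, le_rfl⟩
  rcases lt_or_gt_of_ne hx with h1 | h1 <;> rcases lt_or_gt_of_ne hy with h2 | h2
  · rw [sg_neg h1, sg_neg h2]
  · obtain ⟨z, hz, e⟩ := intermediate_value_Icc hxy hf.continuousOn ⟨h1.le, h2.le⟩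
    exact absurd e (h z hz)
  · obtain ⟨z, hz, e⟩ := intermediate_value_Icc' hxy hf.continuousOn ⟨h2.le, h1.le⟩
    exact absurd e (h z hz)
  · rw [sg_pos h1, sg_pos h2]

theorem quad_fin {A C : ℝ} (h : A ≠ 0 ∨ C ≠ 0) : {t : ℝ | (t ^ 2 - 1) * A + 2 * t * C = 0}.Finite := by
  set p : Polynomial ℝ := (Polynomial.X ^ 2 - 1) * Polynomial.C A + 2 * Polynomial.X * Polynomial.C C with hp
  have hpe : ∀ t, p.eval t = (t ^ 2 - 1) * A + 2 * t * C := by intro t; simp [hp]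
  have hp0 : p ≠ 0 := by
    intro h0
    have e0 := hpe 0
    have e1 := hpe 1
    rw [h0] at e0 e1
    simp at e0 e1
    rcases h with h | h
    · exact h e0
    · exact h e1
  refine (p.roots.toFinset.finite_toSet).subset ?_
  intro t ht
  simp only [Finset.mem_coe, Multiset.mem_toFinset, Polynomial.mem_roots hp0, Polynomial.IsRoot]
  rw [hpe]; exact ht

theorem plane {ι : Type} [Finite ι] (w : ι → E3) {a q : E3} (ha : a ≠ 0) (hq : q ≠ 0) (haq : ⟪a, q⟫ = 0)
    {O Ω : Set E3} (hΩ : IsOpen Ω) (hO : ∀ x, x ∈ O ↔ ⟪a, x⟫ = 0 ∧ x ∈ Ω) (h0 : (0:E3) ∉ O)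
    (hcone : ∀ x ∈ O, ∀ s : ℝ, 0 < s → s • x ∈ O)
    (hcell : ∀ x y, y ≠ 0 → ⟪a, x⟫ = 0 → ⟪a, y⟫ = 0 → (∀ k, sg ⟪w k, x⟫ = sg ⟪w k, y⟫) → x ∈ O → y ∈ O)
    (hqO : q ∉ O) :
    ∃ X : Finset E3, (∀ x ∈ X, x ∈ O) ∧ (X.card : ℚ) ≤ - EE (ind O) ∧
      ∀ x ∈ O, ∃ x' ∈ X, ∃ S ⊆ O, IsPreconnected S ∧ x ∈ S ∧ x' ∈ S := by
  classical
  have hnq : ‖q‖ ≠ 0 := norm_ne_zero_iff.2 hq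
  have hnq' : 0 < ‖q‖ := norm_pos_iff.2 hq
  set q' := ‖q‖⁻¹ • q with hq'
  have eq' : q = ‖q‖ • q' := by rw [hq', smul_smul, mul_inv_cancel₀ hnq, one_smul]
  obtain ⟨b, F⟩ : ∃ b, Fr a q' b := by
    apply Fr_ex ha
    · rw [hq', inner_smul_left, inner_smul_right, real_inner_self_eq_norm_mul_norm]
      simp only [conj_trivial]; field_simp
    · rw [hq', inner_smul_right, haq, mul_zero]
  have hcont : Continuous (ga q' b) := by unfold ga; fun_prop
  set U : Set ℝ := ga q' b ⁻¹' O with hU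
  have hUo : IsOpen U := by
    have : U = ga q' b ⁻¹' Ω := by
      ext t; simp only [hU, Set.mem_preimage, hO, ga_a F, true_and]
    rw [this]; exact hΩ.preimage hcont
  have hPM : ∀ x ∈ O, x ∈ PM a q' b := by
    intro x hx
    have hax := ((hO x).1 hx).1
    refine ⟨hax, ?_⟩
    rintro ⟨h1, h2⟩
    have e := F.ex x hax
    rw [h1, zero_smul, add_zero] at e
    rcases h2.eq_or_lt with h3 | h3
    · rw [← h3, zero_smul] at e; exact h0 (e ▸ hx)
    · have := hcone x hx (‖q‖ / ⟪q', x⟫) (by positivity)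
      rw [e, smul_smul, inner_smul_right, F.qq, mul_one, div_mul_cancel₀ _ h3.ne', ← eq'] at this
      exact hqO this
  have hOU : O = Ph a q' b U := by
    ext x
    constructor
    · intro hx
      obtain ⟨s, hs, e⟩ := PM_ex F (hPM x hx)
      refine ⟨hPM x hx, ?_⟩
      change ga q' b _ ∈ O
      have := hcone x hx s⁻¹ (by positivity)
      rwa [e, smul_smul, inv_mul_cancel₀ hs.ne', one_smul] at this
    · rw [mem_Ph F]
      rintro ⟨s, t, hs, ht, rfl⟩
      exact hcone _ ht s hs
  have hwk : ∀ k t, ⟪w k, ga q' b t⟫ = (t ^ 2 - 1) * ⟪w k, q'⟫ + 2 * t * ⟪w k, b⟫ := by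
    intro k t; simp only [ga, inner_add_right, inner_smul_right]
  have hfin : (⋃ k : {k // ⟪w k, q'⟫ ≠ 0 ∨ ⟪w k, b⟫ ≠ 0}, {t : ℝ | ⟪w k.1, ga q' b t⟫ = 0}).Finite := by
    apply Set.finite_iUnion
    intro k
    simp only [hwk]
    exact quad_fin k.2
  set B := hfin.toFinset with hB
  have hne : ∀ t, ga q' b t ≠ 0 := by
    intro t h
    have h1 := ga_b F t
    have h2 := ga_q F t
    rw [h, inner_zero_right] at h1 h2
    have : t = 0 := by linarith
    subst this; norm_num at h2
  obtain ⟨M, hM⟩ : ∃ M, ∀ c ∈ B, c < M := by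
    obtain ⟨M, hM⟩ := B.bddAbove
    exact ⟨M + 1, fun c hc => by have := hM hc; linarith⟩
  obtain ⟨X, hX1, hX2, hX3⟩ := oneD (fun S => EE (ind (Ph a q' b S))) (fun S T h => ind_Ph_add h)
    (Ph_Ioi F) (Ph_univ F) (Ph_one F) B U hUo (by
      intro x y hxy hxB
      have hs : ∀ k, sg ⟪w k, ga q' b x⟫ = sg ⟪w k, ga q' b y⟫ := by
        intro k
        by_cases hk : ⟪w k, q'⟫ ≠ 0 ∨ ⟪w k, b⟫ ≠ 0
        · apply sg_const (f := fun t => ⟪w k, ga q' b t⟫) (by fun_prop) hxy.le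
          intro z hz hz0
          refine hxB z ?_ hz
          rw [hB, Set.Finite.mem_toFinset, Set.mem_iUnion]
          exact ⟨⟨k, hk⟩, hz0⟩
        · push Not at hk
          rw [hwk, hwk, hk.1, hk.2]; simp
      exact ⟨hcell _ _ (hne y) (ga_a F x) (ga_a F y) hs,
        hcell _ _ (hne x) (ga_a F y) (ga_a F x) (fun k => (hs k).symm)⟩) M hM
  refine ⟨X.image (ga q' b), ?_, ?_, ?_⟩
  · intro x hx
    obtain ⟨t, ht, rfl⟩ := Finset.mem_image.1 hx
    exact (hX1 t ht).1
  · rw [hOU]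
    change _ = - EE (ind (Ph a q' b U)) at hX2
    rw [← hX2]
    exact_mod_cast Finset.card_image_le
  · intro x hx
    rw [hOU] at hx
    obtain ⟨s, t, hs, ht, rfl⟩ := (mem_Ph F).1 hx
    obtain ⟨t', h1, h2⟩ := hX3 t ht
    refine ⟨ga q' b t', Finset.mem_image_of_mem _ h1,
      (fun z : ℝ × ℝ => z.1 • ga q' b z.2) '' (Set.Ioi 0 ×ˢ Set.uIcc t t'), ?_, ?_, ?_, ?_⟩
    · rintro _ ⟨⟨r, z⟩, ⟨hr, hz⟩, rfl⟩
      exact hcone _ (h2 hz) r hr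
    · apply (isPreconnected_Ioi.prod isPreconnected_uIcc).image
      fun_prop
    · exact ⟨(s, t), ⟨hs, Set.left_mem_uIcc⟩, rfl⟩
    · exact ⟨(1, t'), ⟨by simp, Set.right_mem_uIcc⟩, by simp⟩
end GS

namespace GS
open Filter Topology Module

structure QH {ι : Type} (a : ι → E3) (Q : Set E3) : Prop where
  ha : ∀ k, a k ≠ 0
  op : IsOpen Q
  z : (0:E3) ∉ Q
  cone : ∀ x ∈ Q, ∀ s : ℝ, 0 < s → s • x ∈ Q
  cell : ∀ x y, x ∈ Q → y ≠ 0 → (∀ k, sg ⟪a k, x⟫ = sg ⟪a k, y⟫) → y ∈ Q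

section
variable {ι : Type} (a : ι → E3) (Q : Set E3)

def gen (y : E3) : Prop := ∀ k, ⟪a k, y⟫ ≠ 0
def sv (y : E3) : ι → ℚ := fun k => sg ⟪a k, y⟫
def Sig : Set (ι → ℚ) := {e | ∃ x ∈ Q, gen a x ∧ sv a x = e}

open Classical in
def FE (e : ι → ℚ) : (Sig a Q → ℚ) →ₗ[ℚ] ℚ :=
  if h : e ∈ Sig a Q then LinearMap.proj ⟨e, h⟩ else 0

def Fv (y : E3) : (Sig a Q → ℚ) →ₗ[ℚ] ℚ := FE a Q (sv a y)

def Gd (φ : Sig a Q → ℚ) (x : E3) : Prop := ∃ v, ∀ᶠ y in 𝓝 x, gen a y → Fv a Q y φ = v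

def TA (A : Finset ι) : Set E3 := {x | x ∈ Q ∧ ∀ k, k ∉ A → ⟪a k, x⟫ ≠ 0}

def VA (A : Finset ι) : Submodule ℚ (Sig a Q → ℚ) where
  carrier := {φ | ∀ x ∈ TA a Q A, Gd a Q φ x}
  add_mem' := by
    intro φ ψ h1 h2 x hx
    obtain ⟨v, hv⟩ := h1 x hx
    obtain ⟨w, hw⟩ := h2 x hx
    refine ⟨v + w, ?_⟩
    filter_upwards [hv, hw] with y h3 h4 hy
    rw [map_add, h3 hy, h4 hy]
  zero_mem' := by
    intro x _
    exact ⟨0, Eventually.of_forall fun y _ => by simp⟩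
  smul_mem' := by
    intro c φ h1 x hx
    obtain ⟨v, hv⟩ := h1 x hx
    refine ⟨c * v, ?_⟩
    filter_upwards [hv] with y h3 hy
    rw [map_smul, h3 hy]; rfl

variable {a Q}

theorem Fv_congr {y z : E3} (h : sv a y = sv a z) : Fv a Q y = Fv a Q z := by
  unfold Fv
  rw [h]

variable [Finite ι] (H : QH a Q)
include H

theorem freq_gen {D : Set E3} (hD : IsOpen D) {y : E3} (h : ∃ᶠ z in 𝓝 y, z ∈ D) :
    ∃ᶠ z in 𝓝 y, z ∈ D ∧ gen a z := by
  intro h1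
  obtain ⟨z, hz, h2⟩ := (h.and_eventually (eventually_eventually_nhds.2 h1)).exists
  exact ((gen_dense H.ha z).and_eventually (h2.and (hD.mem_nhds hz))).exists.elim
    fun w hw => hw.2.1 ⟨hw.2.2, hw.1⟩

theorem freq_gen' (y : E3) : ∃ᶠ z in 𝓝 y, gen a z := gen_dense H.ha y

omit [Finite ι] H in
theorem freq_half {c y : E3} (hc : c ≠ 0) (hy : ⟪c, y⟫ = 0) : ∃ᶠ z in 𝓝 y, 0 < ⟪c, z⟫ := by
  have ht : Tendsto (fun δ : ℝ => y + δ • c) (𝓝[>] 0) (𝓝 y) := by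
    have : Continuous (fun δ : ℝ => y + δ • c) := by fun_prop
    have := this.tendsto 0
    simp only [zero_smul, add_zero] at this
    exact this.mono_left nhdsWithin_le_nhds
  apply ht.frequently
  apply Eventually.frequently
  filter_upwards [self_mem_nhdsWithin] with δ hδ
  rw [inner_add_right, inner_smul_right, hy, zero_add]
  exact mul_pos hδ (real_inner_self_pos.2 hc)

theorem Gd_const {φ : Sig a Q → ℚ} {S : Set E3} (hS : IsPreconnected S) (h : ∀ x ∈ S, Gd a Q φ x) :
    ∃ v, ∀ x ∈ S, ∀ᶠ y in 𝓝 x, gen a y → Fv a Q y φ = v := by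
  classical
  choose! v hv using h
  have key := lc_const hS v (by
    intro x hx
    filter_upwards [eventually_eventually_nhds.2 (hv x hx)] with y hy hyS
    obtain ⟨z, h1, h2, h3⟩ := ((freq_gen' H y).and_eventually (hy.and (hv y hyS))).exists
    rw [← h2 h1, ← h3 h1])
  rcases S.eq_empty_or_nonempty with rfl | ⟨x0, hx0⟩
  · exact ⟨0, by simp⟩
  · exact ⟨v x0, fun x hx => key x hx x0 hx0 ▸ hv x hx⟩

theorem local_jump [DecidableEq ι] {A : Finset ι} {j : ι} {x : E3} (hx : x ∈ TA a Q (insert j A)) (hxj : ⟪a j, x⟫ = 0) :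
    ∃ y1 y2 : E3, ∀ φ ∈ VA a Q A, (Gd a Q φ x ↔ Fv a Q y1 φ = Fv a Q y2 φ) ∧
      ∀ᶠ y in 𝓝 x, ⟪a j, y⟫ = 0 → (Gd a Q φ y ↔ Gd a Q φ x) := by
  have h1 : ∀ᶠ y in 𝓝 x, y ∈ Q ∧ ∀ k, ⟪a k, x⟫ ≠ 0 → sg ⟪a k, y⟫ = sg ⟪a k, x⟫ :=
    (show ∀ᶠ y in 𝓝 x, y ∈ Q from H.op.mem_nhds hx.1).and (freeze (F := fun k y => ⟪a k, y⟫) (fun k => by fun_prop) x)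
  obtain ⟨ε, hε, hB⟩ := Metric.eventually_nhds_iff_ball.1 h1
  set S1 := Metric.ball x ε ∩ {y | 0 < ⟪a j, y⟫} with hS1
  set S2 := Metric.ball x ε ∩ {y | 0 < ⟪-a j, y⟫} with hS2
  have hop : ∀ c : E3, IsOpen {y : E3 | 0 < ⟪c, y⟫} := fun c => isOpen_lt continuous_const (by fun_prop)
  have hcv : ∀ c : E3, Convex ℝ {y : E3 | 0 < ⟪c, y⟫} := by
    intro c y hy z hz s t hs ht hst
    simp only [Set.mem_setOf_eq, inner_add_right, inner_smul_right] at *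
    rcases hs.eq_or_lt with h | h
    · have : t = 1 := by linarith
      subst this; rw [← h]; linarith
    · nlinarith [mul_pos h hy, mul_nonneg ht hz.le]
  have hT : ∀ y ∈ Metric.ball x ε, ⟪a j, y⟫ ≠ 0 → y ∈ TA a Q A := by
    intro y hy hyj
    refine ⟨(hB y hy).1, fun k hk => ?_⟩
    by_cases hkj : k = j
    · rw [hkj]; exact hyj
    · have h3 := hx.2 k (by simp [hk, hkj])
      have h4 := (hB y hy).2 k h3
      intro h5
      rw [h5, sg_zero] at h4
      exact h3 (sg_eq_zero.1 h4.symm)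
  have ho1 : IsOpen S1 := Metric.isOpen_ball.inter (hop _)
  have ho2 : IsOpen S2 := Metric.isOpen_ball.inter (hop _)
  have hf1 : ∀ y ∈ Metric.ball x ε, ⟪a j, y⟫ = 0 → ∃ᶠ z in 𝓝 y, z ∈ S1 ∧ gen a z := by
    intro y hy hyj
    apply freq_gen H ho1
    exact ((freq_half (H.ha j) hyj).and_eventually (Metric.isOpen_ball.mem_nhds hy)).mono
      fun z hz => ⟨hz.2, hz.1⟩
  have hf2 : ∀ y ∈ Metric.ball x ε, ⟪a j, y⟫ = 0 → ∃ᶠ z in 𝓝 y, z ∈ S2 ∧ gen a z := by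
    intro y hy hyj
    apply freq_gen H ho2
    exact ((freq_half (neg_ne_zero.2 (H.ha j)) (by rw [inner_neg_left, hyj, neg_zero])).and_eventually
      (Metric.isOpen_ball.mem_nhds hy)).mono fun z hz => ⟨hz.2, hz.1⟩
  have hxB : x ∈ Metric.ball x ε := Metric.mem_ball_self hε
  obtain ⟨y1, hy1, hg1⟩ := (hf1 x hxB hxj).exists
  obtain ⟨y2, hy2, hg2⟩ := (hf2 x hxB hxj).exists
  refine ⟨y1, y2, fun φ hφ => ?_⟩
  obtain ⟨v1, hv1⟩ := Gd_const H (φ := φ) (S := S1) ((convex_ball x ε).inter (hcv _)).isPreconnected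
    (fun y hy => hφ y (hT y hy.1 (ne_of_gt hy.2)))
  obtain ⟨v2, hv2⟩ := Gd_const H (φ := φ) (S := S2) ((convex_ball x ε).inter (hcv _)).isPreconnected
    (fun y hy => hφ y (hT y hy.1 (by
      have := hy.2
      simp only [Set.mem_setOf_eq, inner_neg_left] at this
      intro h; rw [h] at this; simp at this)))
  have hv1' : ∀ y ∈ S1, gen a y → Fv a Q y φ = v1 := fun y hy hg => (hv1 y hy).self_of_nhds hg
  have hv2' : ∀ y ∈ S2, gen a y → Fv a Q y φ = v2 := fun y hy hg => (hv2 y hy).self_of_nhds hg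
  have key : ∀ y ∈ Metric.ball x ε, ⟪a j, y⟫ = 0 → (Gd a Q φ y ↔ v1 = v2) := by
    intro y hy hyj
    constructor
    · rintro ⟨v, hv⟩
      obtain ⟨z, h3, h4⟩ := ((hf1 y hy hyj).and_eventually hv).exists
      obtain ⟨z', h5, h6⟩ := ((hf2 y hy hyj).and_eventually hv).exists
      rw [← hv1' z h3.1 h3.2, ← hv2' z' h5.1 h5.2, h4 h3.2, h6 h5.2]
    · intro e
      refine ⟨v1, ?_⟩
      filter_upwards [Metric.isOpen_ball.mem_nhds hy] with z hz hgz
      rcases lt_or_gt_of_ne (hgz j) with h | h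
      · rw [e]; exact hv2' z ⟨hz, by simpa [inner_neg_left] using h⟩ hgz
      · exact hv1' z ⟨hz, h⟩ hgz
  refine ⟨?_, ?_⟩
  · rw [key x hxB hxj, hv1' y1 hy1 hg1, hv2' y2 hy2 hg2]
  · filter_upwards [Metric.isOpen_ball.mem_nhds hxB] with y hy hyj
    rw [key y hy hyj, key x hxB hxj]

omit [Finite ι] H in
theorem rank_cut {W : Type} [AddCommGroup W] [Module ℚ W] [FiniteDimensional ℚ W] {κ : Type} (V V' : Submodule ℚ W)
    (X : Finset κ) (L : κ → W →ₗ[ℚ] ℚ) (h : ∀ φ ∈ V, (∀ x ∈ X, L x φ = 0) → φ ∈ V') :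
    finrank ℚ V ≤ finrank ℚ V' + X.card := by
  let f : V →ₗ[ℚ] (X → ℚ) := LinearMap.pi (fun x => (L x.1).comp V.subtype)
  have h1 := f.finrank_range_add_finrank_ker
  have h2 : finrank ℚ (LinearMap.range f) ≤ X.card := by
    have := Submodule.finrank_le (LinearMap.range f)
    simpa using this
  have h3 : finrank ℚ (LinearMap.ker f) ≤ finrank ℚ V' := by
    rw [← Submodule.finrank_map_subtype_eq V (LinearMap.ker f)]
    apply Submodule.finrank_mono
    rintro _ ⟨φ, hφ, rfl⟩
    apply h _ φ.2
    intro x hx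
    exact congrFun (LinearMap.mem_ker.1 hφ) ⟨x, hx⟩
  omega

omit H in
instance SigFin : Finite (Sig a Q) := by
  have h : (Set.range (fun f : ι → Fin 3 => fun k => ((f k : ℕ) : ℚ) - 1)).Finite := Set.finite_range _
  refine (h.subset ?_).to_subtype
  rintro _ ⟨x, -, -, rfl⟩
  refine ⟨fun k => if sg ⟪a k, x⟫ = 1 then 2 else if sg ⟪a k, x⟫ = 0 then 1 else 0, ?_⟩
  funext k
  rcases sg_cases ⟪a k, x⟫ with h | h | h <;> simp [sv, h] <;> norm_num

theorem step [DecidableEq ι] {A : Finset ι} {j : ι} (hj : j ∉ A) {q : E3} (hq : q ≠ 0) (hqj : ⟪a j, q⟫ = 0)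
    (hqT : q ∉ TA a Q (insert j A)) (ih : EE (ind (TA a Q A)) ≤ finrank ℚ (VA a Q A)) :
    EE (ind (TA a Q (insert j A))) ≤ finrank ℚ (VA a Q (insert j A)) := by
  classical
  set O : Set E3 := {x | ⟪a j, x⟫ = 0 ∧ x ∈ TA a Q (insert j A)} with hO
  have hsplit : ind (TA a Q (insert j A)) = ind (TA a Q A) + ind O := by
    funext x
    simp only [Pi.add_apply]
    by_cases h1 : x ∈ TA a Q (insert j A)
    · rw [ind_mem h1]
      by_cases h2 : ⟪a j, x⟫ = 0
      · rw [ind_mem (s := O) ⟨h2, h1⟩, ind_not (fun h => h.2 j hj h2)]; ring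
      · rw [ind_not (s := O) (fun h => h2 h.1), ind_mem (s := TA a Q A) ⟨h1.1, fun k hk => ?_⟩]
        · ring
        · by_cases hkj : k = j
          · rw [hkj]; exact h2
          · exact h1.2 k (by simp [hk, hkj])
    · rw [ind_not h1, ind_not (s := O) (fun h => h1 h.2), ind_not (fun h => h1 ⟨h.1, fun k hk => h.2 k (fun h' => hk (by simp [h']))⟩)]
      ring
  have hTo : IsOpen (TA a Q (insert j A)) := by
    have : TA a Q (insert j A) = Q ∩ ⋂ k : ι, {x | k ∉ insert j A → ⟪a k, x⟫ ≠ 0} := by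
      ext x; simp [TA]
    rw [this]
    apply H.op.inter
    apply isOpen_iInter_of_finite
    intro k
    by_cases hk : k ∈ insert j A
    · simp only [hk, not_true, false_implies]; exact isOpen_univ
    · simp only [hk, not_false_eq_true, true_implies]
      exact isOpen_ne_fun (by fun_prop) continuous_const
  obtain ⟨X, hX1, hX2, hX3⟩ := plane a (H.ha j) hq hqj (O := O) hTo (fun x => Iff.rfl)
    (fun h => H.z h.2.1)
    (by
      intro x hx s hs
      refine ⟨by rw [inner_smul_right, hx.1, mul_zero], H.cone x hx.2.1 s hs, fun k hk => ?_⟩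
      rw [inner_smul_right]; exact mul_ne_zero hs.ne' (hx.2.2 k hk))
    (by
      intro x y hy _ hyj hxy hx
      refine ⟨hyj, H.cell x y hx.2.1 hy hxy, fun k hk h => ?_⟩
      have h1 := hxy k
      rw [h, sg_zero] at h1
      exact hx.2.2 k hk (sg_eq_zero.1 h1))
    (fun h => hqT h.2)
  have hjump : ∀ x, x ∈ O → ∃ y1 y2 : E3, ∀ φ ∈ VA a Q A, (Gd a Q φ x ↔ Fv a Q y1 φ = Fv a Q y2 φ) ∧
      ∀ᶠ y in 𝓝 x, ⟪a j, y⟫ = 0 → (Gd a Q φ y ↔ Gd a Q φ x) :=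
    fun x hx => local_jump H hx.2 hx.1
  choose! y1 y2 hy using hjump
  have hr := rank_cut (VA a Q A) (VA a Q (insert j A)) X (fun x => Fv a Q (y1 x) - Fv a Q (y2 x)) (by
    intro φ hφ hX x hx
    by_cases hxj : ⟪a j, x⟫ = 0
    · obtain ⟨x', hx', S, hSO, hS, hxS, hxS'⟩ := hX3 x ⟨hxj, hx⟩
      have hc := lc_const hS (fun x => Gd a Q φ x) (by
        intro z hz
        filter_upwards [(hy z (hSO hz) φ hφ).2] with y h1 hyS
        exact propext (h1 (hSO hyS).1))
      have e : Gd a Q φ x = Gd a Q φ x' := hc x hxS x' hxS'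
      rw [e]
      apply (hy x' (hSO hxS') φ hφ).1.2
      have := hX x' hx'
      rw [LinearMap.sub_apply] at this
      linarith
    · apply hφ x ⟨hx.1, fun k hk => ?_⟩
      by_cases hkj : k = j
      · rw [hkj]; exact hxj
      · exact hx.2 k (by simp [hk, hkj]))
  rw [hsplit, map_add]
  have hr' : (finrank ℚ (VA a Q A) : ℚ) ≤ finrank ℚ (VA a Q (insert j A)) + X.card := by exact_mod_cast hr
  linarith

end
end GS

namespace GS
open Filter Topology Module

theorem RO_open {C : Set E3} (hC : Convex ℝ C) (ho : IsOpen C) : RO C := by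
  refine ⟨hC, fun x _ y hy => ?_⟩
  have hc : Continuous (fun ε : ℝ => y + ε • (y - x)) := by fun_prop
  have h1 : ∀ᶠ ε in 𝓝 (0:ℝ), y + ε • (y - x) ∈ C := by
    apply hc.continuousAt.eventually_mem
    simpa using ho.mem_nhds hy
  obtain ⟨ε, h2, h3⟩ := ((h1.filter_mono (nhdsWithin_le_nhds (s := Set.Ioi 0))).and self_mem_nhdsWithin).exists
  exact ⟨ε, h3, h2⟩

theorem EE_open {C : Set E3} (hC : Convex ℝ C) (ho : IsOpen C) (hn : C.Nonempty) (h0 : (0:E3) ∉ C) :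
    EE (ind C) = 1 := by
  rw [EE_ind (RO_open hC ho) hn, ind_not h0, ← direction_affineSpan, ho.affineSpan_eq_top hn,
    AffineSubspace.direction_top, finrank_top]
  simp
  norm_num

theorem half_conv (c : E3) : Convex ℝ {y : E3 | 0 < ⟪c, y⟫} := by
  intro y hy z hz s t hs ht hst
  simp only [Set.mem_setOf_eq, inner_add_right, inner_smul_right] at *
  rcases hs.eq_or_lt with h | h
  · have : t = 1 := by linarith
    subst this; rw [← h]; linarith
  · nlinarith [mul_pos h hy, mul_nonneg ht hz.le]

theorem half_open (c : E3) : IsOpen {y : E3 | 0 < ⟪c, y⟫} := isOpen_lt continuous_const (by fun_prop)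

theorem half_sg (c : E3) {x : E3} (h : ⟪c, x⟫ ≠ 0) : ∃ c', {y | sg ⟪c, y⟫ = sg ⟪c, x⟫} = {y | 0 < ⟪c', y⟫} := by
  rcases lt_or_gt_of_ne h with h | h
  · refine ⟨-c, ?_⟩
    ext y
    simp only [Set.mem_setOf_eq]
    rw [sg_neg h, sg_eq_neg_one, inner_neg_left, neg_pos]
  · refine ⟨c, ?_⟩
    ext y
    simp only [Set.mem_setOf_eq]
    rw [sg_pos h, sg_eq_one]

section
variable {ι : Type} {a : ι → E3} {Q : Set E3} [Finite ι] (H : QH a Q)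

theorem EE_cell (j0 : ι) {x : E3} (hx : gen a x) : EE (ind {y | sv a y = sv a x}) = 1 := by
  have e : {y | sv a y = sv a x} = ⋂ k, {y | sg ⟪a k, y⟫ = sg ⟪a k, x⟫} := by
    ext y; simp only [Set.mem_setOf_eq, Set.mem_iInter]; exact funext_iff
  apply EE_open
  · rw [e]
    apply convex_iInter
    intro k
    obtain ⟨c, hc⟩ := half_sg (a k) (hx k)
    rw [hc]; exact half_conv c
  · rw [e]
    apply isOpen_iInter_of_finite
    intro k
    obtain ⟨c, hc⟩ := half_sg (a k) (hx k)
    rw [hc]; exact half_open c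
  · exact ⟨x, rfl⟩
  · intro h
    have := congrFun h j0
    simp only [sv, inner_zero_right, sg_zero] at this
    exact hx j0 (sg_eq_zero.1 this.symm)

include H
theorem base (j0 : ι) : EE (ind (TA a Q ∅)) ≤ finrank ℚ (VA a Q ∅) := by
  classical
  haveI : Fintype (Sig a Q) := Fintype.ofFinite _
  have hgen : ∀ x, x ∈ TA a Q ∅ ↔ x ∈ Q ∧ gen a x := by
    intro x; simp [TA, gen]
  have hV : VA a Q ∅ = ⊤ := by
    rw [eq_top_iff]
    intro φ _ x hx
    refine ⟨Fv a Q x φ, ?_⟩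
    filter_upwards [freeze (F := fun k y => ⟪a k, y⟫) (fun k => by fun_prop) x] with y hy _
    rw [Fv_congr (funext fun k => hy k (((hgen x).1 hx).2 k))]
  have hs : ind (TA a Q ∅) = ∑ e : Sig a Q, ind {y | sv a y = e.1} := by
    funext y
    rw [Finset.sum_apply]
    by_cases hy : y ∈ TA a Q ∅
    · have hyS : sv a y ∈ Sig a Q := ⟨y, hy.1, ((hgen y).1 hy).2, rfl⟩
      rw [ind_mem hy, Finset.sum_eq_single ⟨sv a y, hyS⟩]
      · rw [ind_mem]; rfl
      · intro e _ he
        apply ind_not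
        intro h
        exact he (Subtype.ext h.symm)
      · simp
    · rw [ind_not hy, Finset.sum_eq_zero]
      rintro ⟨_, x, hx, hxg, rfl⟩ _
      apply ind_not
      intro h
      have h' : ∀ k, sg ⟪a k, y⟫ = sg ⟪a k, x⟫ := fun k => congrFun h k
      have hyg : gen a y := by
        intro k hk
        have := h' k
        rw [hk, sg_zero] at this
        exact hxg k (sg_eq_zero.1 this.symm)
      apply hy
      rw [hgen]
      refine ⟨H.cell x y hx ?_ (fun k => (h' k).symm), hyg⟩
      rintro rfl
      exact hyg j0 (inner_zero_right _)
  have hE : ∀ e : Sig a Q, EE (ind {y | sv a y = e.1}) = 1 := by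
    rintro ⟨_, x, hx, hxg, rfl⟩
    exact EE_cell j0 hxg
  rw [hs, map_sum, hV, finrank_top, Module.finrank_fintype_fun_eq_card]
  simp only [hE]
  simp

theorem EE_le [DecidableEq ι] [Fintype ι] (j0 : ι) {q : E3} (hq : q ≠ 0) (hqj : ⟪a j0, q⟫ = 0) (hqQ : q ∉ Q) :
    EE (ind Q) ≤ finrank ℚ (VA a Q Finset.univ) := by
  have h1 : ∀ A : Finset ι, j0 ∉ A → EE (ind (TA a Q A)) ≤ finrank ℚ (VA a Q A) := by
    intro A
    induction A using Finset.induction_on with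
    | empty => intro _; exact base H j0
    | insert j A hj ih =>
      intro hj0
      have hne : j0 ≠ j := fun h => hj0 (by simp [h])
      -- a nonzero vector orthogonal to both walls
      obtain ⟨x, hx0, hxj, hxj0⟩ : ∃ x : E3, x ≠ 0 ∧ ⟪a j, x⟫ = 0 ∧ ⟪a j0, x⟫ = 0 := by
        have : ∃ x : E3, x ≠ 0 ∧ ∀ i : Fin 2, ⟪(![a j, a j0] : Fin 2 → E3) i, x⟫ = 0 := by
          let f : E3 →ₗ[ℝ] (Fin 2 → ℝ) := LinearMap.pi fun i => (innerSL ℝ ((![a j, a j0] : Fin 2 → E3) i)).toLinearMap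
          have : LinearMap.ker f ≠ ⊥ := LinearMap.ker_ne_bot_of_finrank_lt (by simp)
          obtain ⟨x, hx, hx0⟩ := Submodule.exists_mem_ne_zero_of_ne_bot this
          exact ⟨x, hx0, fun i => congrFun (LinearMap.mem_ker.1 hx) i⟩
        obtain ⟨x, hx0, hx⟩ := this
        exact ⟨x, hx0, hx 0, hx 1⟩
      exact step H hj hx0 hxj (fun h => h.2 j0 (by simpa using hj0) hxj0)
        (ih (fun h => hj0 (by simp [h])))
  have h2 := step H (A := Finset.univ.erase j0) (by simp) hq hqj (fun h => hqQ h.1) (h1 _ (by simp))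
  have h3 : insert j0 (Finset.univ.erase j0) = Finset.univ := Finset.insert_erase (Finset.mem_univ _)
  rw [h3] at h2
  have h4 : TA a Q Finset.univ = Q := by ext x; simp [TA]
  rwa [h4] at h2

theorem final_le [Fintype ι] {n : ℕ} [NeZero n] (K : ZMod n → E3) (h0 : ∀ x ∈ PP K, x ≠ 0) (hgQ : ∀ x ∈ PP K, x ∉ Q)
    (hoff : ∀ x, x ≠ 0 → x ∉ PP K → x ∉ Q → ∀ᶠ y in 𝓝 x, y ∉ Q)
    (hloc : ∀ ξ ∈ PP K, ∃ p q d : E3, ⟪p, ξ⟫ = 0 ∧ ⟪q, ξ⟫ = 0 ∧ ⟪p, d⟫ < 0 ∧ ⟪q, d⟫ < 0 ∧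
      ((∀ᶠ y in 𝓝 ξ, y ∈ Q ↔ (⟪p, y⟫ < 0 ∧ ⟪q, y⟫ < 0)) ∨ (∀ᶠ y in 𝓝 ξ, y ∈ Q ↔ (0 < ⟪p, y⟫ ∨ 0 < ⟪q, y⟫)))) :
    finrank ℚ (VA a Q Finset.univ) ≤ 1 := by
  classical
  have hsub : VA a Q Finset.univ ≤ Submodule.span ℚ {(1 : Sig a Q → ℚ)} := by
    intro φ hφ
    have hGd : ∀ x ∈ Q, Gd a Q φ x := fun x hx => hφ x ⟨hx, by simp⟩
    -- every point of the curve is in the closure of Q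
    have hcl : ∀ ξ ∈ PP K, ∃ᶠ y in 𝓝 ξ, y ∈ Q := by
      intro ξ hξ
      obtain ⟨p, q, d, hp, hq, hpd, hqd, hh⟩ := hloc ξ hξ
      have aux : ∀ e : E3, Tendsto (fun δ : ℝ => ξ + δ • e) (𝓝[>] 0) (𝓝 ξ) := by
        intro e
        have : Continuous (fun δ : ℝ => ξ + δ • e) := by fun_prop
        have := this.tendsto 0
        simp only [zero_smul, add_zero] at this
        exact this.mono_left nhdsWithin_le_nhds
      rcases hh with hh | hh
      · apply (aux d).frequently
        apply Eventually.frequently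
        filter_upwards [self_mem_nhdsWithin, (aux d).eventually hh] with δ hδ h1
        have hδ' : 0 < δ := hδ
        rw [h1, inner_add_right, inner_add_right, inner_smul_right, inner_smul_right, hp, hq]
        constructor <;> nlinarith
      · apply (aux (-d)).frequently
        apply Eventually.frequently
        filter_upwards [self_mem_nhdsWithin, (aux (-d)).eventually hh] with δ hδ h1
        have hδ' : 0 < δ := hδ
        rw [h1, inner_add_right, inner_add_right, inner_smul_right, inner_smul_right, hp, hq,
          inner_neg_right, inner_neg_right]
        left; nlinarith
    have hgq : ∀ ξ ∈ PP K, ∃ᶠ y in 𝓝 ξ, y ∈ Q ∧ gen a y := fun ξ hξ => freq_gen H H.op (hcl ξ hξ)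
    have hval : ∀ ξ, ξ ∈ PP K → ∃ v, ∀ᶠ y in 𝓝 ξ, y ∈ Q → gen a y → Fv a Q y φ = v := by
      intro ξ hξ
      obtain ⟨p, q, d, hp, hq, hpd, hqd, hh⟩ := hloc ξ hξ
      obtain ⟨ε, hε, hB⟩ : ∃ ε > 0, ∃ S, IsPreconnected S ∧ ∀ y ∈ Metric.ball ξ ε, (y ∈ Q → y ∈ S) ∧ S ⊆ Q := by
        rcases hh with hh | hh
        · obtain ⟨ε, hε, hB⟩ := Metric.eventually_nhds_iff_ball.1 hh
          refine ⟨ε, hε, Metric.ball ξ ε ∩ ({y | 0 < ⟪-p, y⟫} ∩ {y | 0 < ⟪-q, y⟫}),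
            ((convex_ball ξ ε).inter ((half_conv _).inter (half_conv _))).isPreconnected, fun y hy => ⟨fun h => ?_, ?_⟩⟩
          · have := (hB y hy).1 h
            refine ⟨hy, ?_, ?_⟩ <;> simp only [Set.mem_setOf_eq, inner_neg_left] <;> linarith
          · rintro z ⟨hz, h1, h2⟩
            simp only [Set.mem_setOf_eq, inner_neg_left] at h1 h2
            exact (hB z hz).2 ⟨by linarith, by linarith⟩
        · obtain ⟨ε, hε, hB⟩ := Metric.eventually_nhds_iff_ball.1 hh
          have hpc : ∀ c : E3, IsPreconnected (Metric.ball ξ ε ∩ {y | 0 < ⟪c, y⟫}) := fun c =>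
            ((convex_ball ξ ε).inter (half_conv _)).isPreconnected
          obtain ⟨z, hz⟩ : ∃ z ∈ Metric.ball ξ ε, 0 < ⟪p, z⟫ ∧ 0 < ⟪q, z⟫ := by
            have ht : Tendsto (fun δ : ℝ => ξ + δ • (-d)) (𝓝[>] 0) (𝓝 ξ) := by
              have : Continuous (fun δ : ℝ => ξ + δ • (-d)) := by fun_prop
              have := this.tendsto 0
              simp only [zero_smul, add_zero] at this
              exact this.mono_left nhdsWithin_le_nhds
            obtain ⟨δ, h1, h2⟩ := ((ht.eventually (Metric.ball_mem_nhds ξ hε)).and self_mem_nhdsWithin).exists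
            have hδ' : 0 < δ := h2
            refine ⟨_, h1, ?_, ?_⟩
            · rw [inner_add_right, inner_smul_right, hp, inner_neg_right]; nlinarith
            · rw [inner_add_right, inner_smul_right, hq, inner_neg_right]; nlinarith
          have hm1 : z ∈ Metric.ball ξ ε ∩ {y | 0 < ⟪p, y⟫} := ⟨hz.1, hz.2.1⟩
          have hm2 : z ∈ Metric.ball ξ ε ∩ {y | 0 < ⟪q, y⟫} := ⟨hz.1, hz.2.2⟩
          refine ⟨ε, hε, _, IsPreconnected.union z hm1 hm2 (hpc p) (hpc q), fun y hy => ⟨fun h => ?_, ?_⟩⟩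
          · rcases (hB y hy).1 h with h1 | h1
            · exact Or.inl ⟨hy, h1⟩
            · exact Or.inr ⟨hy, h1⟩
          · rintro w (⟨hw, h1⟩ | ⟨hw, h1⟩)
            · exact (hB w hw).2 (Or.inl h1)
            · exact (hB w hw).2 (Or.inr h1)
      obtain ⟨S, hS, hB⟩ := hB
      have hSQ := (hB ξ (Metric.mem_ball_self hε)).2
      obtain ⟨v, hv⟩ := Gd_const H hS (fun x hx => hGd x (hSQ hx))
      refine ⟨v, ?_⟩
      filter_upwards [Metric.ball_mem_nhds ξ hε] with y hy hyQ hyg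
      exact (hv y ((hB y hy).1 hyQ)).self_of_nhds hyg
    choose! v hv using hval
    have hvc : ∀ i, ∀ x ∈ kk (K i) (K (i + 1)), ∀ y ∈ kk (K i) (K (i + 1)), v x = v y := by
      intro i
      apply lc_const (kk_conv _ _).isPreconnected v
      intro x hx
      filter_upwards [eventually_eventually_nhds.2 (hv x ⟨i, hx⟩)] with y hy hyk
      obtain ⟨z, ⟨h1, h2⟩, h3, h4⟩ := ((hgq y ⟨i, hyk⟩).and_eventually (hy.and (hv y ⟨i, hyk⟩))).exists
      rw [← h3 h1 h2, ← h4 h1 h2]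
    set t := v (K 0) with ht
    have hK : ∀ i, v (K i) = t := by
      apply zmod_ind
      · rfl
      · intro i hi
        rw [← hi]
        exact hvc i _ (kk_right _ _) _ (kk_left _ _)
    have hvt : ∀ x ∈ PP K, v x = t := by
      rintro x ⟨i, hx⟩
      rw [← hK i]; exact hvc i _ hx _ (kk_left _ _)
    choose! w hw using hGd
    have hcon := lc_const ne0_conn (fun x => if x ∈ Q then w x else t) (by
      intro x hx
      by_cases hxQ : x ∈ Q
      · filter_upwards [H.op.mem_nhds hxQ, eventually_eventually_nhds.2 (hw x hxQ)] with y hyQ hy _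
        simp only [hxQ, hyQ, if_true]
        obtain ⟨z, h1, h2, h3⟩ := ((freq_gen' H y).and_eventually (hy.and (hw y hyQ))).exists
        rw [← h2 h1, ← h3 h1]
      · by_cases hxg : x ∈ PP K
        · filter_upwards [eventually_eventually_nhds.2 (hv x hxg)] with y hy _
          simp only [hxQ, if_false]
          split_ifs with hyQ
          · obtain ⟨z, h1, h2, h3, h4⟩ := ((freq_gen' H y).and_eventually (hy.and ((hw y hyQ).and (H.op.mem_nhds hyQ)))).exists
            rw [← hvt x hxg, ← h2 h4 h1, ← h3 h1]
          · rfl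
        · filter_upwards [hoff x hx hxg hxQ] with y hy _
          simp only [hxQ, hy, if_false])
    have hK0 : K 0 ∈ PP K := ⟨0, kk_left _ _⟩
    have hwt : ∀ x ∈ Q, w x = t := by
      intro x hx
      have := hcon x (by intro h; exact H.z (by rw [Set.mem_singleton_iff] at h; exact h ▸ hx)) (K 0) (h0 _ hK0)
      simpa [hx, hgQ _ hK0] using this
    rw [Submodule.mem_span_singleton]
    refine ⟨t, ?_⟩
    funext ⟨e, x, hx, hxg, he⟩
    have h1 := (hw x hx).self_of_nhds hxg
    rw [hwt x hx] at h1
    subst he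
    have h2 : sv a x ∈ Sig a Q := ⟨x, hx, hxg, rfl⟩
    simp only [Fv, FE, h2, dite_true] at h1
    simpa using h1.symm
  refine (Submodule.finrank_mono hsub).trans ?_
  exact finrank_span_le_card _ |>.trans (by simp)
end
end GS

namespace GS
open Filter Topology Module

def QQ {n : ℕ} [NeZero n] (u : ZMod n → E3) (ζ : E3) (v : ℚ) : Set E3 := {x | x ≠ 0 ∧ x ∉ PP (KK u) ∧ hh u ζ x = v}

def wal {n : ℕ} (u : ZMod n → E3) (ζ : E3) : Option (ZMod n) → E3
  | none => ζ
  | some i => u i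

theorem sg_zero_iff {x y : ℝ} (h : sg x = sg y) : x = 0 ↔ y = 0 := by
  rw [← sg_eq_zero, h, sg_eq_zero]
theorem sg_pos_iff {x y : ℝ} (h : sg x = sg y) : 0 < x ↔ 0 < y := by
  rw [← sg_eq_one, h, sg_eq_one]
theorem sg_neg_iff {x y : ℝ} (h : sg x = sg y) : x < 0 ↔ y < 0 := by
  rw [← sg_eq_neg_one, h, sg_eq_neg_one]
theorem sg_le_iff {x y : ℝ} (h : sg x = sg y) : x ≤ 0 ↔ y ≤ 0 := by
  rw [← not_lt, sg_pos_iff h, not_lt]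
theorem sg_mul_nonneg {x y S : ℝ} (h : sg x = sg y) : 0 ≤ x * S ↔ 0 ≤ y * S := by
  have : sg (x * S) = sg (y * S) := by rw [sg_mul, sg_mul, h]
  rw [← not_lt, sg_neg_iff this, not_lt]

theorem aa_sgc {a x y : E3} (h : sg ⟪a, x⟫ = sg ⟪a, y⟫) : aa a x = aa a y := by
  classical
  unfold aa
  simp only [sg_le_iff h]

theorem hh_cell {n : ℕ} [NeZero n] {u : ZMod n → E3} {ζ x y : E3} (hz : sg ⟪ζ, x⟫ = sg ⟪ζ, y⟫)
    (h : ∀ i, sg ⟪u i, x⟫ = sg ⟪u i, y⟫) : hh u ζ x = hh u ζ y := by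
  have h1 := hh_eq u ζ x
  have h2 := hh_eq u ζ y
  simp only [dd, aa_sgc hz, aa_sgc (h _)] at h1 h2
  linarith

theorem g_cell {n : ℕ} [NeZero n] {u : ZMod n → E3} {ζ x y : E3} (H : Hyp u ζ) (hx : x ≠ 0) (hy : y ≠ 0)
    (h : ∀ i, sg ⟪u i, x⟫ = sg ⟪u i, y⟫) : x ∈ PP (KK u) ↔ y ∈ PP (KK u) := by
  unfold PP
  simp only [Set.mem_setOf_eq, kkK H hx, kkK H hy]
  apply exists_congr; intro i
  rw [sg_zero_iff (h i), sg_mul_nonneg (h (i-1)), sg_mul_nonneg (h (i+1))]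

theorem QQ_QH {n : ℕ} [NeZero n] {u : ZMod n → E3} {ζ : E3} (H : Hyp u ζ) (G : Poly (KK u)) (v : ℚ) :
    QH (wal u ζ) (QQ u ζ v) := by
  have hc : ∀ x y, x ∈ QQ u ζ v → y ≠ 0 → (∀ k, sg ⟪wal u ζ k, x⟫ = sg ⟪wal u ζ k, y⟫) → y ∈ QQ u ζ v := by
    rintro x y ⟨h0, h1, h2⟩ hy h
    have hu : ∀ i, sg ⟪u i, x⟫ = sg ⟪u i, y⟫ := fun i => h (some i)
    exact ⟨hy, (g_cell H h0 hy hu).not.1 h1, by rw [← hh_cell (ζ := ζ) (h none) hu, h2]⟩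
  refine ⟨?_, ?_, fun h => h.1 rfl, ?_, hc⟩
  · rintro (_ | i)
    · exact H.zne
    · exact H.une i
  · rw [isOpen_iff_mem_nhds]
    rintro x ⟨h0, h1, h2⟩
    filter_upwards [ne0_near h0, hh_off H h0 h1, G.off h0 h1] with y y1 y2 y3
    exact ⟨y1, y3, by rw [y2.1, h2]⟩
  · intro x hx s hs
    refine hc x _ hx (smul_ne_zero hs.ne' hx.1) fun k => ?_
    rw [inner_smul_right, sg_mul, sg_pos hs, one_mul]

theorem QQ_le {n : ℕ} [NeZero n] {u : ZMod n → E3} {ζ : E3} (H : Hyp u ζ) (G : Poly (KK u)) (c v : ℚ)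
    (hv : v = c ∨ v = c + 1)
    (hl : ∀ x ∈ PP (KK u), LocG (PP (KK u)) (hh u ζ) (hh' u ζ) c x) :
    EE (ind (QQ u ζ v)) ≤ 1 := by
  classical
  have Q := QQ_QH H G v
  have hq : mm u 0 ∈ PP (KK u) := ⟨0, by rw [KK_succ]; exact kk_right _ _⟩
  have h1 := EE_le Q (some 0) (q := mm u 0) (G.ne0 hq) (by
    simp only [wal, mm]; rw [real_inner_comm]; first | exact inner_cross_self _ _ | exact inner_cross_self' _ _ | (rw [real_inner_comm]; exact inner_cross_self _ _)) (fun h => h.2.1 hq)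
  have h2 := final_le Q (KK u) (fun x hx => G.ne0 hx) (fun x hx h => h.2.1 hx) (by
    intro x h0 hx hn
    filter_upwards [hh_off H h0 hx] with y hy hQ
    exact hn ⟨h0, hx, by rw [← hy.1, hQ.2.2]⟩) (by
    intro ξ hξ
    obtain ⟨p, q, d, e1, e2, e3, e4, e5⟩ := hl ξ hξ
    have key : ∀ (R L : E3 → Prop), (∀ᶠ y in 𝓝 ξ, TL (PP (KK u)) (hh u ζ) (hh' u ζ) c (R y) (L y) y) →
        ((v = c → ∀ᶠ y in 𝓝 ξ, y ∈ QQ u ζ v ↔ L y) ∧ (v = c + 1 → ∀ᶠ y in 𝓝 ξ, y ∈ QQ u ζ v ↔ R y)) := by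
      intro R L h
      constructor
      · rintro rfl
        filter_upwards [h, ne0_near (G.ne0 hξ)] with y hy h0
        constructor
        · intro hQ
          by_contra hL
          by_cases hR : R y
          · have := (hy.r hR).1; rw [hQ.2.2] at this; linarith
          · exact hQ.2.1 (hy.b hR hL).1
        · intro hL
          have := hy.l hL
          exact ⟨h0, this.2.2, this.1⟩
      · rintro rfl
        filter_upwards [h, ne0_near (G.ne0 hξ)] with y hy h0
        constructor
        · intro hQ
          by_contra hR
          by_cases hL : L y
          · have := (hy.l hL).1; rw [hQ.2.2] at this; linarith
          · exact hQ.2.1 (hy.b hR hL).1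
        · intro hL
          have := hy.r hL
          exact ⟨h0, this.2.2, this.1⟩
    refine ⟨p, q, d, e1, e2, e3, e4, ?_⟩
    rcases e5 with e5 | e5
    · rcases hv with hv | hv
      · exact Or.inr ((key _ _ e5).1 hv)
      · exact Or.inl ((key _ _ e5).2 hv)
    · rcases hv with hv | hv
      · exact Or.inl ((key _ _ e5).1 hv)
      · exact Or.inr ((key _ _ e5).2 hv))
  refine h1.trans ?_
  exact_mod_cast h2

end GS

namespace GS
open Filter Topology Module

theorem LocG.mn {g : Set E3} {h h' : E3 → ℚ} {v : ℚ} {ξ : E3} (H : LocG g h h' v ξ) : min (h ξ) (h' ξ) = v := by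
  obtain ⟨p, q, d, e1, e2, -, -, e5⟩ := H
  rcases e5 with e5 | e5
  · exact ((e5.self_of_nhds).b (by simp [e1]) (by simp [e1, e2])).2.1
  · exact ((e5.self_of_nhds).b (by simp [e1, e2]) (by simp [e1])).2.1

def kq {n : ℕ} [NeZero n] (u : ZMod n → E3) : ℚ := ∑ i, (1 - ss u i * ss u (i+1)) / 2

theorem EE_cells {n : ℕ} [NeZero n] {u : ZMod n → E3} {ζ : E3} (G : Poly (KK u)) (c : ℚ)
    (h1 : ∀ i, ∀ x ∈ pc ![mm u (i-1), mm u i], hh u ζ x = c + (1 + ss u i)/2)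
    (h2 : ∀ i, ∀ x ∈ pc ![mm u i], hh u ζ x = c + (1 + ss u i)*(1 + ss u (i+1))/4) :
    EE ((hh u ζ - c • 1) * ind (PP (KK u))) = - kq u / 2 := by
  have e : (hh u ζ - c • 1) * ind (PP (KK u)) = ∑ i, (((1 + ss u i)/2) • ind (pc ![KK u i, KK u (i+1)]) +
      ((1 + ss u (i-1))*(1 + ss u i)/4) • ind (pc ![KK u i])) := by
    rw [G.ind_PP, Finset.mul_sum]
    apply Finset.sum_congr rfl
    intro i _
    rw [mul_add]
    congr 1
    · funext x
      simp only [Pi.mul_apply, Pi.sub_apply, Pi.smul_apply, Pi.one_apply, smul_eq_mul, mul_one]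
      by_cases hx : x ∈ pc ![KK u i, KK u (i+1)]
      · have := h1 i x (by rwa [KK_succ] at hx)
        rw [this]; ring
      · rw [ind_not hx]; ring
    · funext x
      simp only [Pi.mul_apply, Pi.sub_apply, Pi.smul_apply, Pi.one_apply, smul_eq_mul, mul_one]
      by_cases hx : x ∈ pc ![KK u i]
      · have := h2 (i-1) x hx
        rw [sub_add_cancel] at this
        rw [this]; ring
      · rw [ind_not hx]; ring
  rw [e, map_sum]
  have e2 : ∀ i, EE (((1 + ss u i)/2) • ind (pc ![KK u i, KK u (i+1)]) +
      ((1 + ss u (i-1))*(1 + ss u i)/4) • ind (pc ![KK u i])) = -(1/4) - (1/4) * ss u i + (1/4) * ss u (i-1) + (1/4) * (ss u (i-1) * ss u (i-1+1)) := by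
    intro i
    rw [map_add, map_smul, map_smul, EE_pc (by norm_num) (li12 (G.hS' i)), EE_pc (by norm_num) (li1 (G.hS' i)), sub_add_cancel]
    simp only [smul_eq_mul]; ring
  simp only [e2, Finset.sum_add_distrib, Finset.sum_sub_distrib, ← Finset.mul_sum]
  rw [sum_sub1 (fun i => ss u i), sum_sub1 (fun i => ss u i * ss u (i+1)), kq]
  simp only [sub_div, Finset.sum_sub_distrib, ← Finset.sum_div]
  simp only [Finset.sum_const]
  simp only [nsmul_eq_mul]
  ring

theorem main_alt {n : ℕ} [NeZero n] {u : ZMod n → E3} {ζ : E3} (H : Hyp u ζ) (G : Poly (KK u)) :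
    kq u = 4 ∨ ∀ ξ, ξ ≠ 0 → ⟪ζ, ξ⟫ ≠ 0 → (∀ i, ⟪u i, ξ⟫ ≠ 0) → ∑ i, dd u i ξ ≤ 2 := by
  obtain ⟨c, c1, c2, c3, c4⟩ := xi_side H G
  obtain ⟨a, W, -, a1, a2⟩ := ff_int H
  obtain ⟨b, hb⟩ := beta_int H
  set g := PP (KK u) with hg
  have hR := QQ_le H G c (c+1) (Or.inr rfl) c2
  have hL := QQ_le H G c c (Or.inl rfl) c2
  have hoff : ∀ x, x ≠ 0 → x ∉ g → hh u ζ x = hh' u ζ x := fun x => hh_off_eq H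
  have rl : EE (ind (QQ u ζ (c+1))) + EE (ind (QQ u ζ c)) = 2 := by
    have : EE (ind (QQ u ζ (c+1)) + ind (QQ u ζ c)) = EE (1 - ind g) := by
      apply EE_congr
      intro x hx
      simp only [Pi.add_apply, Pi.sub_apply, Pi.one_apply]
      by_cases h : x ∈ g
      · rw [ind_not (fun h' : x ∈ QQ u ζ (c+1) => h'.2.1 h), ind_not (fun h' : x ∈ QQ u ζ c => h'.2.1 h), ind_mem h]; ring
      · rcases (c1 x hx).1 with h1 | h1
        · rw [ind_not (s := QQ u ζ (c+1)) (fun h' => by have := h'.2.2; rw [h1] at this; linarith), ind_mem (s := QQ u ζ c) ⟨hx, h, h1⟩, ind_not h]; ring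
        · rw [ind_not (s := QQ u ζ c) (fun h' => by have := h'.2.2; rw [h1] at this; linarith), ind_mem (s := QQ u ζ (c+1)) ⟨hx, h, h1⟩, ind_not h]; ring
    rw [map_add, map_sub, EE_one, hg, G.EE_PP] at this
    linarith
  have hR1 : EE (ind (QQ u ζ (c+1))) = 1 := by linarith
  have eR : EE (ind (QQ u ζ (c+1))) = beta u ζ - 2 * c + kq u / 2 := by
    have : EE (ind (QQ u ζ (c+1))) = EE ((hh u ζ - (c:ℚ) • 1) - (hh u ζ - (c:ℚ) • 1) * ind g) := by
      apply EE_congr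
      intro x hx
      simp only [Pi.mul_apply, Pi.sub_apply, Pi.smul_apply, Pi.one_apply, smul_eq_mul, mul_one]
      by_cases h : x ∈ g
      · rw [ind_not (fun h' : x ∈ QQ u ζ (c+1) => h'.2.1 h), ind_mem h]; ring
      · rcases (c1 x hx).1 with h1 | h1
        · rw [ind_not (s := QQ u ζ (c+1)) (fun h' => by have := h'.2.2; rw [h1] at this; linarith), ind_not h, h1]; ring
        · rw [ind_mem (s := QQ u ζ (c+1)) ⟨hx, h, h1⟩, ind_not h, h1]; ring
    rw [this, map_sub, EE_cells G c (fun i x hx => (c3 i x hx).1) (fun i x hx => (c4 i x hx).1), map_sub, map_smul, EE_one, EE_hh H]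
    simp only [smul_eq_mul]; ring
  have eH : EE (hh u ζ * hh' u ζ) = 2 * c * beta u ζ - 2 * c^2 + EE (ind (QQ u ζ (c+1))) := by
    have : EE (hh u ζ * hh' u ζ) = EE ((c:ℚ) • hh u ζ + (c:ℚ) • hh' u ζ - ((c:ℚ)^2) • 1 + ind (QQ u ζ (c+1))) := by
      apply EE_congr
      intro x hx
      simp only [Pi.mul_apply, Pi.add_apply, Pi.sub_apply, Pi.smul_apply, Pi.one_apply, smul_eq_mul, mul_one]
      by_cases h : x ∈ g
      · rw [ind_not (fun h' : x ∈ QQ u ζ (c+1) => h'.2.1 h)]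
        have := (c2 x h).mn
        obtain ⟨h1, h2⟩ := c1 x hx
        rcases h1 with h1 | h1
        · rw [h1]; ring
        · rcases h2 with h2 | h2
          · rw [h2]; ring
          · rw [h1, h2, min_self] at this; linarith
      · rw [← hoff x hx h]
        rcases (c1 x hx).1 with h1 | h1
        · rw [ind_not (s := QQ u ζ (c+1)) (fun h' => by have := h'.2.2; rw [h1] at this; linarith), h1]; ring
        · rw [ind_mem (s := QQ u ζ (c+1)) ⟨hx, h, h1⟩, h1]; ring
    rw [this, map_add, map_sub, map_add, map_smul, map_smul, map_smul, EE_hh H, EE_hh' H, EE_one]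
    simp only [smul_eq_mul]; ring
  have eF : EE (ff u ζ * ff' u ζ) = (2 * a + 1) * beta u ζ - 2 * a * (a + 1) := by
    have : EE (ff u ζ * ff' u ζ) = EE ((2 * (a:ℚ) + 1) • ff u ζ - ((a:ℚ) * (a+1)) • 1 - ((a:ℚ)+1) • ind (PP u)) := by
      apply EE_congr
      intro x hx
      rw [ff_sub H]
      simp only [Pi.mul_apply, Pi.add_apply, Pi.sub_apply, Pi.smul_apply, Pi.one_apply, smul_eq_mul, mul_one]
      by_cases h : x ∈ PP u
      · rw [ind_mem h, a2 x h]; ring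
      · rw [ind_not h]
        rcases a1 x hx with h1 | h1 <;> rw [h1] <;> ring
    rw [this, map_sub, map_sub, map_smul, map_smul, map_smul, EE_ff H, H.poly.EE_PP, EE_one]
    simp only [smul_eq_mul]; ring
  have eP := planch_u H
  rw [eH, eF, hR1, hb] at eP
  rw [hR1, hb] at eR
  have e1 : 2 * c * b - 2 * c^2 + 1 = (2 * a + 1) * b - 2 * a * (a+1) := by exact_mod_cast eP
  have e2 : (2 * (c - a) - 1) * ((2 * (c - a) + 1) - 2 * (b - 2 * a)) = 1 := by linarith
  rcases Int.eq_one_or_neg_one_of_mul_eq_one e2 with h | h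
  · left
    rw [h] at e2
    have h3 : b = 2 * c - 1 := by linarith
    rw [h3] at eR; push_cast at eR; linarith
  · right
    rw [h] at e2
    have h3 : b = 2 * c + 1 := by linarith
    intro ξ h0 hz hu
    have hN := hh_N hz hu
    rw [hb, h3] at hN
    push_cast at hN
    have b1 : hh u ζ ξ ≤ c + 1 := by rcases (c1 ξ h0).1 with h | h <;> linarith
    have b2 : hh u ζ (-ξ) ≤ c + 1 := by rcases (c1 (-ξ) (neg_ne_zero.2 h0)).1 with h | h <;> linarith
    linarith
end GS

namespace GS
open Filter Topology Module MeasureTheory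

def mu : Measure E3 := volume.restrict (Metric.ball 0 1)

instance mu_fin : IsFiniteMeasure mu := ⟨by
  rw [mu, Measure.restrict_apply_univ]; exact measure_ball_lt_top⟩

def VV : ℝ := mu.real Set.univ

theorem VV_pos : 0 < VV := by
  unfold VV
  rw [measureReal_def, mu, Measure.restrict_apply_univ]
  exact ENNReal.toReal_pos (Metric.measure_ball_pos _ _ one_pos).ne' measure_ball_lt_top.ne

theorem mu_null {a : E3} (h : a ≠ 0) : mu {x | ⟪a, x⟫ = 0} = 0 := by
  apply le_antisymm _ (zero_le)
  refine (Measure.restrict_apply_le _ _).trans ?_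
  have : {x : E3 | ⟪a, x⟫ = 0} = (LinearMap.ker (innerSL ℝ a).toLinearMap : Set E3) := by
    ext x; simp
  rw [this, Measure.addHaar_submodule]
  intro ht
  have : a ∈ LinearMap.ker (innerSL ℝ a).toLinearMap := ht ▸ trivial
  simp at this
  exact h this

theorem mu_iso (e : E3 ≃ₗᵢ[ℝ] E3) {s : Set E3} (hs : MeasurableSet s) : mu (e ⁻¹' s) = mu s := by
  have h := e.measurePreserving
  rw [mu, Measure.restrict_apply (e.continuous.measurable hs), Measure.restrict_apply hs, ← h.measure_preimage (hs.inter measurableSet_ball).nullMeasurableSet]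
  congr 1
  ext x
  simp [e.norm_map]

def ee (p q : E3) (t : ℝ) : E3 := Real.cos t • p + Real.sin t • q
def DD (a b : E3) : Set E3 := {x | ⟪a, x⟫ * ⟪b, x⟫ < 0}

theorem DD_meas (a b : E3) : MeasurableSet (DD a b) := by
  apply IsOpen.measurableSet
  exact isOpen_lt (by fun_prop) continuous_const

section
variable {p q : E3} (hp : ⟪p, p⟫ = 1) (hq : ⟪q, q⟫ = 1) (hpq : ⟪p, q⟫ = 0)
include hp hq hpq

theorem ee_inner (s t : ℝ) : ⟪ee p q s, ee p q t⟫ = Real.cos (s - t) := by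
  have hqp : ⟪q, p⟫ = 0 := by rw [real_inner_comm]; exact hpq
  simp only [ee, inner_add_left, inner_add_right, inner_smul_left, inner_smul_right, hp, hq, hpq, hqp, Real.cos_sub]
  simp; ring

theorem ee_ne (s : ℝ) : ee p q s ≠ 0 := by
  intro h
  have := ee_inner hp hq hpq s s
  rw [h] at this; simp at this

theorem refl_ee (φ θ : ℝ) : ∃ e : E3 ≃ₗᵢ[ℝ] E3, ∀ t x, ⟪ee p q t, e x⟫ = ⟪ee p q (φ - t), x⟫ := by
  set f := ee p q (φ/2 + Real.pi/2) with hf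
  have hff : ⟪f, f⟫ = 1 := by rw [hf, ee_inner hp hq hpq]; simp
  refine ⟨(Submodule.reflection (ℝ ∙ f)ᗮ), fun t x => ?_⟩
  have h1 : ⟪ee p q t, (Submodule.reflection (ℝ ∙ f)ᗮ) x⟫ = ⟪(Submodule.reflection (ℝ ∙ f)ᗮ) (ee p q t), x⟫ := by
    have := (Submodule.reflection (ℝ ∙ f)ᗮ).inner_map_map (ee p q t) ((Submodule.reflection (ℝ ∙ f)ᗮ) x)
    rw [Submodule.reflection_reflection] at this
    exact this.symm
  rw [h1]
  congr 1
  rw [Submodule.reflection_orthogonal_apply, Submodule.reflection_singleton_apply]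
  have hn : ‖f‖ = 1 := by
    have := real_inner_self_eq_norm_sq f
    rw [hff] at this
    have := norm_nonneg f
    nlinarith
  rw [hn, hf, ee_inner hp hq hpq]
  have c1 : Real.cos (φ/2 + Real.pi/2 - t) = - Real.sin (φ/2 - t) := by
    rw [← Real.cos_add_pi_div_two]; congr 1; ring
  have c2 : Real.cos (φ - t) = Real.cos (φ/2) * Real.cos (φ/2 - t) - Real.sin (φ/2) * Real.sin (φ/2 - t) := by
    rw [← Real.cos_add]; congr 1; ring
  have c3 : Real.sin (φ - t) = Real.sin (φ/2) * Real.cos (φ/2 - t) + Real.cos (φ/2) * Real.sin (φ/2 - t) := by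
    rw [← Real.sin_add]; congr 1; ring
  have c4 : Real.cos t = Real.cos (φ/2) * Real.cos (φ/2 - t) + Real.sin (φ/2) * Real.sin (φ/2 - t) := by
    rw [← Real.cos_sub]; congr 1; ring
  have c5 : Real.sin t = Real.sin (φ/2) * Real.cos (φ/2 - t) - Real.cos (φ/2) * Real.sin (φ/2 - t) := by
    rw [← Real.sin_sub]; congr 1; ring
  simp only [ee]
  rw [c1, c2, c3, c4, c5, Real.cos_add_pi_div_two, Real.sin_add_pi_div_two]
  simp only [RCLike.ofReal_one, one_pow, div_one]
  module

theorem DD_shift (s t : ℝ) : mu.real (DD (ee p q s) (ee p q (s+t))) = mu.real (DD (ee p q 0) (ee p q t)) := by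
  obtain ⟨e, he⟩ := refl_ee hp hq hpq (s+t) 0
  rw [measureReal_def, measureReal_def, ← mu_iso e (DD_meas (ee p q 0) (ee p q t))]
  congr 2
  ext x
  simp only [DD, Set.mem_setOf_eq, Set.mem_preimage, he, sub_zero, add_sub_cancel_right]
  rw [mul_comm]

omit hp hq hpq in
theorem ee_rel (s t : ℝ) (x : E3) :
    Real.sin t * ⟪ee p q 0, x⟫ + Real.sin s * ⟪ee p q (s+t), x⟫ = Real.sin (s+t) * ⟪ee p q s, x⟫ := by
  simp only [ee, inner_add_left, inner_smul_left, Real.cos_zero, Real.sin_zero, Real.cos_add, Real.sin_add]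
  simp
  linear_combination (⟪p, x⟫ * (-Real.sin t)) * Real.sin_sq_add_cos_sq s

theorem G_super {s t : ℝ} (hs : 0 < s) (ht : 0 < t) (hst : s + t < Real.pi) :
    mu.real (DD (ee p q 0) (ee p q s)) + mu.real (DD (ee p q 0) (ee p q t)) ≤ mu.real (DD (ee p q 0) (ee p q (s+t))) := by
  have s1 : 0 < Real.sin s := Real.sin_pos_of_pos_of_lt_pi hs (by linarith)
  have s2 : 0 < Real.sin t := Real.sin_pos_of_pos_of_lt_pi ht (by linarith)
  have s3 : 0 < Real.sin (s+t) := Real.sin_pos_of_pos_of_lt_pi (by linarith) hst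
  rw [← DD_shift hp hq hpq s t]
  rw [← measureReal_union _ (DD_meas _ _)]
  · refine measureReal_mono ?_
    rintro x (h | h)
    · have := ee_rel (p := p) (q := q) s t x
      simp only [DD, Set.mem_setOf_eq] at h ⊢
      rcases mul_neg_iff.1 h with ⟨h1, h2⟩ | ⟨h1, h2⟩
      · refine mul_neg_iff.2 (Or.inl ⟨h1, ?_⟩)
        by_contra h3; push Not at h3
        have := mul_pos s2 h1; have := mul_nonneg s1.le h3; have := mul_neg_of_pos_of_neg s3 h2; linarith
      · refine mul_neg_iff.2 (Or.inr ⟨h1, ?_⟩)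
        by_contra h3; push Not at h3
        have := mul_neg_of_pos_of_neg s2 h1; have := mul_nonpos_of_nonneg_of_nonpos s1.le h3; have := mul_pos s3 h2; linarith
    · have := ee_rel (p := p) (q := q) s t x
      simp only [DD, Set.mem_setOf_eq] at h ⊢
      rcases mul_neg_iff.1 h with ⟨h1, h2⟩ | ⟨h1, h2⟩
      · refine mul_neg_iff.2 (Or.inl ⟨?_, h2⟩)
        by_contra h3; push Not at h3
        have := mul_nonpos_of_nonneg_of_nonpos s2.le h3; have := mul_neg_of_pos_of_neg s1 h2; have := mul_pos s3 h1; linarith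
      · refine mul_neg_iff.2 (Or.inr ⟨?_, h2⟩)
        by_contra h3; push Not at h3
        have := mul_nonneg s2.le h3; have := mul_pos s1 h2; have := mul_neg_of_pos_of_neg s3 h1; linarith
  · rw [Set.disjoint_left]
    intro x h h'
    have := ee_rel (p := p) (q := q) s t x
    simp only [DD, Set.mem_setOf_eq] at h h'
    rcases mul_neg_iff.1 h with ⟨h1, h2⟩ | ⟨h1, h2⟩
    · have h3 : 0 < ⟪ee p q (s+t), x⟫ := by by_contra h3; push Not at h3; nlinarith
      have := mul_pos s2 h1; have := mul_pos s1 h3; have := mul_neg_of_pos_of_neg s3 h2; linarith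
    · have h3 : ⟪ee p q (s+t), x⟫ < 0 := by by_contra h3; push Not at h3; nlinarith
      have := mul_neg_of_pos_of_neg s2 h1; have := mul_neg_of_pos_of_neg s1 h3; have := mul_pos s3 h2; linarith

theorem G_sub (s t : ℝ) :
    mu.real (DD (ee p q 0) (ee p q (s+t))) ≤ mu.real (DD (ee p q 0) (ee p q s)) + mu.real (DD (ee p q 0) (ee p q t)) := by
  rw [← DD_shift hp hq hpq s t]
  have h0 : mu.real {x | ⟪ee p q s, x⟫ = 0} = 0 := by rw [measureReal_def, mu_null (ee_ne hp hq hpq s)]; rfl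
  have : DD (ee p q 0) (ee p q (s+t)) ⊆ (DD (ee p q 0) (ee p q s) ∪ DD (ee p q s) (ee p q (s+t))) ∪ {x | ⟪ee p q s, x⟫ = 0} := by
    intro x h
    simp only [DD, Set.mem_union, Set.mem_setOf_eq] at h ⊢
    rcases lt_trichotomy ⟪ee p q s, x⟫ 0 with h1 | h1 | h1
    · rcases mul_neg_iff.1 h with ⟨h2, h3⟩ | ⟨h2, h3⟩
      · exact Or.inl (Or.inl (mul_neg_of_pos_of_neg h2 h1))
      · exact Or.inl (Or.inr (mul_neg_of_neg_of_pos h1 h3))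
    · exact Or.inr h1
    · rcases mul_neg_iff.1 h with ⟨h2, h3⟩ | ⟨h2, h3⟩
      · exact Or.inl (Or.inr (mul_neg_of_pos_of_neg h1 h3))
      · exact Or.inl (Or.inl (mul_neg_of_neg_of_pos h2 h1))
  have h1 := measureReal_mono (μ := mu) this
  have h2 := measureReal_union_le (μ := mu) (DD (ee p q 0) (ee p q s) ∪ DD (ee p q s) (ee p q (s+t))) {x | ⟪ee p q s, x⟫ = 0}
  have h3 := measureReal_union_le (μ := mu) (DD (ee p q 0) (ee p q s)) (DD (ee p q s) (ee p q (s+t)))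
  linarith

theorem G_pi : mu.real (DD (ee p q 0) (ee p q Real.pi)) = VV := by
  have h0 : mu.real {x | ⟪ee p q 0, x⟫ = 0} = 0 := by rw [measureReal_def, mu_null (ee_ne hp hq hpq 0)]; rfl
  apply le_antisymm (measureReal_mono (Set.subset_univ _))
  have : Set.univ ⊆ DD (ee p q 0) (ee p q Real.pi) ∪ {x | ⟪ee p q 0, x⟫ = 0} := by
    intro x _
    by_cases h : ⟪ee p q 0, x⟫ = 0
    · exact Or.inr h
    · left
      have e : ee p q Real.pi = - ee p q 0 := by simp [ee]
      simp only [DD, Set.mem_setOf_eq, e, inner_neg_left]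
      have := mul_self_pos.2 h; linarith
  have h1 := measureReal_mono (μ := mu) this
  have h3 := measureReal_union_le (μ := mu) (DD (ee p q 0) (ee p q Real.pi)) {x | ⟪ee p q 0, x⟫ = 0}
  linarith

theorem G_low {N : ℕ} (hN : 0 < N) : VV ≤ N * mu.real (DD (ee p q 0) (ee p q (Real.pi / N))) := by
  have : ∀ k : ℕ, mu.real (DD (ee p q 0) (ee p q (k * (Real.pi / N)))) ≤ k * mu.real (DD (ee p q 0) (ee p q (Real.pi / N))) := by
    intro k
    induction k with
    | zero =>
      have : DD (ee p q 0) (ee p q 0) = ∅ := by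
        ext x; simp only [DD, Set.mem_setOf_eq, Set.mem_empty_iff_false, iff_false, not_lt]; exact mul_self_nonneg _
      simp [this]
    | succ k ih =>
      have := G_sub hp hq hpq (k * (Real.pi / N)) (Real.pi / N)
      push_cast
      rw [show ((k:ℝ) + 1) * (Real.pi / N) = k * (Real.pi / N) + Real.pi / N by ring]
      linarith
  have h := this N
  have hN' : (N:ℝ) ≠ 0 := by positivity
  rwa [mul_div_cancel₀ _ hN', G_pi hp hq hpq] at h

theorem G_mul {h : ℝ} (h0 : 0 < h) (k : ℕ) (hk : (k+1 : ℕ) * h < Real.pi) :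
    (k+1 : ℕ) * mu.real (DD (ee p q 0) (ee p q h)) ≤ mu.real (DD (ee p q 0) (ee p q ((k+1 : ℕ) * h))) := by
  induction k with
  | zero => simp
  | succ k ih =>
    have e : ((k+1+1:ℕ):ℝ) * h = ((k+1:ℕ):ℝ) * h + h := by push_cast; ring
    rw [e] at hk ⊢
    have := G_super hp hq hpq (s := ((k+1:ℕ):ℝ) * h) (t := h) (by positivity) h0 hk
    have := ih (by linarith)
    push_cast at *
    linarith

theorem G_ge {α : ℝ} (h0 : 0 < α) (h1 : α < Real.pi) : α / Real.pi * VV ≤ mu.real (DD (ee p q 0) (ee p q α)) := by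
  have hpi := Real.pi_pos
  have key : ∀ N : ℕ, 0 < N → α / Real.pi * VV - VV / N ≤ mu.real (DD (ee p q 0) (ee p q α)) := by
    intro N hN
    have hNr : (0:ℝ) < N := by positivity
    obtain ⟨k, hk1, hk2⟩ : ∃ k : ℕ, (k:ℝ) * (Real.pi / N) < α ∧ α ≤ ((k:ℝ)+1) * (Real.pi / N) := by
      have hpos : 0 < α / (Real.pi / N) := by positivity
      have hc : 0 < ⌈α / (Real.pi / N)⌉₊ := Nat.ceil_pos.2 hpos
      refine ⟨⌈α / (Real.pi / N)⌉₊ - 1, ?_, ?_⟩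
      · rw [← lt_div_iff₀ (by positivity)]
        have := Nat.ceil_lt_add_one hpos.le
        rw [Nat.cast_sub hc]; push_cast; linarith
      · rw [← div_le_iff₀ (by positivity)]
        have := Nat.le_ceil (α / (Real.pi / N))
        rw [Nat.cast_sub hc]; push_cast; linarith
    have hb : α / Real.pi - 1 / N ≤ k / N := by
      have : α / Real.pi ≤ (k + 1) / N := by
        rw [div_le_iff₀ hpi]; calc α ≤ _ := hk2
          _ = _ := by ring
      rw [add_div] at this; linarith
    have hV := VV_pos
    have hgoal : (k / N : ℝ) * VV ≤ mu.real (DD (ee p q 0) (ee p q α)) := by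
      rcases Nat.eq_zero_or_pos k with rfl | hkp
      · simp
      · obtain ⟨j, rfl⟩ : ∃ j, k = j + 1 := ⟨k - 1, by omega⟩
        have hh : 0 < Real.pi / N := by positivity
        have g1 := G_mul hp hq hpq hh j (by linarith)
        have g2 := G_low hp hq hpq hN
        have g3 := G_super hp hq hpq (s := ((j+1:ℕ):ℝ) * (Real.pi / N)) (t := α - ((j+1:ℕ):ℝ) * (Real.pi / N)) (by positivity) (by linarith) (by linarith)
        rw [add_sub_cancel] at g3
        have g4 : 0 ≤ mu.real (DD (ee p q 0) (ee p q (α - ((j+1:ℕ):ℝ) * (Real.pi / N)))) := measureReal_nonneg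
        have g5 : VV / N ≤ mu.real (DD (ee p q 0) (ee p q (Real.pi / N))) := by
          rw [div_le_iff₀ hNr]; linarith
        have g6 := mul_le_mul_of_nonneg_left g5 (by positivity : (0:ℝ) ≤ ((j+1:ℕ):ℝ))
        calc _ = ((j+1:ℕ):ℝ) * (VV / N) := by ring
          _ ≤ _ := by linarith
    have := mul_le_mul_of_nonneg_right hb hV.le
    calc _ = (α / Real.pi - 1 / N) * VV := by ring
      _ ≤ _ := by linarith
  have ht : Tendsto (fun N : ℕ => α / Real.pi * VV - VV / N) atTop (𝓝 (α / Real.pi * VV - 0)) :=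
    tendsto_const_nhds.sub (tendsto_const_div_atTop_nhds_zero_nat VV)
  rw [sub_zero] at ht
  exact le_of_tendsto ht (eventually_atTop.2 ⟨1, fun N hN => key N hN⟩)
end

theorem DD_ge {a b : E3} (h : LinearIndependent ℝ ![a, b]) : InnerProductGeometry.angle a b / Real.pi * VV ≤ mu.real (DD a b) := by
  rw [LinearIndependent.pair_iff] at h
  have ha : a ≠ 0 := by rintro rfl; have := h 1 0; simp at this
  have hb : b ≠ 0 := by rintro rfl; have := h 0 1; simp at this
  set α := InnerProductGeometry.angle a b with hα
  have h0 : α ≠ 0 := by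
    intro h'
    obtain ⟨-, r, hr, hr'⟩ := InnerProductGeometry.angle_eq_zero_iff.1 h'
    have := (h r (-1) (by rw [hr']; module)).2
    norm_num at this
  have h1 : α ≠ Real.pi := by
    intro h'
    obtain ⟨-, r, hr, hr'⟩ := InnerProductGeometry.angle_eq_pi_iff.1 h'
    have := (h r (-1) (by rw [hr']; module)).2
    norm_num at this
  have h0' : 0 < α := lt_of_le_of_ne (InnerProductGeometry.angle_nonneg a b) (Ne.symm h0)
  have h1' : α < Real.pi := lt_of_le_of_ne (InnerProductGeometry.angle_le_pi a b) h1
  have hs : 0 < Real.sin α := Real.sin_pos_of_pos_of_lt_pi h0' h1'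
  have hna : 0 < ‖a‖ := norm_pos_iff.2 ha
  have hnb : 0 < ‖b‖ := norm_pos_iff.2 hb
  have hc : ⟪a, b⟫ = Real.cos α * (‖a‖ * ‖b‖) := (InnerProductGeometry.cos_angle_mul_norm_mul_norm a b).symm
  set p := ‖a‖⁻¹ • a with hp
  set q := (Real.sin α)⁻¹ • (‖b‖⁻¹ • b - Real.cos α • p) with hq
  have hpp : ⟪p, p⟫ = 1 := by
    rw [hp, inner_smul_left, inner_smul_right, real_inner_self_eq_norm_sq]; simp; field_simp
  have hpb : ⟪p, b⟫ = Real.cos α * ‖b‖ := by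
    rw [hp, inner_smul_left, hc]; simp; field_simp
  have hbp : ⟪b, p⟫ = Real.cos α * ‖b‖ := by rw [real_inner_comm, hpb]
  have hpq : ⟪p, q⟫ = 0 := by
    rw [hq, inner_smul_right, inner_sub_right, inner_smul_right, inner_smul_right, hpp, hpb]; field_simp; ring
  have hqq : ⟪q, q⟫ = 1 := by
    have : ⟪‖b‖⁻¹ • b - Real.cos α • p, ‖b‖⁻¹ • b - Real.cos α • p⟫ = Real.sin α ^ 2 := by
      simp only [inner_sub_left, inner_sub_right, real_inner_smul_left, real_inner_smul_right, hpp, hpb, hbp, real_inner_self_eq_norm_sq b]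
      have := Real.sin_sq_add_cos_sq α
      field_simp
      linarith
    rw [hq, real_inner_smul_left, real_inner_smul_right, this]; field_simp
  have e1 : a = ‖a‖ • ee p q 0 := by
    simp only [ee, Real.cos_zero, Real.sin_zero, one_smul, zero_smul, add_zero, hp, smul_smul]
    rw [one_mul, mul_inv_cancel₀ hna.ne', one_smul]
  have e2 : b = ‖b‖ • ee p q α := by
    simp only [ee, hq, smul_smul, mul_inv_cancel₀ hs.ne', one_smul, add_sub_cancel]
    rw [mul_inv_cancel₀ hnb.ne', one_smul]
  have e3 : DD a b = DD (ee p q 0) (ee p q α) := by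
    ext x
    simp only [DD, Set.mem_setOf_eq]
    have : ⟪a, x⟫ * ⟪b, x⟫ = (‖a‖ * ‖b‖) * (⟪ee p q 0, x⟫ * ⟪ee p q α, x⟫) := by
      conv_lhs => rw [e1, e2]
      rw [real_inner_smul_left, real_inner_smul_left]; ring
    rw [this]
    have hab := mul_pos hna hnb
    constructor
    · intro h; by_contra h'; push Not at h'; have := mul_nonneg hab.le h'; linarith
    · intro h; exact mul_neg_of_pos_of_neg hab h
  rw [e3]
  exact G_ge hpp hqq hpq h0' h1'

theorem crofton {n : ℕ} [NeZero n] {u : ZMod n → E3} {ζ : E3} (hli : ∀ i, LinearIndependent ℝ ![u i, u (i+1)]) (hz : ζ ≠ 0)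
    (hu : ∀ i, u i ≠ 0)
    (h : ∀ ξ, ξ ≠ 0 → ⟪ζ, ξ⟫ ≠ 0 → (∀ i, ⟪u i, ξ⟫ ≠ 0) → ∑ i, dd u i ξ ≤ 2) :
    ∑ i, InnerProductGeometry.angle (u i) (u (i+1)) ≤ 2 * Real.pi := by
  have hpi := Real.pi_pos
  have h1 : ∑ i, mu.real (DD (u i) (u (i+1))) ≤ 2 * VV := by
    have hig : ∀ i, Integrable ((DD (u i) (u (i+1))).indicator (fun _ => (1:ℝ))) mu := fun i =>
      (integrable_const 1).indicator (DD_meas _ _)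
    have e : ∑ i, mu.real (DD (u i) (u (i+1))) = ∫ x, ∑ i, (DD (u i) (u (i+1))).indicator (fun _ => (1:ℝ)) x ∂mu := by
      rw [integral_finsetSum _ (fun i _ => hig i)]
      apply Finset.sum_congr rfl
      intro i _
      rw [integral_indicator (DD_meas _ _)]; simp
    have e2 : 2 * VV = ∫ x : E3, (2:ℝ) ∂mu := by simp [VV, mul_comm]
    rw [e, e2]
    apply integral_mono_ae (integrable_finsetSum _ (fun i _ => hig i)) (integrable_const 2)
    have n1 : ∀ᵐ x ∂mu, ⟪ζ, x⟫ ≠ 0 := by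
      rw [ae_iff]; simpa using mu_null hz
    have n2 : ∀ᵐ x ∂mu, ∀ i, ⟪u i, x⟫ ≠ 0 := by
      rw [ae_all_iff]; intro i; rw [ae_iff]; simpa using mu_null (hu i)
    filter_upwards [n1, n2] with x x1 x2
    have hx0 : x ≠ 0 := by rintro rfl; simp at x1
    have := h x hx0 x1 x2
    have e3 : ∀ i, (DD (u i) (u (i+1))).indicator (fun _ => (1:ℝ)) x = ((dd u i x : ℚ) : ℝ) := by
      intro i
      classical
      simp only [Set.indicator_apply, DD, Set.mem_setOf_eq, dd, aa]
      rcases lt_or_gt_of_ne (x2 i) with h1 | h1 <;> rcases lt_or_gt_of_ne (x2 (i+1)) with h2 | h2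
      · rw [if_neg (by have := mul_pos_of_neg_of_neg h1 h2; linarith), if_pos h1.le, if_pos h2.le]; norm_num
      · rw [if_pos (mul_neg_of_neg_of_pos h1 h2), if_pos h1.le, if_neg (by linarith)]; norm_num
      · rw [if_pos (mul_neg_of_pos_of_neg h1 h2), if_neg (by linarith), if_pos h2.le]; norm_num
      · rw [if_neg (by have := mul_pos h1 h2; linarith), if_neg (by linarith), if_neg (by linarith)]; norm_num
    simp only [e3]
    exact_mod_cast this
  have h2 : ∑ i, InnerProductGeometry.angle (u i) (u (i+1)) / Real.pi * VV ≤ 2 * VV :=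
    (Finset.sum_le_sum fun i _ => DD_ge (hli i)).trans h1
  rw [← Finset.sum_mul, ← Finset.sum_div] at h2
  have := le_of_mul_le_mul_right h2 VV_pos
  rwa [div_le_iff₀ hpi] at this
end GS

namespace GS
open Filter Topology Module

theorem cross_li {a b : E3} (h : LinearIndependent ℝ ![a, b]) : cross3 a b ≠ 0 := by
  intro hc
  rw [LinearIndependent.pair_iff] at h
  have ha : a ≠ 0 := by rintro rfl; have := h 1 0; simp at this
  obtain ⟨h0, h1, h2⟩ := cross3_apply a b
  rw [hc] at h0 h1 h2
  simp only [PiLp.zero_apply] at h0 h1 h2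
  have := (h (-⟪a, b⟫) ⟪a, a⟫ (by
    apply ext3 <;> simp only [inner3, PiLp.add_apply, PiLp.smul_apply, PiLp.zero_apply, smul_eq_mul]
    · linear_combination (a 1) * h2 - (a 2) * h1
    · linear_combination (a 2) * h0 - (a 0) * h2
    · linear_combination (a 0) * h1 - (a 1) * h0)).2
  exact (real_inner_self_pos.2 ha).ne' this

theorem cross_cross (a b c : E3) : cross3 (cross3 a b) (cross3 b c) = det3 a b c • b := by
  obtain ⟨h0, h1, h2⟩ := cross3_apply a b
  obtain ⟨k0, k1, k2⟩ := cross3_apply b c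
  obtain ⟨l0, l1, l2⟩ := cross3_apply (cross3 a b) (cross3 b c)
  apply ext3
  · rw [l0, h1, h2, k1, k2, PiLp.smul_apply, smul_eq_mul, det3_eq]; ring
  · rw [l1, h0, h2, k0, k2, PiLp.smul_apply, smul_eq_mul, det3_eq]; ring
  · rw [l2, h0, h1, k0, k1, PiLp.smul_apply, smul_eq_mul, det3_eq]; ring

theorem det_cross (a b c d : E3) : det3 (cross3 a b) (cross3 b c) (cross3 c d) = det3 a b c * det3 b c d := by
  rw [det3, cross_cross, inner_smul_right, det3_eq b c d]
  rw [inner3]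
  obtain ⟨h0, h1, h2⟩ := cross3_apply a b
  rw [h0, h1, h2, det3_eq]; ring

theorem lagr (a b : E3) : ⟪cross3 a b, cross3 a b⟫ = ⟪a, a⟫ * ⟪b, b⟫ - ⟪a, b⟫ ^ 2 := by
  obtain ⟨h0, h1, h2⟩ := cross3_apply a b
  simp only [inner3, h0, h1, h2]; ring

theorem unit_par {a b : E3} (ha : a ≠ 0) (hb : b ≠ 0) (h : cross3 a b = 0) :
    ‖b‖⁻¹ • b = ‖a‖⁻¹ • a ∨ ‖b‖⁻¹ • b = -(‖a‖⁻¹ • a) := by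
  have hl := lagr a b
  rw [h, inner_zero_left] at hl
  have hna : 0 < ‖a‖ := norm_pos_iff.2 ha
  have hnb : 0 < ‖b‖ := norm_pos_iff.2 hb
  rw [real_inner_self_eq_norm_sq, real_inner_self_eq_norm_sq] at hl
  have h1 : (⟪a, b⟫ - ‖a‖ * ‖b‖) * (⟪a, b⟫ + ‖a‖ * ‖b‖) = 0 := by linarith
  rcases mul_eq_zero.1 h1 with h2 | h2
  · left
    have h3 : ⟪a, b⟫ = ‖a‖ * ‖b‖ := by linarith
    rw [inner_eq_norm_mul_iff_real] at h3
    have : ‖b‖⁻¹ • b = (‖a‖⁻¹ * ‖b‖⁻¹) • (‖a‖ • b) := by rw [smul_smul]; congr 1; field_simp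
    rw [this, ← h3, smul_smul]; congr 1; field_simp
  · right
    have h3 : ⟪-a, b⟫ = ‖-a‖ * ‖b‖ := by rw [inner_neg_left, norm_neg]; linarith
    rw [inner_eq_norm_mul_iff_real, norm_neg] at h3
    have : ‖b‖⁻¹ • b = (‖a‖⁻¹ * ‖b‖⁻¹) • (‖a‖ • b) := by rw [smul_smul]; congr 1; field_simp
    rw [this, ← h3, smul_smul, smul_neg]; congr 2; field_simp

theorem hull_mem {v a b : E3} {s t : ℝ} (hs : 0 ≤ s) (ht : 0 ≤ t) (hst : s + t ≤ 1) :
    v + (s • (a - v) + t • (b - v)) ∈ convexHull ℝ {v, a, b} := by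
  have hc := convex_convexHull ℝ ({v, a, b} : Set E3)
  have hsub := subset_convexHull ℝ ({v, a, b} : Set E3)
  have := hc.sum_mem (t := Finset.univ) (w := ![1 - s - t, s, t]) (z := ![v, a, b])
    (by intro i _; fin_cases i <;> simp <;> linarith) (by simp [Fin.sum_univ_three]; ring)
    (by intro i _; apply hsub; fin_cases i <;> simp)
  rw [Fin.sum_univ_three] at this
  convert this using 1
  simp only [Matrix.cons_val_zero, Matrix.cons_val_one, Matrix.cons_val]
  module

theorem kk_face {v a b a' b' x : E3} (h : convexHull ℝ {v, a, b} ∩ convexHull ℝ {v, a', b'} = {v})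
    (h1 : x ∈ kk (a - v) (b - v)) (h2 : x ∈ kk (a' - v) (b' - v)) : x = 0 := by
  obtain ⟨s, t, hs, ht, hst, e⟩ := h1
  obtain ⟨s', t', hs', ht', hst', e'⟩ := h2
  have hM : 0 < s + t + (s' + t') := by linarith
  set M := s + t + (s' + t') with hMd
  have m1 : v + M⁻¹ • x ∈ convexHull ℝ {v, a, b} := by
    have := hull_mem (v := v) (a := a) (b := b) (s := M⁻¹ * s) (t := M⁻¹ * t) (by positivity) (by positivity)
      (by rw [← mul_add, inv_mul_le_iff₀ hM]; linarith)
    convert this using 2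
    rw [e]; module
  have m2 : v + M⁻¹ • x ∈ convexHull ℝ {v, a', b'} := by
    have := hull_mem (v := v) (a := a') (b := b') (s := M⁻¹ * s') (t := M⁻¹ * t') (by positivity) (by positivity)
      (by rw [← mul_add, inv_mul_le_iff₀ hM]; linarith)
    convert this using 2
    rw [e']; module
  have : v + M⁻¹ • x ∈ ({v} : Set E3) := h ▸ ⟨m1, m2⟩
  have h3 : M⁻¹ • x = 0 := by simpa using this
  exact (smul_eq_zero.1 h3).resolve_left (inv_ne_zero hM.ne')

theorem kk_ne {a b x : E3} (h : LinearIndependent ℝ ![a, b]) (hx : x ∈ kk a b) : x ≠ 0 := by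
  rintro rfl
  obtain ⟨s, t, hs, ht, hst, e⟩ := hx
  rw [LinearIndependent.pair_iff] at h
  obtain ⟨h1, h2⟩ := h s t e.symm
  linarith

theorem kk_arc {a b x : E3} (ha : a ≠ 0) (hb : b ≠ 0) (hx : x ∈ kk a b) :
    ‖x‖⁻¹ • x ∈ sArc (‖a‖⁻¹ • a) (‖b‖⁻¹ • b) := by
  obtain ⟨s, t, hs, ht, hst, e⟩ := hx
  have hna : 0 < ‖a‖ := norm_pos_iff.2 ha
  have hnb : 0 < ‖b‖ := norm_pos_iff.2 hb
  refine ⟨s * ‖a‖, t * ‖b‖, by positivity, by positivity, ?_, ?_⟩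
  · rcases hs.lt_or_eq with h | h
    · have := mul_pos h hna; have := mul_nonneg ht hnb.le; linarith
    · have : 0 < t := by linarith
      have := mul_pos this hnb; have := mul_nonneg hs hna.le; linarith
  · have : (s * ‖a‖) • ‖a‖⁻¹ • a + (t * ‖b‖) • ‖b‖⁻¹ • b = x := by
      rw [e, smul_smul, smul_smul, mul_assoc, mul_assoc, mul_inv_cancel₀ hna.ne', mul_inv_cancel₀ hnb.ne', mul_one, mul_one]
    rw [this]

theorem final {n : ℕ} [NeZero n] (v : E3) (w : ZMod n → E3)
    (hstar : IsStar v w) (hG : GaussEmb v w) (hK : curv v w < 0) :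
    {i : ZMod n | IsInflectionFace v w i}.ncard = 4 := by
  classical
  obtain ⟨hn, hli, hun, hfa⟩ := hstar
  obtain ⟨-, hga⟩ := hG
  set u : ZMod n → E3 := fun i => w i - v with hu
  have hm : ∀ i, starFN v w i = mm u i := fun i => rfl
  have hUN : ∀ i, starUN v w i = ‖mm u i‖⁻¹ • mm u i := fun i => rfl
  have hm0 : ∀ i, mm u i ≠ 0 := fun i => cross_li (hli i)
  have hS : ∀ i, sS u i ≠ 0 := by
    intro i h
    have h1 := cross_cross (u (i-1)) (u i) (u (i+1))
    rw [show det3 (u (i-1)) (u i) (u (i+1)) = 0 from h, zero_smul, ← mm_pred] at h1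
    have h2 := unit_par (hm0 (i-1)) (hm0 i) h1
    have h3 := hun (i-1)
    rw [sub_add_cancel] at h3
    rcases h2 with h2 | h2
    · exact h3.1 h2
    · exact h3.2 h2
  obtain ⟨ζ, hζ⟩ := (gen_dense hm0 0).exists
  have H : Hyp u ζ := by
    refine ⟨hn, hS, fun i => ?_, fun i j hij h1 h2 x hx hx' => ?_⟩
    · have := hζ i
      rwa [real_inner_comm] at this
    · exact kk_ne (hli i) hx (kk_face ((hfa i j hij).2.2 h1 h2) hx hx')
  have G : Poly (KK u) := by
    refine ⟨hn, fun i => ?_, fun i j hij h1 h2 x hx hx' => ?_⟩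
    · have e : det3 (KK u (i-1)) (KK u i) (KK u (i+1)) = sS u (i-1) * sS u i := by
        rw [KK_succ, KK, KK, mm_pred u (i-1), mm_pred u i, mm, det_cross, sS, sS, sub_add_cancel]
      rw [e]; exact mul_ne_zero (hS _) (hS _)
    · have a1 := kk_arc (hm0 (i-1)) (hm0 i) (by rwa [KK_succ] at hx)
      have a2 := kk_arc (hm0 (j-1)) (hm0 j) (by rwa [KK_succ] at hx')
      have := (hga (i-1) (j-1) (fun h => hij (sub_left_inj.1 h))).2.2
        (fun h => h1 (by rw [sub_add_cancel] at h; rw [← h, sub_add_cancel]))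
        (fun h => h2 (by rw [sub_add_cancel] at h; rw [← h, sub_add_cancel]))
      rw [sub_add_cancel, sub_add_cancel] at this
      have hmem : ‖x‖⁻¹ • x ∈ (∅ : Set E3) := this ▸ ⟨a1, a2⟩
      exact hmem
  have h4 : kq u = 4 := by
    rcases main_alt H G with h | h
    · exact h
    · exfalso
      have := crofton (fun i => hli i) H.zne H.une h
      unfold curv at hK
      linarith
  have hinf : ∀ i, IsInflectionFace v w i ↔ sS u i * sS u (i+1) < 0 := by
    intro i
    have e : ⟪w (i + 2) - v, starFN v w i⟫ = sS u (i+1) := by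
      rw [sS, add_sub_cancel_right, add_assoc, one_add_one_eq_two]
      change det3 (u (i+2)) (u i) (u (i+1)) = _
      rw [det3_eq, det3_eq]; ring
    unfold IsInflectionFace
    rw [e]
    rfl
  have hk : kq u = ∑ i, if IsInflectionFace v w i then (1:ℚ) else 0 := by
    unfold kq
    apply Finset.sum_congr rfl
    intro i _
    rw [hinf]
    unfold ss
    rw [← sg_mul]
    split_ifs with h
    · rw [sg_neg h]; norm_num
    · have := lt_of_le_of_ne (not_lt.1 h) (Ne.symm (mul_ne_zero (hS i) (hS (i+1))))
      rw [sg_pos this]; norm_num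
  rw [hk, Finset.sum_boole] at h4
  rw [← Set.ncard_coe_finset] at h4
  simp only [Finset.coe_filter, Finset.mem_univ, true_and] at h4
  exact_mod_cast h4
end GS

/-- Theorem 2.8 (ii), simplicial case: for an embedded, immersed simplicial vertex star
whose Gauss image has no self-intersections and whose discrete Gaussian curvature is
negative, exactly four of the faces are inflection faces. -/
theorem stmt4 {n : ℕ} [NeZero n] (v : E3) (w : ZMod n → E3)
    (hstar : IsStar v w) (hG : GaussEmb v w) (hK : curv v w < 0) :
    {i : ZMod n | IsInflectionFace v w i}.ncard = 4 := GS.final v w hstar hG hK
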